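/- For all positive integers n, m, k₁, k₂ (with D_𝓜 ≥ 1): c_{2k₁,2k₂} ≤ (Vol P̃os / Vol B_𝓜)^{1/D_𝓜} ≤ 2·(min(2k₁²/(2k₁²+n), 2k₂²/(2k₂²+m)))^{1/2}, where c_{2k₁,2k₂} = 3³·10^{−20/9}·max(n,m)^{−1/2} if k₁ = k₂ = 1, and c_{2k₁,2k₂} = e^{−3}·(2·⌈max(n,m)·ln(2·max(k₁,k₂)+1)⌉)^{−1/2} otherwise. -/

import Mathlib

open MeasureTheory MvPolynomial

noncomputable section

namespace BiformPaper

/-- The weight function on the variables: the `x`-variables get weight `(1,0)` and the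
`y`-variables get weight `(0,1)`. -/
def bw (n m : ℕ) : Fin n ⊕ Fin m → ℕ × ℕ := Sum.elim (fun _ => (1, 0)) (fun _ => (0, 1))

/-- The set of biforms of bidegree `(k₁, k₂)`: real polynomials in
`x = (x₁, …, xₙ)` and `y = (y₁, …, y_m)`, homogeneous of degree `k₁` in `x` and of degree
`k₂` in `y`. -/
def Biform (n m k₁ k₂ : ℕ) : Set (MvPolynomial (Fin n ⊕ Fin m) ℝ) :=
  {f | MvPolynomial.IsWeightedHomogeneous (bw n m) f (k₁, k₂)}

/-- Evaluation of a polynomial at a point `(x, y) ∈ ℝⁿ × ℝᵐ`. -/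
def beval {n m : ℕ} (f : MvPolynomial (Fin n ⊕ Fin m) ℝ) (x : Fin n → ℝ) (y : Fin m → ℝ) : ℝ :=
  eval (Sum.elim x y) f

/-- The Euclidean unit sphere `S^{n-1}` in `ℝⁿ`. -/
def unitSphere (n : ℕ) : Set (Fin n → ℝ) := {x | ∑ i, x i ^ 2 = 1}

/-- `σ` is the normalized uniform measure on the unit sphere `S^{n-1} ⊆ ℝⁿ`, i.e., the
unique rotation-invariant Borel probability measure concentrated on the sphere. -/
structure IsSphereMeasure (n : ℕ) (σ : Measure (Fin n → ℝ)) : Prop where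
  prob : IsProbabilityMeasure σ
  onSphere : σ (unitSphere n)ᶜ = 0
  invariant : ∀ Q : Matrix (Fin n) (Fin n) ℝ, Q * Q.transpose = 1 → σ.map Q.mulVec = σ

/-- The average `∫_T f dσ` of `f` over `T = S^{n-1} × S^{m-1}` (with `σ` the product of the
normalized sphere measures `σ₁`, `σ₂`). -/
def bavg {n m : ℕ} (σ₁ : Measure (Fin n → ℝ)) (σ₂ : Measure (Fin m → ℝ))
    (f : MvPolynomial (Fin n ⊕ Fin m) ℝ) : ℝ :=
  ∫ x, ∫ y, beval f x y ∂σ₂ ∂σ₁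

/-- The `L²(σ)` inner product `⟨f, g⟩ = ∫_T f·g dσ` on biforms. -/
def bip {n m : ℕ} (σ₁ : Measure (Fin n → ℝ)) (σ₂ : Measure (Fin m → ℝ))
    (f g : MvPolynomial (Fin n ⊕ Fin m) ℝ) : ℝ :=
  ∫ x, ∫ y, beval f x y * beval g x y ∂σ₂ ∂σ₁

/-- The cone `Pos^{(n,m)}_{(2k₁,2k₂)}` of nonnegative biforms of bidegree `(2k₁, 2k₂)`. -/
def PosSet (n m k₁ k₂ : ℕ) : Set (MvPolynomial (Fin n ⊕ Fin m) ℝ) :=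
  {f | f ∈ Biform n m (2 * k₁) (2 * k₂) ∧ ∀ x y, 0 ≤ beval f x y}

/-- The cone `Sq^{(n,m)}_{(2k₁,2k₂)}` of finite sums of squares of biforms of bidegree
`(k₁, k₂)`. -/
def SqSet (n m k₁ k₂ : ℕ) : Set (MvPolynomial (Fin n ⊕ Fin m) ℝ) :=
  {f | ∃ (N : ℕ) (g : Fin N → MvPolynomial (Fin n ⊕ Fin m) ℝ),
      (∀ i, g i ∈ Biform n m k₁ k₂) ∧ f = ∑ i, g i ^ 2}

/-- The cone `Lf^{(n,m)}_{(2k₁,2k₂)}` of finite sums of products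
`ℓᵢ(x)^{2k₁} · ℓ′ᵢ(y)^{2k₂}` of even powers of linear forms. -/
def LfSet (n m k₁ k₂ : ℕ) : Set (MvPolynomial (Fin n ⊕ Fin m) ℝ) :=
  {f | ∃ (N : ℕ) (a : Fin N → Fin n → ℝ) (b : Fin N → Fin m → ℝ),
      f = ∑ r, (∑ i, C (a r i) * X (Sum.inl i)) ^ (2 * k₁) *
               (∑ j, C (b r j) * X (Sum.inr j)) ^ (2 * k₂)}

/-- The biform `q = (x₁² + ⋯ + xₙ²)^{k₁} · (y₁² + ⋯ + y_m²)^{k₂}`. -/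
def qpoly (n m k₁ k₂ : ℕ) : MvPolynomial (Fin n ⊕ Fin m) ℝ :=
  (∑ i : Fin n, X (Sum.inl i) ^ 2) ^ k₁ * (∑ j : Fin m, X (Sum.inr j) ^ 2) ^ k₂

/-- The hyperplane `𝓜` of biforms of bidegree `(2k₁, 2k₂)` with average `0` on `T`. -/
def MSet (n m k₁ k₂ : ℕ) (σ₁ : Measure (Fin n → ℝ)) (σ₂ : Measure (Fin m → ℝ)) :
    Set (MvPolynomial (Fin n ⊕ Fin m) ℝ) :=
  {f | f ∈ Biform n m (2 * k₁) (2 * k₂) ∧ bavg σ₁ σ₂ f = 0}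

/-- The translated section `K̃ = {f ∈ 𝓜 : f + q ∈ K}` of a cone `K`. -/
def tilde (n m k₁ k₂ : ℕ) (σ₁ : Measure (Fin n → ℝ)) (σ₂ : Measure (Fin m → ℝ))
    (K : Set (MvPolynomial (Fin n ⊕ Fin m) ℝ)) : Set (MvPolynomial (Fin n ⊕ Fin m) ℝ) :=
  {f | f ∈ MSet n m k₁ k₂ σ₁ σ₂ ∧ f + qpoly n m k₁ k₂ ∈ K}

/-- The unit ball `B_𝓜` of `𝓜` in the `L²(σ)` norm. -/
def bball (n m k₁ k₂ : ℕ) (σ₁ : Measure (Fin n → ℝ)) (σ₂ : Measure (Fin m → ℝ)) :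
    Set (MvPolynomial (Fin n ⊕ Fin m) ℝ) :=
  {f | f ∈ MSet n m k₁ k₂ σ₁ σ₂ ∧ bip σ₁ σ₂ f f ≤ 1}

/-- `ψ : ℝ^D → Mset` is a unitary isomorphism: an injective linear map with range `Mset`
carrying the standard inner product of `ℝ^D` to the `L²(σ)` inner product.  Volumes of
Borel subsets `E` of `Mset` are computed as the Lebesgue measure of `ψ ⁻¹' E`
(by Lemma 1.1 of the paper this does not depend on the choice of `ψ`). -/
structure IsUnitaryParam (n m D : ℕ) (σ₁ : Measure (Fin n → ℝ)) (σ₂ : Measure (Fin m → ℝ))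
    (Mset : Set (MvPolynomial (Fin n ⊕ Fin m) ℝ))
    (ψ : (Fin D → ℝ) →ₗ[ℝ] MvPolynomial (Fin n ⊕ Fin m) ℝ) : Prop where
  inj : Function.Injective ψ
  range : Set.range ψ = Mset
  ip : ∀ a b : Fin D → ℝ, bip σ₁ σ₂ (ψ a) (ψ b) = ∑ i, a i * b i

/-- The apolar inner product `⟨r, s⟩_d = D_r(s)` on biforms, where `D_r` is the
differential operator obtained from `r` by replacing each variable by the corresponding
partial derivative; its value on a pair of forms of the same bidegree is
`∑_α r_α · s_α · α!`. -/
def apolar {n m : ℕ} (r s : MvPolynomial (Fin n ⊕ Fin m) ℝ) : ℝ :=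
  ∑ α ∈ r.support, coeff α r * coeff α s * α.prod fun _ k => (k.factorial : ℝ)

end BiformPaper

section PrekopaLeindler
open Set ENNReal

/-- The one-dimensional Brunn–Minkowski inequality for compact sets. -/
theorem volume_add_le_volume_of_isCompact {A B H : Set ℝ} (hA : IsCompact A) (hB : IsCompact B)
    (hA0 : A.Nonempty) (hB0 : B.Nonempty) (h : ∀ a ∈ A, ∀ b ∈ B, a + b ∈ H) :
    volume A + volume B ≤ volume H := by
  have ha := hA.sSup_mem hA0
  have hb := hB.sInf_mem hB0
  set a := sSup A
  set b := sInf B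
  have h1 : (fun x => b + x) ⁻¹' ((fun x => b + x) '' A) = A :=
    preimage_image_eq _ (add_right_injective b)
  have vA : volume ((fun x => b + x) '' A) = volume A := by
    simp [image_add_left, measure_preimage_add]
  have vB : volume ((fun x => a + x) '' B) = volume B := by
    simp [image_add_left, measure_preimage_add]
  have hBm : MeasurableSet ((fun x => a + x) '' B) :=
    (hB.image (by fun_prop)).isClosed.measurableSet
  have hdis : AEDisjoint volume ((fun x => b + x) '' A) ((fun x => a + x) '' B) := by
    refine measure_mono_null (t := {a + b}) ?_ (by simp)
    rintro z ⟨⟨x, hx, rfl⟩, ⟨y, hy, hxy⟩⟩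
    have := le_csSup hA.bddAbove hx
    have := csInf_le hB.bddBelow hy
    simp only [mem_singleton_iff]
    simp only at hxy
    linarith
  calc volume A + volume B
      = volume ((fun x => b + x) '' A ∪ (fun x => a + x) '' B) := by
        rw [measure_union₀ hBm.nullMeasurableSet hdis, vA, vB]
    _ ≤ volume H := by
        refine measure_mono ?_
        rintro z (⟨x, hx, rfl⟩ | ⟨y, hy, rfl⟩)
        · simpa [add_comm] using h x hx b hb
        · exact h a ha y hy

theorem volume_add_le_two_mul_volume {S T H : Set ℝ} (hS : MeasurableSet S) (hT : MeasurableSet T)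
    (hS0 : S.Nonempty) (hT0 : T.Nonempty) (h : ∀ a ∈ S, ∀ b ∈ T, (a + b) / 2 ∈ H) :
    volume S + volume T ≤ 2 * volume H := by
  obtain ⟨s, hs⟩ := hS0
  obtain ⟨t, ht⟩ := hT0
  have key : ∀ K ⊆ S, IsCompact K → ∀ L ⊆ T, IsCompact L → volume K + volume L ≤ 2 * volume H := by
    intro K hK hKc L hL hLc
    have h2 : volume ((fun x : ℝ => x / 2) ⁻¹' H) = 2 * volume H := by
      have := Real.volume_preimage_mul_right (a := (1 / 2 : ℝ)) (by norm_num) H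
      simp only [div_eq_mul_inv, one_mul] at this ⊢
      rw [this]; simp
    rw [← h2]
    refine le_trans (add_le_add (measure_mono (subset_insert s K)) (measure_mono (subset_insert t L)))
      (volume_add_le_volume_of_isCompact (hKc.insert s) (hLc.insert t) (insert_nonempty _ _)
        (insert_nonempty _ _) ?_)
    intro a ha b hb
    refine h a ?_ b ?_
    · rcases ha with rfl | ha
      exacts [hs, hK ha]
    · rcases hb with rfl | hb
      exacts [ht, hL hb]
  rw [hS.measure_eq_iSup_isCompact, hT.measure_eq_iSup_isCompact]
  have e : ∀ U : Set ℝ, ⨆ K, ⨆ (_ : K ⊆ U), ⨆ (_ : IsCompact K), volume K =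
      ⨆ K, ⨆ (_ : K ⊆ U ∧ IsCompact K), volume K := fun U => by simp only [iSup_and]
  rw [e, e]
  refine ENNReal.biSup_add_biSup_le' ⟨∅, by simp⟩ ⟨∅, by simp⟩ ?_
  rintro K ⟨hK, hKc⟩ L ⟨hL, hLc⟩
  exact key K hK hKc L hL hLc

theorem lintegral_add_le_of_level {f g h : ℝ → ℝ} (hf : Measurable f) (hg : Measurable g)
    (hh : Measurable h) (f0 : ∀ x, 0 ≤ f x) (g0 : ∀ x, 0 ≤ g x) (h0 : ∀ x, 0 ≤ h x)
    (f1 : ∀ x, f x ≤ 1) (g1 : ∀ x, g x ≤ 1)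
    (fs : ∀ c < 1, ∃ x, c < f x) (gs : ∀ c < 1, ∃ x, c < g x)
    (hyp : ∀ x y, f x * g y ≤ h ((x + y) / 2) ^ 2) :
    (∫⁻ x, ENNReal.ofReal (f x)) + (∫⁻ x, ENNReal.ofReal (g x)) ≤
      2 * ∫⁻ x, ENNReal.ofReal (h x) := by
  rw [lintegral_eq_lintegral_meas_lt _ (.of_forall f0) hf.aemeasurable,
    lintegral_eq_lintegral_meas_lt _ (.of_forall g0) hg.aemeasurable,
    lintegral_eq_lintegral_meas_lt _ (.of_forall h0) hh.aemeasurable,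
    ← lintegral_const_mul' _ _ (by norm_num), ← lintegral_add_left]
  · refine setLIntegral_mono' measurableSet_Ioi fun c hc => ?_
    rcases lt_or_ge c 1 with hc1 | hc1
    · refine volume_add_le_two_mul_volume (hf measurableSet_Ioi) (hg measurableSet_Ioi) (fs c hc1)
        (gs c hc1) ?_
      intro a ha b hb
      have hc0 : (0 : ℝ) < c := hc
      have ha' : c < f a := ha
      have hb' : c < g b := hb
      have := hyp a b
      refine lt_of_pow_lt_pow_left₀ 2 (h0 _) ?_
      nlinarith
    · have e1 : {a | c < f a} = ∅ := by
        ext a; simpa using (f1 a).trans hc1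
      have e2 : {a | c < g a} = ∅ := by
        ext a; simpa using (g1 a).trans hc1
      simp [e1, e2]
  · exact (Antitone.measurable fun a b hab => measure_mono fun x hx => lt_of_le_of_lt hab hx)

theorem prekopa_leindler_bounded {f g h : ℝ → ℝ≥0∞} (hf : Measurable f) (hg : Measurable g)
    (hh : Measurable h) {C : ℝ≥0∞} (hC : C ≠ ∞) (fC : ∀ x, f x ≤ C) (gC : ∀ x, g x ≤ C)
    (hyp : ∀ x y, f x * g y ≤ h ((x + y) / 2) ^ 2) :
    (∫⁻ x, f x) * (∫⁻ x, g x) ≤ (∫⁻ x, h x) ^ 2 := by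
  by_cases hf0 : ∀ x, f x = 0
  · simp [hf0]
  by_cases hg0 : ∀ x, g x = 0
  · simp [hg0]
  push Not at hf0 hg0
  obtain ⟨x0, hx0⟩ := hf0
  obtain ⟨y0, hy0⟩ := hg0
  set a := ⨆ x, f x with ha
  set b := ⨆ x, g x with hb
  have ha0 : a ≠ 0 := fun h => hx0 (le_zero_iff.1 (h ▸ le_iSup f x0))
  have hb0 : b ≠ 0 := fun h => hy0 (le_zero_iff.1 (h ▸ le_iSup g y0))
  have hat : a ≠ ∞ := ne_top_of_le_ne_top hC (iSup_le fC)
  have hbt : b ≠ ∞ := ne_top_of_le_ne_top hC (iSup_le gC)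
  have hA : 0 < a.toReal := ENNReal.toReal_pos ha0 hat
  have hB : 0 < b.toReal := ENNReal.toReal_pos hb0 hbt
  set A := a.toReal
  set B := b.toReal
  set s := √(A * B) with hs
  have hs0 : 0 < s := Real.sqrt_pos.2 (mul_pos hA hB)
  have hss : s ^ 2 = A * B := Real.sq_sqrt (mul_pos hA hB).le
  have lt_toReal : ∀ {r : ℝ} {u : ℝ≥0∞}, u ≠ ∞ → ENNReal.ofReal r < u → r < u.toReal := by
    intro r u hu hr
    rw [← ENNReal.ofReal_toReal hu] at hr
    exact (ENNReal.ofReal_lt_ofReal_iff'.1 hr).1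
  have fle : ∀ x, f x ≤ a := le_iSup f
  have gle : ∀ x, g x ≤ b := le_iSup g
  have ft : ∀ x, f x ≠ ∞ := fun x => ne_top_of_le_ne_top hat (fle x)
  have gt : ∀ x, g x ≠ ∞ := fun x => ne_top_of_le_ne_top hbt (gle x)
  set h' : ℝ → ℝ≥0∞ := fun x => min (h x) (ENNReal.ofReal s) with hh'
  have ht : ∀ x, h' x ≠ ∞ := fun x => ne_top_of_le_ne_top ofReal_ne_top (min_le_right _ _)
  have key := lintegral_add_le_of_level (f := fun x => (f x).toReal / A)
    (g := fun x => (g x).toReal / B) (h := fun x => (h' x).toReal / s)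
    (hf.ennreal_toReal.div_const _) (hg.ennreal_toReal.div_const _)
    ((hh.min measurable_const).ennreal_toReal.div_const _)
    (fun x => by positivity) (fun x => by positivity) (fun x => by positivity)
    (fun x => (div_le_one hA).2 (ENNReal.toReal_mono hat (fle x)))
    (fun x => (div_le_one hB).2 (ENNReal.toReal_mono hbt (gle x))) ?_ ?_ ?_
  · have conv : ∀ (u : ℝ → ℝ≥0∞) (c : ℝ), 0 < c → (∀ x, u x ≠ ∞) →
        ∫⁻ x, ENNReal.ofReal ((u x).toReal / c) = (∫⁻ x, u x) * ENNReal.ofReal c⁻¹ := by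
      intro u c hc hu
      rw [← lintegral_mul_const' _ _ ofReal_ne_top]
      refine lintegral_congr fun x => ?_
      rw [div_eq_mul_inv, ENNReal.ofReal_mul toReal_nonneg, ENNReal.ofReal_toReal (hu x)]
    rw [conv f A hA ft, conv g B hB gt, conv h' s hs0 ht] at key
    have hle : ∫⁻ x, h' x ≤ ∫⁻ x, h x := lintegral_mono fun x => min_le_left _ _
    set I := ∫⁻ x, f x
    set J := ∫⁻ x, g x
    set L := ∫⁻ x, h x
    have key2 : I * ENNReal.ofReal A⁻¹ + J * ENNReal.ofReal B⁻¹ ≤ 2 * (L * ENNReal.ofReal s⁻¹) :=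
      key.trans (by gcongr)
    by_cases hL : L = ∞
    · rw [hL]; simp
    have hI : I ≠ ∞ := by
      intro hI
      have : (∞ : ℝ≥0∞) ≤ 2 * (L * ENNReal.ofReal s⁻¹) := by
        refine le_trans ?_ key2
        rw [hI, ENNReal.top_mul (by simpa using hA)]; simp
      exact absurd this (not_le.2 (ENNReal.mul_lt_top (by simp) (ENNReal.mul_lt_top
        (lt_top_iff_ne_top.2 hL) ofReal_lt_top)))
    have hJ : J ≠ ∞ := by
      intro hI
      have : (∞ : ℝ≥0∞) ≤ 2 * (L * ENNReal.ofReal s⁻¹) := by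
        refine le_trans ?_ key2
        rw [hI, ENNReal.top_mul (by simpa using hB)]; simp
      exact absurd this (not_le.2 (ENNReal.mul_lt_top (by simp) (ENNReal.mul_lt_top
        (lt_top_iff_ne_top.2 hL) ofReal_lt_top)))
    lift I to NNReal using hI with i
    lift J to NNReal using hJ with j
    lift L to NNReal using hL with l
    have k3 : (i : ℝ) * A⁻¹ + j * B⁻¹ ≤ 2 * (l * s⁻¹) := by
      have := ENNReal.toReal_mono (by finiteness) key2
      rwa [ENNReal.toReal_add (by finiteness) (by finiteness), toReal_mul, toReal_mul, toReal_mul,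
        toReal_mul, ENNReal.toReal_ofReal (by positivity), ENNReal.toReal_ofReal (by positivity),
        ENNReal.toReal_ofReal (by positivity)] at this
    norm_cast
    rw [← NNReal.coe_le_coe]
    push_cast
    have p1 : 0 ≤ (i : ℝ) * A⁻¹ := by positivity
    have p2 : 0 ≤ (j : ℝ) * B⁻¹ := by positivity
    have k4 : ((i : ℝ) * A⁻¹) * (j * B⁻¹) ≤ (l * s⁻¹) ^ 2 := by
      nlinarith [sq_nonneg ((i : ℝ) * A⁻¹ - j * B⁻¹)]
    have : (l * s⁻¹ : ℝ) ^ 2 = l ^ 2 * (A * B)⁻¹ := by rw [mul_pow, inv_pow, hss]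
    rw [this, show (i : ℝ) * A⁻¹ * (j * B⁻¹) = i * j * (A * B)⁻¹ by
      rw [mul_inv]; ring] at k4
    exact le_of_mul_le_mul_right k4 (by positivity)
  · intro c hc
    have : ENNReal.ofReal (c * A) < a := by
      rw [← ENNReal.ofReal_toReal hat]
      exact (ENNReal.ofReal_lt_ofReal_iff hA).2 (by nlinarith)
    obtain ⟨x, hx⟩ := lt_iSup_iff.1 this
    exact ⟨x, (lt_div_iff₀ hA).2 (lt_toReal (ft x) hx)⟩
  · intro c hc
    have : ENNReal.ofReal (c * B) < b := by
      rw [← ENNReal.ofReal_toReal hbt]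
      exact (ENNReal.ofReal_lt_ofReal_iff hB).2 (by nlinarith)
    obtain ⟨x, hx⟩ := lt_iSup_iff.1 this
    exact ⟨x, (lt_div_iff₀ hB).2 (lt_toReal (gt x) hx)⟩
  · intro x y
    have h1 : f x * g y ≤ h' ((x + y) / 2) ^ 2 := by
      simp only [hh']
      rcases le_total (h ((x + y) / 2)) (ENNReal.ofReal s) with h2 | h2
      · rw [min_eq_left h2]; exact hyp x y
      · rw [min_eq_right h2, ← ENNReal.ofReal_pow hs0.le, hss, ENNReal.ofReal_mul hA.le,
          ENNReal.ofReal_toReal hat, ENNReal.ofReal_toReal hbt]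
        gcongr
        exacts [fle x, gle y]
    have h3 := ENNReal.toReal_mono (ENNReal.pow_ne_top (ht _)) h1
    rw [toReal_mul, toReal_pow] at h3
    rw [div_pow, hss, div_mul_div_comm]
    gcongr

theorem prekopa_leindler_real {f g h : ℝ → ℝ≥0∞} (hf : Measurable f) (hg : Measurable g)
    (hh : Measurable h) (hyp : ∀ x y, f x * g y ≤ h ((x + y) / 2) ^ 2) :
    (∫⁻ x, f x) * (∫⁻ x, g x) ≤ (∫⁻ x, h x) ^ 2 := by
  have lim : ∀ u : ℝ → ℝ≥0∞, Measurable u →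
      ∫⁻ x, u x = ⨆ k : ℕ, ∫⁻ x, min (u x) k := by
    intro u hu
    rw [← lintegral_iSup (fun k => hu.min measurable_const)
      (fun i j hij x => min_le_min_left _ (by exact_mod_cast hij))]
    refine lintegral_congr fun x => ?_
    rw [← inf_iSup_eq, ENNReal.iSup_natCast]
    simp
  rw [lim f hf, lim g hg, ENNReal.iSup_mul]
  refine iSup_le fun i => ?_
  rw [ENNReal.mul_iSup]
  refine iSup_le fun j => ?_
  exact prekopa_leindler_bounded (hf.min measurable_const)
    (hg.min measurable_const) hh (ENNReal.natCast_ne_top (max i j))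
    (fun x => (min_le_right _ _).trans (by gcongr; exact le_max_left _ _))
    (fun x => (min_le_right _ _).trans (by gcongr; exact le_max_right _ _))
    fun x y => le_trans (mul_le_mul' (min_le_left _ _) (min_le_left _ _)) (hyp x y)

/-- The Prékopa–Leindler inequality for midpoints. -/
theorem prekopa_leindler : ∀ (n : ℕ) {f g h : (Fin n → ℝ) → ℝ≥0∞}, Measurable f → Measurable g →
    Measurable h → (∀ x y, f x * g y ≤ h ((1 / 2 : ℝ) • (x + y)) ^ 2) →
    (∫⁻ x, f x) * (∫⁻ x, g x) ≤ (∫⁻ x, h x) ^ 2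
  | 0, f, g, h, hf, hg, hh, hyp => by
    have e : (volume : Measure (Fin 0 → ℝ)) = Measure.dirac 0 := by
      rw [volume_pi, Measure.pi_of_empty _ 0]
    rw [e, lintegral_dirac, lintegral_dirac, lintegral_dirac]
    convert hyp 0 0 using 3
  | n + 1, f, g, h, hf, hg, hh, hyp => by
    have split : ∀ u : (Fin (n + 1) → ℝ) → ℝ≥0∞, Measurable u →
        ∫⁻ x, u x = ∫⁻ s : ℝ, ∫⁻ y : Fin n → ℝ, u (Fin.cons s y) := by
      intro u hu
      have e := (volume_preserving_piFinSuccAbove (fun _ : Fin (n + 1) => ℝ) 0).symm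
      rw [← e.lintegral_comp hu, Measure.volume_eq_prod]
      refine (lintegral_prod _ (hu.comp e.measurable).aemeasurable).trans ?_
      simp [MeasurableEquiv.piFinSuccAbove, Fin.insertNthEquiv]
    have meas : ∀ u : (Fin (n + 1) → ℝ) → ℝ≥0∞, Measurable u →
        Measurable fun p : ℝ × (Fin n → ℝ) => u (Fin.cons p.1 p.2) := fun u hu => by
      refine hu.comp (measurable_pi_iff.2 fun i => ?_)
      refine Fin.cases ?_ (fun j => ?_) i
      · simpa using measurable_fst
      · simp only [Fin.cons_succ]
        exact (measurable_pi_apply j).comp measurable_snd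
    rw [split f hf, split g hg, split h hh]
    refine prekopa_leindler_real (meas f hf).lintegral_prod_right' (meas g hg).lintegral_prod_right'
      (meas h hh).lintegral_prod_right' fun s t => ?_
    refine prekopa_leindler n ((meas f hf).comp measurable_prodMk_left)
      ((meas g hg).comp measurable_prodMk_left) ((meas h hh).comp measurable_prodMk_left)
      fun x y => ?_
    convert hyp (Fin.cons s x) (Fin.cons t y) using 3
    ext i
    refine Fin.cases ?_ (fun j => ?_) i
    · simp; ring
    · simp; ring

end PrekopaLeindler

section SuperlevelSets
open Set Filter Topology

theorem lineMap_mem_of_isClosed_of_midpoint {E : Type*} [NormedAddCommGroup E] [NormedSpace ℝ E]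
    {S : Set E} (hS : IsClosed S) (hmid : ∀ x ∈ S, ∀ y ∈ S, (1 / 2 : ℝ) • (x + y) ∈ S)
    {x y : E} (hx : x ∈ S) (hy : y ∈ S) {t : ℝ} (h0 : 0 ≤ t) (h1 : t ≤ 1) :
    x + t • (y - x) ∈ S := by
  by_contra ht
  set A : Set ℝ := (fun s : ℝ => x + s • (y - x)) ⁻¹' S with hA
  have hAc : IsClosed A := hS.preimage (by fun_prop)
  have m0 : (0 : ℝ) ∈ A := by simpa [hA] using hx
  have m1 : (1 : ℝ) ∈ A := by simpa [hA] using hy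
  have htA : t ∉ A := ht
  have hL : IsCompact (A ∩ Icc 0 t) := isCompact_Icc.inter_left hAc
  have hR : IsCompact (A ∩ Icc t 1) := isCompact_Icc.inter_left hAc
  have ha := hL.sSup_mem ⟨0, m0, le_rfl, h0⟩
  have hb := hR.sInf_mem ⟨1, m1, h1, le_rfl⟩
  set a := sSup (A ∩ Icc 0 t) with haa
  set b := sInf (A ∩ Icc t 1) with hbb
  have hat : a < t := lt_of_le_of_ne ha.2.2 fun h => htA (h ▸ ha.1)
  have htb : t < b := lt_of_le_of_ne hb.2.1 fun h => htA (h ▸ hb.1)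
  have hc : (a + b) / 2 ∈ A := by
    have := hmid _ ha.1 _ hb.1
    simp only [hA, mem_preimage]
    convert this using 1
    module
  rcases le_total ((a + b) / 2) t with h | h
  · have : (a + b) / 2 ≤ a := le_csSup hL.bddAbove ⟨hc, by linarith [ha.2.1, h0], h⟩
    linarith
  · have : b ≤ (a + b) / 2 := csInf_le hR.bddBelow ⟨hc, h, by linarith [hb.2.2, h1]⟩
    linarith

variable {D : ℕ}

theorem volume_mul_volume_le_of_midpoint {A B H : Set (Fin D → ℝ)} (hA : MeasurableSet A)
    (hB : MeasurableSet B) (hH : MeasurableSet H)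
    (h : ∀ a ∈ A, ∀ b ∈ B, (1 / 2 : ℝ) • (a + b) ∈ H) :
    volume A * volume B ≤ volume H ^ 2 := by
  have := prekopa_leindler D (f := A.indicator 1) (g := B.indicator 1) (h := H.indicator 1)
    (measurable_one.indicator hA) (measurable_one.indicator hB) (measurable_one.indicator hH) ?_
  · rwa [lintegral_indicator_one hA, lintegral_indicator_one hB, lintegral_indicator_one hH] at this
  · intro x y
    by_cases hx : x ∈ A
    · by_cases hy : y ∈ B
      · rw [indicator_of_mem (h x hx y hy)]
        simp [hx, hy]
      · simp [hy]
    · simp [hx]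

variable {E : Type*} [NormedAddCommGroup E]

theorem isClosed_le_volume_section {C : Set (E × (Fin D → ℝ))} (hC : IsClosed C)
    {K : Set (Fin D → ℝ)} (hK : IsCompact K) (hCK : ∀ p ∈ C, p.2 ∈ K) (c : ENNReal) :
    IsClosed {w | c ≤ volume (Prod.mk w ⁻¹' C)} := by
  refine IsSeqClosed.isClosed fun w w₀ hw hlim => ?_
  have hCm : ∀ w, MeasurableSet (Prod.mk w ⁻¹' C) := fun w =>
    (hC.preimage (by fun_prop)).measurableSet
  have h1 := limsup_lintegral_le (μ := (volume : Measure (Fin D → ℝ)))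
    (f := fun k => (Prod.mk (w k) ⁻¹' C).indicator 1) (K.indicator 1)
    (fun k => measurable_one.indicator (hCm _)) (fun k => .of_forall fun a => by
      have hsub : Prod.mk (w k) ⁻¹' C ⊆ K := fun a ha => hCK _ ha
      exact indicator_le_indicator_of_subset hsub (fun _ => zero_le) a) (by
      rw [lintegral_indicator_one hK.measurableSet]; exact hK.measure_lt_top.ne)
  simp only [lintegral_indicator_one (hCm _)] at h1
  have h2 : c ≤ limsup (fun n => volume (Prod.mk (w n) ⁻¹' C)) atTop := by
    refine le_trans ?_ (limsup_le_limsup (.of_forall hw))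
    simp
  refine h2.trans (h1.trans ?_)
  rw [← lintegral_indicator_one (hCm w₀)]
  refine lintegral_mono fun a => ?_
  by_cases ha : (w₀, a) ∈ C
  · rw [indicator_of_mem (by exact ha)]
    refine limsup_le_of_le (by isBoundedDefault) (.of_forall fun k => ?_)
    exact indicator_le_self' (by simp) a
  · rw [indicator_of_notMem (by exact ha)]
    have : ∀ᶠ k in atTop, (w k, a) ∉ C := by
      have ht : Tendsto (fun k => (w k, a)) atTop (𝓝 (w₀, a)) :=
        hlim.prodMk_nhds tendsto_const_nhds
      exact ht.eventually (hC.isOpen_compl.mem_nhds ha)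
    refine limsup_le_of_le (by isBoundedDefault) (this.mono fun k hk => ?_)
    rw [indicator_of_notMem (by exact hk)]

variable [NormedSpace ℝ E]

theorem volume_section_midpoint {C : Set (E × (Fin D → ℝ))} (hC : IsClosed C)
    (hCc : Convex ℝ C) {c : ENNReal} {w w' : E} (hw : c ≤ volume (Prod.mk w ⁻¹' C))
    (hw' : c ≤ volume (Prod.mk w' ⁻¹' C)) :
    c ≤ volume (Prod.mk ((1 / 2 : ℝ) • (w + w')) ⁻¹' C) := by
  have hCm : ∀ w, MeasurableSet (Prod.mk w ⁻¹' C) := fun w =>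
    (hC.preimage (by fun_prop)).measurableSet
  have := volume_mul_volume_le_of_midpoint (hCm w) (hCm w') (hCm ((1 / 2 : ℝ) • (w + w'))) ?_
  · refine le_of_not_gt fun h => ?_
    have h2 : c * c ≤ _ := (mul_le_mul' hw hw').trans this
    rw [sq] at h2
    exact absurd h2 (not_le.2 (ENNReal.mul_lt_mul h h))
  · intro a ha b hb
    have := hCc ha hb (a := 1 / 2) (b := 1 / 2) (by norm_num) (by norm_num) (by norm_num)
    simpa using this

theorem volume_section_le_of_symm {C : Set (E × (Fin D → ℝ))} (hC : IsClosed C)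
    (hCc : Convex ℝ C) {K : Set (Fin D → ℝ)} (hK : IsCompact K) (hCK : ∀ p ∈ C, p.2 ∈ K)
    (hsymm : ∀ p ∈ C, -p ∈ C) (w : E) {s : ℝ} (hs0 : 0 ≤ s) (hs1 : s ≤ 1) :
    volume (Prod.mk w ⁻¹' C) ≤ volume (Prod.mk (s • w) ⁻¹' C) := by
  set c := volume (Prod.mk w ⁻¹' C)
  have h1 : c ≤ volume (Prod.mk (-w) ⁻¹' C) := by
    have : Prod.mk w ⁻¹' C = Neg.neg ⁻¹' (Prod.mk (-w) ⁻¹' C) := by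
      ext a
      exact ⟨fun h => hsymm _ h, fun h => by simpa using hsymm _ h⟩
    simp only [c]
    rw [this, Measure.measure_preimage_neg]
  have := lineMap_mem_of_isClosed_of_midpoint (isClosed_le_volume_section hC hK hCK c)
    (fun x hx y hy => volume_section_midpoint hC hCc hx hy) (x := -w) (y := w) h1 (le_refl c)
    (t := (1 + s) / 2) (by linarith) (by linarith)
  have e : -w + ((1 + s) / 2) • (w - -w) = s • w := by module
  rwa [e] at this

end SuperlevelSets

section SymmetricIntersection
open Set Filter Topology Pointwise
variable {D : ℕ}

theorem measurePreserving_of_sum_sq {L : (Fin D → ℝ) →ₗ[ℝ] (Fin D → ℝ)}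
    (h : ∀ a, ∑ i, L a i ^ 2 = ∑ i, a i ^ 2) : MeasurePreserving L volume volume := by
  have hM : (LinearMap.toMatrix' L).transpose * LinearMap.toMatrix' L = 1 := by
    have pol : ∀ a b, L a ⬝ᵥ L b = a ⬝ᵥ b := by
      intro a b
      have h1 := h (a + b)
      have h2 := h a
      have h3 := h b
      simp only [map_add, Pi.add_apply, add_sq, Finset.sum_add_distrib, h2, h3] at h1
      have h4 : ∑ i, 2 * L a i * L b i = ∑ i, 2 * a i * b i := by linarith
      simp only [mul_assoc, ← Finset.mul_sum] at h4
      simpa [dotProduct] using h4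
    ext i j
    have := pol (Pi.single i 1) (Pi.single j 1)
    simp only [Matrix.mul_apply, Matrix.transpose_apply, LinearMap.toMatrix'_apply]
    simp only [dotProduct] at this
    rw [this]
    simp [Matrix.one_apply, Pi.single_apply, eq_comm]
  have hdet : |LinearMap.det L| = 1 := by
    have := congrArg Matrix.det hM
    rw [Matrix.det_mul, Matrix.det_transpose, Matrix.det_one, LinearMap.det_toMatrix'] at this
    rcases mul_self_eq_one_iff.1 this with h | h <;> simp [h]
  have h0 : LinearMap.det L ≠ 0 := by
    intro h; simp [h] at hdet
  refine ⟨(LinearMap.continuous_of_finiteDimensional L).measurable, ?_⟩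
  rw [Measure.map_linearMap_addHaar_eq_smul_addHaar _ h0, abs_inv, hdet]
  simp

/-- A convex body whose symmetry group has no nonzero fixed vector satisfies
`vol K ≤ 2 ^ D * vol (K ∩ -K)`. -/
theorem volume_le_two_pow_mul_volume_inter_neg {K : Set (Fin D → ℝ)} (hK : IsCompact K)
    (hKc : Convex ℝ K) (G : Set ((Fin D → ℝ) →ₗ[ℝ] (Fin D → ℝ)))
    (hG : ∀ L ∈ G, ∀ a, ∑ i, L a i ^ 2 = ∑ i, a i ^ 2) (hGK : ∀ L ∈ G, ∀ a, L a ∈ K ↔ a ∈ K)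
    (hfix : ∀ a, (∀ L ∈ G, L a = a) → a = 0) :
    volume K ≤ 2 ^ D * volume (K ∩ -K) := by
  set C : Set ((Fin D → ℝ) × (Fin D → ℝ)) := {p | p.2 ∈ K ∧ p.1 - p.2 ∈ K} with hCdef
  have hC : IsClosed C :=
    (hK.isClosed.preimage continuous_snd).inter
      (hK.isClosed.preimage (continuous_fst.sub continuous_snd))
  have hCc : Convex ℝ C :=
    (hKc.linear_preimage (LinearMap.snd ℝ _ _)).inter
      (hKc.linear_preimage (LinearMap.fst ℝ _ _ - LinearMap.snd ℝ _ _))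
  set g : (Fin D → ℝ) → ENNReal := fun x => volume (Prod.mk x ⁻¹' C) with hg
  have ginv : ∀ L ∈ G, ∀ x, g (L x) = g x := by
    intro L hL x
    have hp := measurePreserving_of_sum_sq (hG L hL)
    have hm : MeasurableSet (Prod.mk (L x) ⁻¹' C) := (hC.preimage (by fun_prop)).measurableSet
    simp only [hg]
    rw [← hp.measure_preimage hm.nullMeasurableSet]
    congr 1
    ext a
    simp only [hCdef, mem_preimage, mem_ofPred_eq, ← map_sub, hGK L hL]
  have gmax : ∀ x, g x ≤ g 0 := by
    intro x₀
    set S := {x | g x₀ ≤ g x} with hS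
    have hSc : IsClosed S := isClosed_le_volume_section hC hK (fun p hp => hp.1) _
    have hmid : ∀ x ∈ S, ∀ y ∈ S, (1 / 2 : ℝ) • (x + y) ∈ S := fun x hx y hy =>
      volume_section_midpoint hC hCc hx hy
    by_cases h0 : g x₀ = 0
    · rw [h0]; exact zero_le
    have hSK : S ⊆ (fun p : (Fin D → ℝ) × (Fin D → ℝ) => p.1 + p.2) '' (K ×ˢ K) := by
      intro x hx
      have : g x ≠ 0 := fun h => h0 (le_zero_iff.1 (h ▸ hx))
      obtain ⟨a, ha⟩ := nonempty_of_measure_ne_zero this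
      exact ⟨(a, x - a), ⟨ha.1, ha.2⟩, by simp⟩
    have hScomp : IsCompact S :=
      ((hK.prod hK).image (continuous_fst.add continuous_snd)).of_isClosed_subset hSc hSK
    obtain ⟨z, hz, hzmin⟩ := hScomp.exists_isMinOn ⟨x₀, le_refl (g x₀)⟩
      (f := fun a : Fin D → ℝ => ∑ i, a i ^ 2) (by fun_prop)
    have hz0 : z = 0 := by
      refine hfix z fun L hL => ?_
      have hLz : L z ∈ S := by
        simp only [hS, mem_ofPred_eq, ginv L hL]; exact hz
      have h1 := hzmin (hmid _ hLz _ hz)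
      simp only [mem_ofPred_eq, Pi.smul_apply, Pi.add_apply, smul_eq_mul] at h1
      have h2 : ∑ i, (1 / 2 * (L z i + z i)) ^ 2 + ∑ i, (1 / 2 * (L z i - z i)) ^ 2 =
          ∑ i, z i ^ 2 := by
        have : ∑ i, z i ^ 2 = 1 / 2 * ∑ i, L z i ^ 2 + 1 / 2 * ∑ i, z i ^ 2 := by
          rw [hG L hL]; ring
        rw [this, Finset.mul_sum, Finset.mul_sum, ← Finset.sum_add_distrib,
          ← Finset.sum_add_distrib]
        exact Finset.sum_congr rfl fun i _ => by ring
      have h3 : ∑ i, (1 / 2 * (L z i - z i)) ^ 2 = 0 :=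
        le_antisymm (by linarith) (Finset.sum_nonneg fun i _ => sq_nonneg _)
      rw [Finset.sum_eq_zero_iff_of_nonneg (fun i _ => sq_nonneg _)] at h3
      ext i
      have := h3 i (Finset.mem_univ i)
      have := pow_eq_zero_iff (two_ne_zero) |>.1 this
      linarith
    rw [hz0] at hz
    exact hz
  have h_int : ∫⁻ x, g x = volume K * volume K := by
    have h1 : ((volume : Measure (Fin D → ℝ)).prod volume) C = ∫⁻ x, g x :=
      Measure.prod_apply hC.measurableSet
    rw [← h1, Measure.prod_apply_symm hC.measurableSet]
    have : ∀ y, volume ((fun x => (x, y)) ⁻¹' C) = K.indicator (fun _ => volume K) y := by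
      intro y
      by_cases hy : y ∈ K
      · rw [indicator_of_mem hy]
        have : (fun x => (x, y)) ⁻¹' C = (fun x => x - y) ⁻¹' K := by
          ext x; simp [hCdef, hy]
        rw [this]
        simp [sub_eq_add_neg]
      · rw [indicator_of_notMem hy]
        have : (fun x => (x, y)) ⁻¹' C = ∅ := by
          ext x; simp [hCdef, hy]
        simp [this]
    simp only [this]
    rw [lintegral_indicator_const hK.measurableSet]
  have hsupp : ∀ x, g x ≤ ((2 : ℝ) • K).indicator (fun _ => g 0) x := by
    intro x
    by_cases hx : x ∈ (2 : ℝ) • K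
    · rw [indicator_of_mem hx]; exact gmax x
    · rw [indicator_of_notMem hx]
      have : Prod.mk x ⁻¹' C = ∅ := by
        ext a
        simp only [hCdef, mem_preimage, mem_ofPred_eq, mem_empty_iff_false, iff_false]
        rintro ⟨h1, h2⟩
        refine hx ⟨(1 / 2 : ℝ) • x, ?_, by module⟩
        have := hKc h1 h2 (a := 1 / 2) (b := 1 / 2) (by norm_num) (by norm_num) (by norm_num)
        convert this using 1
        module
      simp [hg, this]
  have hg0 : g 0 = volume (K ∩ -K) := by
    simp only [hg]
    congr 1
    ext a
    simp [hCdef]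
  have hmeas2 : MeasurableSet ((2 : ℝ) • K) := (hK.smul (2 : ℝ)).measurableSet
  have hfinal : volume K * volume K ≤ (2 ^ D * volume (K ∩ -K)) * volume K := by
    rw [← h_int]
    refine (lintegral_mono hsupp).trans ?_
    rw [lintegral_indicator_const hmeas2, Measure.addHaar_smul, hg0]
    simp only [Module.finrank_fin_fun, abs_pow, Nat.abs_ofNat]
    rw [ENNReal.ofReal_pow (by norm_num)]
    simp only [ENNReal.ofReal_ofNat]
    ring_nf
    exact le_rfl
  rcases eq_or_ne (volume K) 0 with h | h
  · rw [h]; exact zero_le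
  · exact (ENNReal.mul_le_mul_iff_left h hK.measure_lt_top.ne).1 hfinal

end SymmetricIntersection

section RadialDecrease
open Set Filter Topology ENNReal
variable {D n : ℕ}

theorem pow_mul_volume_le_thickened {K : Set (Fin D → ℝ)} (hK : IsCompact K) (hKc : Convex ℝ K)
    (hKs : ∀ a ∈ K, -a ∈ K) (l : (Fin D → ℝ) →ₗ[ℝ] EuclideanSpace ℝ (Fin n))
    (hl : ∀ a ∈ K, ‖l a‖ ≤ 1) {ε s : ℝ} (hε : 0 < ε) (hs0 : 0 < s) (hs1 : s ≤ 1) :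
    ENNReal.ofReal (s ^ n) * volume K ≤ volume (K ∩ {a | ‖l a‖ ≤ s * (1 + ε) + ε}) := by
  have hlc : Continuous l := l.continuous_of_finiteDimensional
  set C : Set (EuclideanSpace ℝ (Fin n) × (Fin D → ℝ)) := {p | p.2 ∈ K ∧ ‖p.1 - l p.2‖ ≤ ε}
    with hCdef
  have hC : IsClosed C :=
    (hK.isClosed.preimage continuous_snd).inter
      (isClosed_le (f := fun p : EuclideanSpace ℝ (Fin n) × (Fin D → ℝ) => ‖p.1 - l p.2‖)
        (by fun_prop) continuous_const)
  have hCc : Convex ℝ C := by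
    rintro ⟨w, a⟩ ⟨h1, h2⟩ ⟨w', a'⟩ ⟨h1', h2'⟩ s t hs ht hst
    refine ⟨hKc h1 h1' hs ht hst, ?_⟩
    have := convex_closedBall (0 : EuclideanSpace ℝ (Fin n)) ε (mem_closedBall_zero_iff.2 h2)
      (mem_closedBall_zero_iff.2 h2') hs ht hst
    rw [mem_closedBall_zero_iff] at this
    have e : (s • w + t • w') - l (s • a + t • a') = s • (w - l a) + t • (w' - l a') := by
      rw [map_add, map_smul, map_smul]; module
    rw [← e] at this
    exact this
  have hCs : ∀ p ∈ C, -p ∈ C := by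
    rintro ⟨w, a⟩ ⟨h1, h2⟩
    refine ⟨hKs _ h1, ?_⟩
    simp only [Prod.fst_neg, Prod.snd_neg, map_neg] at h2 ⊢
    rwa [← neg_sub', norm_neg]
  set m : EuclideanSpace ℝ (Fin n) → ENNReal := fun w => volume (Prod.mk w ⁻¹' C) with hm
  have hmm : Measurable m := measurable_measure_prodMk_left hC.measurableSet
  have mono : ∀ w, m w ≤ m (s • w) := fun w =>
    volume_section_le_of_symm hC hCc hK (fun p hp => hp.1) hCs w hs0.le hs1
  set v := volume (Metric.closedBall (0 : EuclideanSpace ℝ (Fin n)) ε) with hv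
  have hv0 : v ≠ 0 := (Metric.measure_closedBall_pos _ _ hε).ne'
  have hvt : v ≠ ∞ := measure_closedBall_lt_top.ne
  set R := 1 + ε with hR
  have sect : ∀ a, volume ((fun w => (w, a)) ⁻¹' C) = K.indicator (fun _ => v) a := by
    intro a
    by_cases ha : a ∈ K
    · rw [indicator_of_mem ha]
      have : (fun w => (w, a)) ⁻¹' C = Metric.closedBall (l a) ε := by
        ext w; simp [hCdef, ha, dist_eq_norm]
      rw [this, Measure.addHaar_closedBall_center]
    · rw [indicator_of_notMem ha]
      have : (fun w => (w, a)) ⁻¹' C = ∅ := by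
        ext x; simp [hCdef, ha]
      simp [this]
  have tot : ∫⁻ w, m w = v * volume K := by
    have h1 : ((volume : Measure (EuclideanSpace ℝ (Fin n))).prod
        (volume : Measure (Fin D → ℝ))) C = ∫⁻ w, m w := Measure.prod_apply hC.measurableSet
    rw [← h1, Measure.prod_apply_symm hC.measurableSet]
    simp only [sect]
    rw [lintegral_indicator_const hK.measurableSet]
  have supp : ∀ w, m w ≤ (Metric.closedBall 0 (s * R)).indicator m (s • w) := by
    intro w
    by_cases hw : ‖w‖ ≤ R
    · rw [indicator_of_mem]
      · exact mono w
      · rw [mem_closedBall_zero_iff, norm_smul, Real.norm_of_nonneg hs0.le]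
        gcongr
    · have : Prod.mk w ⁻¹' C = ∅ := by
        ext a
        simp only [hCdef, mem_preimage, mem_ofPred_eq, mem_empty_iff_false, iff_false]
        rintro ⟨h1, h2⟩
        refine hw ?_
        calc ‖w‖ = ‖l a + (w - l a)‖ := by congr 1; abel
          _ ≤ ‖l a‖ + ‖w - l a‖ := norm_add_le _ _
          _ ≤ R := add_le_add (hl a h1) h2
      simp [hm, this]
  have hball : MeasurableSet (Metric.closedBall (0 : EuclideanSpace ℝ (Fin n)) (s * R)) :=
    measurableSet_closedBall
  have h1 : v * volume K ≤ ENNReal.ofReal ((s ^ n)⁻¹) *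
      ∫⁻ w, (Metric.closedBall 0 (s * R)).indicator m w := by
    rw [← tot]
    refine (lintegral_mono supp).trans ?_
    rw [← lintegral_map (f := (Metric.closedBall 0 (s * R)).indicator m)
      (g := fun w => s • w) (hmm.indicator hball) (by fun_prop),
      Measure.map_addHaar_smul _ hs0.ne', lintegral_smul_measure]
    simp [abs_of_pos hs0]
  have h2 : ∫⁻ w, (Metric.closedBall 0 (s * R)).indicator m w ≤
      v * volume (K ∩ {a | ‖l a‖ ≤ s * R + ε}) := by
    set C' := C ∩ {p | ‖p.1‖ ≤ s * R} with hC'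
    have hC'm : MeasurableSet C' :=
      (hC.inter (isClosed_le (by fun_prop) continuous_const)).measurableSet
    have e : ∀ w, (Metric.closedBall 0 (s * R)).indicator m w = volume (Prod.mk w ⁻¹' C') := by
      intro w
      by_cases hw : ‖w‖ ≤ s * R
      · rw [indicator_of_mem (by simpa using hw)]
        simp only [hm]
        congr 1
        ext a; simp [hC', hw]
      · rw [indicator_of_notMem (by simpa using hw)]
        have : Prod.mk w ⁻¹' C' = ∅ := by
          ext a; simp [hC', hw]
        simp [this]
    simp only [e]
    have h1 : ((volume : Measure (EuclideanSpace ℝ (Fin n))).prod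
        (volume : Measure (Fin D → ℝ))) C' = _ := Measure.prod_apply hC'm
    rw [← h1, Measure.prod_apply_symm hC'm]
    have hKm : MeasurableSet (K ∩ {a | ‖l a‖ ≤ s * R + ε}) :=
      (hK.isClosed.inter (isClosed_le (by fun_prop) continuous_const)).measurableSet
    rw [← lintegral_indicator_const hKm]
    refine lintegral_mono fun a => ?_
    by_cases ha : a ∈ K ∩ {a | ‖l a‖ ≤ s * R + ε}
    · rw [indicator_of_mem ha]
      refine (measure_mono (preimage_mono inter_subset_left)).trans ?_
      rw [sect, indicator_of_mem ha.1]
    · have : (fun w => (w, a)) ⁻¹' C' = ∅ := by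
        ext w
        simp only [hC', hCdef, mem_preimage, mem_inter_iff, mem_ofPred_eq, mem_empty_iff_false,
          iff_false]
        rintro ⟨⟨h1, h2⟩, h3⟩
        refine ha ⟨h1, ?_⟩
        calc ‖l a‖ = ‖w - (w - l a)‖ := by congr 1; abel
          _ ≤ ‖w‖ + ‖w - l a‖ := norm_sub_le _ _
          _ ≤ s * R + ε := add_le_add h3 h2
      simp [this]
  have hsn : 0 < s ^ n := by positivity
  have h3 : v * (ENNReal.ofReal (s ^ n) * volume K) ≤
      v * volume (K ∩ {a | ‖l a‖ ≤ s * R + ε}) := by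
    refine le_trans ?_ h2
    calc v * (ENNReal.ofReal (s ^ n) * volume K) = ENNReal.ofReal (s ^ n) * (v * volume K) := by
          ring
      _ ≤ ENNReal.ofReal (s ^ n) * (ENNReal.ofReal ((s ^ n)⁻¹) * _) := by gcongr
      _ = _ := by
          rw [← mul_assoc, ← ENNReal.ofReal_mul hsn.le, mul_inv_cancel₀ hsn.ne', ofReal_one,
            one_mul]
  exact (ENNReal.mul_le_mul_iff_right hv0 hvt).1 h3

theorem pow_mul_volume_le {K : Set (Fin D → ℝ)} (hK : IsCompact K) (hKc : Convex ℝ K)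
    (hKs : ∀ a ∈ K, -a ∈ K) (l : (Fin D → ℝ) →ₗ[ℝ] EuclideanSpace ℝ (Fin n))
    (hl : ∀ a ∈ K, ‖l a‖ ≤ 1) {s : ℝ} (hs0 : 0 < s) (hs1 : s ≤ 1) :
    ENNReal.ofReal (s ^ n) * volume K ≤ volume (K ∩ {a | ‖l a‖ ≤ s}) := by
  have key : ∀ ε ∈ Ioo (0 : ℝ) (s / 2), ENNReal.ofReal (((s - ε) / (1 + ε)) ^ n) * volume K ≤
      volume (K ∩ {a | ‖l a‖ ≤ s}) := by
    rintro ε ⟨h1, h2⟩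
    have h3 : (s - ε) / (1 + ε) * (1 + ε) + ε = s := by field_simp; ring
    have := pow_mul_volume_le_thickened hK hKc hKs l hl h1 (s := (s - ε) / (1 + ε))
      (div_pos (by linarith) (by linarith)) ((div_le_one (by linarith)).2 (by linarith))
    rwa [h3] at this
  have lim : Tendsto (fun ε : ℝ => ENNReal.ofReal (((s - ε) / (1 + ε)) ^ n) * volume K) (𝓝[>] 0)
      (𝓝 (ENNReal.ofReal (s ^ n) * volume K)) := by
    refine ENNReal.Tendsto.mul_const ?_ (Or.inr hK.measure_lt_top.ne)
    refine tendsto_ofReal ?_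
    have : ContinuousAt (fun ε : ℝ => ((s - ε) / (1 + ε)) ^ n) 0 := by
      refine ContinuousAt.pow (ContinuousAt.div (by fun_prop) (by fun_prop) (by norm_num)) n
    have := this.tendsto
    simp only [sub_zero, add_zero, div_one] at this
    exact this.mono_left nhdsWithin_le_nhds
  refine le_of_tendsto lim ?_
  filter_upwards [Ioo_mem_nhdsGT (show (0 : ℝ) < s / 2 by linarith)] using key

theorem setIntegral_norm_sq_le {K : Set (Fin D → ℝ)} (hK : IsCompact K) (hKc : Convex ℝ K)
    (hKs : ∀ a ∈ K, -a ∈ K) (l : (Fin D → ℝ) →ₗ[ℝ] EuclideanSpace ℝ (Fin n))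
    (hl : ∀ a ∈ K, ‖l a‖ ≤ 1) :
    ∫ a in K, ‖l a‖ ^ 2 ≤ (n : ℝ) / (n + 2) * volume.real K := by
  have hlc : Continuous l := l.continuous_of_finiteDimensional
  have hKt : volume K ≠ ∞ := hK.measure_lt_top.ne
  have int1 : IntegrableOn (fun a => 1 - ‖l a‖ ^ 2) K volume :=
    ContinuousOn.integrableOn_compact hK (by fun_prop)
  have int2 : IntegrableOn (fun a => ‖l a‖ ^ 2) K volume :=
    ContinuousOn.integrableOn_compact hK (by fun_prop)
  have int0 : Integrable (fun _ : Fin D → ℝ => (1 : ℝ)) (volume.restrict K) :=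
    integrableOn_const hKt (by simp)
  have nn : 0 ≤ᵐ[volume.restrict K] fun a => 1 - ‖l a‖ ^ 2 := by
    filter_upwards [ae_restrict_mem hK.measurableSet] with a ha
    have := hl a ha
    have : ‖l a‖ ^ 2 ≤ 1 := pow_le_one₀ (norm_nonneg _) this
    simpa using this
  have h1 : ENNReal.ofReal (2 / (n + 2) * volume.real K) ≤
      ∫⁻ a in K, ENNReal.ofReal (1 - ‖l a‖ ^ 2) := by
    rw [lintegral_eq_lintegral_meas_le _ nn (by fun_prop)]
    have h2 : ∫⁻ t in Ioo (0 : ℝ) 1, ENNReal.ofReal ((1 - t) ^ ((n : ℝ) / 2)) * volume K ≤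
        ∫⁻ t in Ioi (0 : ℝ), (volume.restrict K) {a | t ≤ 1 - ‖l a‖ ^ 2} := by
      refine (setLIntegral_mono' measurableSet_Ioo fun t ht => ?_).trans
        (lintegral_mono_set Ioo_subset_Ioi_self)
      have hp : 0 < 1 - t := by linarith [ht.2]
      have := pow_mul_volume_le hK hKc hKs l hl (s := √(1 - t)) (Real.sqrt_pos.2 hp)
        (Real.sqrt_le_one.2 (by linarith [ht.1]))
      have e : √(1 - t) ^ n = (1 - t) ^ ((n : ℝ) / 2) := by
        rw [Real.sqrt_eq_rpow, ← Real.rpow_natCast, ← Real.rpow_mul hp.le]; congr 1; ring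
      rw [e] at this
      refine this.trans ?_
      rw [Measure.restrict_apply (measurableSet_le measurable_const (by fun_prop)), inter_comm]
      refine measure_mono (inter_subset_inter_left _ fun a ha => ?_)
      have := pow_le_pow_left₀ (norm_nonneg _) ha 2
      rw [Real.sq_sqrt hp.le] at this
      show t ≤ 1 - ‖l a‖ ^ 2
      linarith
    refine le_trans ?_ h2
    rw [lintegral_mul_const' _ _ hKt, ← ofReal_integral_eq_lintegral_ofReal]
    · have : ∫ t in Ioo (0 : ℝ) 1, (1 - t) ^ ((n : ℝ) / 2) = 2 / (n + 2) := by
        rw [← integral_Ioc_eq_integral_Ioo, ← intervalIntegral.integral_of_le zero_le_one,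
          intervalIntegral.integral_comp_sub_left (fun t => t ^ ((n : ℝ) / 2)) 1,
          sub_self, sub_zero, integral_rpow (Or.inl (by
            have : (0 : ℝ) ≤ (n : ℝ) / 2 := by positivity
            linarith))]
        rw [Real.zero_rpow (by positivity), Real.one_rpow]
        field_simp; ring
      rw [this, ENNReal.ofReal_mul (by positivity), Measure.real, ENNReal.ofReal_toReal hKt]
    · refine IntegrableOn.mono_set (t := Icc 0 1) ?_ Ioo_subset_Icc_self
      refine ContinuousOn.integrableOn_compact isCompact_Icc ?_
      exact ContinuousOn.rpow_const (by fun_prop) (fun x _ => Or.inr (by positivity))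
    · filter_upwards [ae_restrict_mem measurableSet_Ioo] with t ht
      have hp : 0 < 1 - t := by linarith [ht.2]
      positivity
  rw [← ofReal_integral_eq_lintegral_ofReal int1 nn,
    ENNReal.ofReal_le_ofReal_iff (integral_nonneg_of_ae nn),
    integral_sub int0 int2] at h1
  simp only [integral_const, smul_eq_mul, mul_one, measureReal_restrict_apply_univ] at h1
  have e : (n : ℝ) / (n + 2) * volume.real K =
    volume.real K - 2 / (n + 2) * volume.real K := by field_simp; ring
  rw [e]; linarith

end RadialDecrease

section Householder

theorem exists_orthogonal_mulVec_eq {n : ℕ} (v w : Fin n → ℝ) (h : ∑ i, v i ^ 2 = ∑ i, w i ^ 2) :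
    ∃ Q : Matrix (Fin n) (Fin n) ℝ, Q * Q.transpose = 1 ∧ Q.mulVec v = w := by
  by_cases hvw : v = w
  · exact ⟨1, by simp, by simp [hvw]⟩
  set u := v - w with hu
  have hu0 : u ⬝ᵥ u ≠ 0 := fun h0 => hvw (sub_eq_zero.1 (dotProduct_self_eq_zero.1 h0))
  set c := 2 / (u ⬝ᵥ u) with hc
  have hcu : c * (u ⬝ᵥ u) = 2 := by rw [hc]; field_simp
  have huv : 2 * (u ⬝ᵥ v) = u ⬝ᵥ u := by
    have h' : v ⬝ᵥ v = w ⬝ᵥ w := by simpa [dotProduct, sq] using h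
    simp only [hu, sub_dotProduct, dotProduct_sub, dotProduct_comm w v, h']
    ring
  refine ⟨1 - c • Matrix.vecMulVec u u, ?_, ?_⟩
  · rw [Matrix.transpose_sub, Matrix.transpose_smul, Matrix.transpose_one,
      Matrix.transpose_vecMulVec, sub_mul, mul_sub, mul_sub]
    simp only [one_mul, mul_one, Matrix.smul_mul, Matrix.mul_smul,
      Matrix.vecMulVec_mul_vecMulVec, smul_smul, Matrix.vecMulVec_smul]
    rw [hcu]
    module
  · rw [Matrix.sub_mulVec, Matrix.one_mulVec, Matrix.smul_mulVec, Matrix.vecMulVec_mulVec]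
    ext i
    simp only [Pi.sub_apply, Pi.smul_apply, MulOpposite.smul_eq_mul_unop, MulOpposite.unop_op,
      smul_eq_mul]
    have : c * (u i * (u ⬝ᵥ v)) = u i := by
      have : c * (u ⬝ᵥ v) = 1 := by
        rw [← huv] at hcu; linarith
      rw [mul_left_comm, this, mul_one]
    rw [this, hu]; simp

end Householder

section Bathtub
open Set Filter Topology ENNReal
variable {D : ℕ}

theorem volume_sublevel {G : (Fin D → ℝ) → ℝ} (hh : ∀ (s : ℝ) a, G (s • a) = s ^ 2 * G a)
    {u : ℝ} (hu : 0 < u) :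
    volume {a | G a ≤ u} = ENNReal.ofReal (u ^ ((D : ℝ) / 2)) * volume {a | G a ≤ 1} := by
  have e : {a | G a ≤ 1} = ((√u) • ·) ⁻¹' {a | G a ≤ u} := by
    ext a
    simp only [mem_ofPred_eq, mem_preimage, hh, Real.sq_sqrt hu.le]
    rw [mul_le_iff_le_one_right hu]
  have hs : 0 < √u := Real.sqrt_pos.2 hu
  rw [e, Measure.addHaar_preimage_smul _ hs.ne', ← mul_assoc, ← ENNReal.ofReal_mul (by positivity)]
  have : u ^ ((D : ℝ) / 2) = √u ^ D := by
    rw [Real.sqrt_eq_rpow, ← Real.rpow_natCast, ← Real.rpow_mul hu.le]; congr 1; ring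
  rw [this, abs_of_pos (by positivity)]
  simp [hs.ne']

theorem volume_le_of_setIntegral_le {G : (Fin D → ℝ) → ℝ} (hG : Continuous G)
    (h0 : ∀ a, 0 ≤ G a) (hh : ∀ (s : ℝ) a, G (s • a) = s ^ 2 * G a) (hD : 0 < D)
    {K : Set (Fin D → ℝ)} (hK : IsCompact K) {κ : ℝ} (hκ : 0 < κ)
    (hle : ∫ a in K, G a ≤ κ * volume.real K) :
    volume K ≤ ENNReal.ofReal ((κ * (D + 2) / D) ^ ((D : ℝ) / 2)) * volume {a | G a ≤ 1} := by
  have hD' : (0 : ℝ) < D := by exact_mod_cast hD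
  set ρ := κ * (D + 2) / D with hρ
  have hρ0 : 0 < ρ := by positivity
  have hρκ : ρ - κ = 2 * κ / D := by rw [hρ]; field_simp; ring
  have hKt : volume K ≠ ∞ := hK.measure_lt_top.ne
  have int2 : Integrable G (volume.restrict K) := hG.continuousOn.integrableOn_compact hK
  have int0 : Integrable (fun _ : Fin D → ℝ => ρ) (volume.restrict K) :=
    integrableOn_const hKt (by simp)
  have h1 : ENNReal.ofReal (ρ - κ) * volume K ≤ ∫⁻ a, ENNReal.ofReal (max (ρ - G a) 0) := by
    have : (ρ - κ) * volume.real K ≤ ∫ a in K, max (ρ - G a) 0 := by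
      calc (ρ - κ) * volume.real K ≤ ∫ a in K, (ρ - G a) := by
            rw [integral_sub int0 int2]
            simp only [integral_const, smul_eq_mul, measureReal_restrict_apply_univ]
            linarith
        _ ≤ _ := integral_mono (int0.sub int2)
            (((int0.sub int2).sup (integrable_zero _ _ _))) fun a => le_max_left _ _
    calc ENNReal.ofReal (ρ - κ) * volume K = ENNReal.ofReal ((ρ - κ) * volume.real K) := by
          rw [ENNReal.ofReal_mul (by rw [hρκ]; positivity), Measure.real,
            ENNReal.ofReal_toReal hKt]
      _ ≤ ENNReal.ofReal (∫ a in K, max (ρ - G a) 0) := ENNReal.ofReal_le_ofReal this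
      _ = ∫⁻ a in K, ENNReal.ofReal (max (ρ - G a) 0) := by
          refine ofReal_integral_eq_lintegral_ofReal ?_ (.of_forall fun a => le_max_right _ _)
          exact (int0.sub int2).sup (integrable_zero _ _ _)
      _ ≤ _ := setLIntegral_le_lintegral _ _
  have h2 : ∫⁻ a, ENNReal.ofReal (max (ρ - G a) 0) =
      ENNReal.ofReal (ρ ^ ((D : ℝ) / 2) * (ρ - κ)) * volume {a | G a ≤ 1} := by
    have hfm : Measurable fun a => max (ρ - G a) 0 :=
      (measurable_const.sub hG.measurable).max measurable_const
    rw [lintegral_eq_lintegral_meas_le volume (f := fun a => max (ρ - G a) 0)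
      (.of_forall fun a => le_max_right _ _) hfm.aemeasurable]
    have : ∀ t ∈ Ioi (0 : ℝ), volume {a | t ≤ max (ρ - G a) 0} =
        (Iio ρ).indicator (fun t => ENNReal.ofReal ((ρ - t) ^ ((D : ℝ) / 2))) t *
          volume {a | G a ≤ 1} + (Iic ρ \ Iio ρ).indicator
            (fun t => volume {a | t ≤ max (ρ - G a) 0}) t := by
      intro t ht
      rcases lt_trichotomy t ρ with h | h | h
      · rw [indicator_of_mem (by exact h), indicator_of_notMem (by simp [h.ne]),
          ← volume_sublevel hh (by linarith), add_zero]
        congr 1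
        ext a
        have : ¬ t ≤ 0 := not_le.2 ht
        simp only [mem_ofPred_eq, le_max_iff, this, or_false]
        constructor <;> intro <;> linarith
      · rw [indicator_of_notMem (by simp [h]), indicator_of_mem (by simp [h])]
        simp
      · have e : {a | t ≤ max (ρ - G a) 0} = ∅ := by
          ext a
          have : ¬ t ≤ 0 := not_le.2 ht
          simp only [mem_ofPred_eq, le_max_iff, this, or_false, mem_empty_iff_false, iff_false]
          have := h0 a
          intro; linarith
        rw [indicator_of_notMem (by simp [h.le]), indicator_of_notMem (by simp [h.ne']), e]
        simp
    have hae : ∀ᵐ t ∂(volume.restrict (Ioi (0 : ℝ))), volume {a | t ≤ max (ρ - G a) 0} =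
        (Iio ρ).indicator (fun t => ENNReal.ofReal ((ρ - t) ^ ((D : ℝ) / 2))) t *
          volume {a | G a ≤ 1} := by
      have hne : ∀ᵐ t ∂(volume.restrict (Ioi (0 : ℝ))), t ≠ ρ :=
        ae_restrict_of_ae (Measure.ae_ne volume ρ)
      filter_upwards [ae_restrict_mem measurableSet_Ioi, hne] with t ht htρ
      rw [this t ht, indicator_of_notMem (s := Iic ρ \ Iio ρ), add_zero]
      rintro ⟨h1, h2⟩
      exact htρ (le_antisymm h1 (not_lt.1 h2))
    have hmeas : Measurable ((Iio ρ).indicator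
        (fun t => ENNReal.ofReal ((ρ - t) ^ ((D : ℝ) / 2)))) :=
      Measurable.indicator (by fun_prop) measurableSet_Iio
    rw [lintegral_congr_ae hae, lintegral_mul_const _ hmeas,
      lintegral_indicator measurableSet_Iio, Measure.restrict_restrict measurableSet_Iio,
      inter_comm, Ioi_inter_Iio, ← ofReal_integral_eq_lintegral_ofReal]
    · congr 2
      rw [← integral_Ioc_eq_integral_Ioo, ← intervalIntegral.integral_of_le hρ0.le,
          intervalIntegral.integral_comp_sub_left (fun t => t ^ ((D : ℝ) / 2)) ρ,
          sub_self, sub_zero, integral_rpow (Or.inl (by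
            have : (0 : ℝ) ≤ (D : ℝ) / 2 := by positivity
            linarith)), Real.zero_rpow (by positivity), Real.rpow_add hρ0, Real.rpow_one, hρκ]
      rw [hρ]
      field_simp
      ring
    · refine IntegrableOn.mono_set (t := Icc 0 ρ) ?_ Ioo_subset_Icc_self
      refine ContinuousOn.integrableOn_compact isCompact_Icc ?_
      exact ContinuousOn.rpow_const (by fun_prop) (fun x _ => Or.inr (by positivity))
    · filter_upwards [ae_restrict_mem measurableSet_Ioo] with t ht
      have hp : 0 < ρ - t := by linarith [ht.2]
      positivity
  have hpos : 0 < ρ - κ := by rw [hρκ]; positivity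
  rw [h2, ENNReal.ofReal_mul (by positivity), mul_comm (ENNReal.ofReal _) (ENNReal.ofReal (ρ - κ)),
    mul_assoc] at h1
  exact (ENNReal.mul_le_mul_iff_right (by simpa using hpos) ofReal_ne_top).1 h1

theorem volume_sublevel_le_of_le {G : (Fin D → ℝ) → ℝ} (T : (Fin D → ℝ) →ₗ[ℝ] (Fin D → ℝ))
    (hT : LinearMap.det T ≠ 0) (hle : ∀ a, ∑ i, T a i ^ 2 ≤ G a) :
    volume {a | G a ≤ 1} ≤ ENNReal.ofReal |(LinearMap.det T)⁻¹| *
      volume {a : Fin D → ℝ | ∑ i, a i ^ 2 ≤ 1} := by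
  rw [← Measure.addHaar_preimage_linearMap _ hT]
  exact measure_mono fun a ha => (hle a).trans ha

end Bathtub

section BallMoments
open Set Filter Topology ENNReal
variable {D : ℕ}

theorem setLIntegral_sq_le_eq {h : (Fin D → ℝ) → ENNReal} (hm : Measurable h) {p : ℕ}
    (hh : ∀ s > 0, ∀ a, h (s • a) = ENNReal.ofReal (s ^ (2 * p)) * h a) {u : ℝ} (hu : 0 < u) :
    ∫⁻ a in {a | ∑ i, a i ^ 2 ≤ u}, h a =
      ENNReal.ofReal (u ^ ((D : ℝ) / 2 + p)) * ∫⁻ a in {a | ∑ i, a i ^ 2 ≤ 1}, h a := by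
  have hs : 0 < √u := Real.sqrt_pos.2 hu
  have hS : ∀ v : ℝ, MeasurableSet {a : Fin D → ℝ | ∑ i, a i ^ 2 ≤ v} := fun v =>
    measurableSet_le (by fun_prop) measurable_const
  rw [← lintegral_indicator (hS u), ← lintegral_indicator (hS 1)]
  set F := indicator {a : Fin D → ℝ | ∑ i, a i ^ 2 ≤ u} h with hF
  have hFm : Measurable F := hm.indicator (hS u)
  have e1 : ∀ a, F (√u • a) = ENNReal.ofReal (u ^ p) *
      indicator {a : Fin D → ℝ | ∑ i, a i ^ 2 ≤ 1} h a := by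
    intro a
    have e : ∑ i, (√u • a) i ^ 2 = u * ∑ i, a i ^ 2 := by
      rw [Finset.mul_sum]
      refine Finset.sum_congr rfl fun i _ => ?_
      rw [Pi.smul_apply, smul_eq_mul, mul_pow, Real.sq_sqrt hu.le]
    by_cases ha : ∑ i, a i ^ 2 ≤ 1
    · rw [indicator_of_mem (by exact ha), hF, indicator_of_mem, hh _ hs, pow_mul,
        Real.sq_sqrt hu.le]
      show ∑ i, (√u • a) i ^ 2 ≤ u
      rw [e]; nlinarith
    · rw [indicator_of_notMem (by exact ha), hF, indicator_of_notMem, mul_zero]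
      show ¬ ∑ i, (√u • a) i ^ 2 ≤ u
      rw [e]
      push Not at ha ⊢
      nlinarith
  have e2 : ∫⁻ a, F (√u • a) = ENNReal.ofReal ((√u ^ D)⁻¹) * ∫⁻ a, F a := by
    rw [← lintegral_map (f := F) (g := fun w => √u • w) hFm (by fun_prop),
      Measure.map_addHaar_smul _ hs.ne', lintegral_smul_measure]
    simp [abs_of_pos hs]
  simp only [e1] at e2
  rw [lintegral_const_mul' _ _ ofReal_ne_top] at e2
  have e3 : u ^ ((D : ℝ) / 2 + p) = √u ^ D * u ^ p := by
    rw [Real.rpow_add hu, Real.rpow_natCast, Real.sqrt_eq_rpow, ← Real.rpow_natCast (u ^ _) D,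
      ← Real.rpow_mul hu.le]
    congr 2; ring
  rw [e3, ENNReal.ofReal_mul (by positivity), mul_assoc, e2, ← mul_assoc,
    ← ENNReal.ofReal_mul (by positivity), mul_inv_cancel₀ (by positivity), ofReal_one, one_mul]

theorem lintegral_mul_exp_neg_sq {h : (Fin D → ℝ) → ENNReal} (hm : Measurable h) {p : ℕ}
    (hh : ∀ s > 0, ∀ a, h (s • a) = ENNReal.ofReal (s ^ (2 * p)) * h a) :
    ∫⁻ a, h a * ENNReal.ofReal (Real.exp (-∑ i, a i ^ 2)) =
      ENNReal.ofReal (Real.Gamma ((D : ℝ) / 2 + p + 1)) *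
        ∫⁻ a in {a | ∑ i, a i ^ 2 ≤ 1}, h a := by
  have hN : Measurable fun a : Fin D → ℝ => ∑ i, a i ^ 2 := by fun_prop
  have h1 : ∀ a : Fin D → ℝ, ENNReal.ofReal (Real.exp (-∑ i, a i ^ 2)) =
      ∫⁻ u in Ioi (0 : ℝ), {u : ℝ | ∑ i, a i ^ 2 ≤ u}.indicator
        (fun u => ENNReal.ofReal (Real.exp (-u))) u := by
    intro a
    have h0 : 0 ≤ ∑ i, a i ^ 2 := Finset.sum_nonneg fun i _ => sq_nonneg _
    rw [← integral_exp_neg_Ioi, ofReal_integral_eq_lintegral_ofReal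
      (integrableOn_exp_neg_Ioi _) (.of_forall fun _ => (Real.exp_pos _).le),
      ← lintegral_indicator measurableSet_Ioi, ← lintegral_indicator measurableSet_Ioi]
    refine lintegral_congr_ae ?_
    have hne : ∀ᵐ t : ℝ, t ≠ ∑ i, a i ^ 2 := Measure.ae_ne volume _
    filter_upwards [hne] with t ht
    by_cases h : ∑ i, a i ^ 2 < t
    · rw [indicator_of_mem (by exact h), indicator_of_mem (by exact h0.trans_lt h),
        indicator_of_mem (by exact h.le)]
    · have h' : ¬ ∑ i, a i ^ 2 ≤ t := by
        push Not at h ⊢; exact lt_of_le_of_ne h ht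
      rw [indicator_of_notMem (by exact h)]
      by_cases h2 : 0 < t
      · rw [indicator_of_mem (by exact h2), indicator_of_notMem (by exact h')]
      · rw [indicator_of_notMem (by exact h2)]
  have hmS : MeasurableSet {q : (Fin D → ℝ) × ℝ | ∑ i, q.1 i ^ 2 ≤ q.2} :=
    measurableSet_le (by fun_prop) (by fun_prop)
  simp_rw [h1]
  have h2 : ∀ a : Fin D → ℝ, h a * (∫⁻ u in Ioi (0 : ℝ), {u : ℝ | ∑ i, a i ^ 2 ≤ u}.indicator
        (fun u => ENNReal.ofReal (Real.exp (-u))) u) =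
      ∫⁻ u in Ioi (0 : ℝ), {q : (Fin D → ℝ) × ℝ | ∑ i, q.1 i ^ 2 ≤ q.2}.indicator
        (fun q => h q.1 * ENNReal.ofReal (Real.exp (-q.2))) (a, u) := by
    intro a
    rw [← lintegral_const_mul]
    · refine lintegral_congr fun u => ?_
      by_cases hu : ∑ i, a i ^ 2 ≤ u
      · rw [indicator_of_mem (by exact hu), indicator_of_mem (by exact hu)]
      · rw [indicator_of_notMem (by exact hu), indicator_of_notMem (by exact hu), mul_zero]
    · exact Measurable.indicator (by fun_prop) measurableSet_Ici
  simp_rw [h2]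
  rw [lintegral_lintegral_swap]
  swap
  · exact (Measurable.indicator (by fun_prop) hmS).aemeasurable
  have h3 : ∀ u ∈ Ioi (0 : ℝ), (∫⁻ a, {q : (Fin D → ℝ) × ℝ | ∑ i, q.1 i ^ 2 ≤ q.2}.indicator
        (fun q => h q.1 * ENNReal.ofReal (Real.exp (-q.2))) (a, u)) =
      ENNReal.ofReal (Real.exp (-u) * u ^ ((D : ℝ) / 2 + p + 1 - 1)) *
        ∫⁻ a in {a | ∑ i, a i ^ 2 ≤ 1}, h a := by
    intro u hu
    rw [add_sub_cancel_right, ENNReal.ofReal_mul (Real.exp_pos _).le, mul_assoc,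
      ← setLIntegral_sq_le_eq hm hh hu, ← lintegral_const_mul' _ _ ofReal_ne_top,
      ← lintegral_indicator (measurableSet_le hN measurable_const)]
    refine lintegral_congr fun a => ?_
    by_cases hu : ∑ i, a i ^ 2 ≤ u
    · rw [indicator_of_mem (by exact hu), indicator_of_mem (by exact hu), mul_comm]
    · rw [indicator_of_notMem (by exact hu), indicator_of_notMem (by exact hu)]
  rw [setLIntegral_congr_fun measurableSet_Ioi h3, lintegral_mul_const _ (by fun_prop),
    ← ofReal_integral_eq_lintegral_ofReal, ← Real.Gamma_eq_integral (by positivity)]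
  · exact Real.GammaIntegral_convergent (by positivity)
  · filter_upwards [ae_restrict_mem measurableSet_Ioi] with t ht
    have : 0 < t := ht
    positivity

theorem lintegral_pow_mul_exp_neg_sq (p : ℕ) :
    ∫⁻ x : ℝ, ENNReal.ofReal (x ^ (2 * p)) * ENNReal.ofReal (Real.exp (-x ^ 2)) =
      ENNReal.ofReal (Real.Gamma (p + 1 / 2)) := by
  have e : ∀ x : ℝ, x ^ (2 * p) * Real.exp (-x ^ 2) =
      |x| ^ (2 * (p : ℝ)) * Real.exp (-|x| ^ (2 : ℝ)) := by
    intro x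
    have := Real.rpow_natCast |x| (2 * p)
    push_cast at this
    rw [this, pow_mul, pow_mul, sq_abs]
    norm_num
  have int : Integrable fun x : ℝ => x ^ (2 * p) * Real.exp (-x ^ 2) := by
    have := integrable_rpow_mul_exp_neg_mul_sq (b := 1) one_pos (s := ((2 * p : ℕ) : ℝ))
      (by have : (0 : ℝ) ≤ ((2 * p : ℕ) : ℝ) := by positivity
          linarith)
    simp only [Real.rpow_natCast, neg_mul, one_mul] at this
    exact this
  have : ∫ x : ℝ, x ^ (2 * p) * Real.exp (-x ^ 2) = Real.Gamma (p + 1 / 2) := by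
    simp_rw [e]
    rw [integral_comp_abs (f := fun x => x ^ (2 * (p : ℝ)) * Real.exp (-x ^ (2 : ℝ))),
      integral_rpow_mul_exp_neg_rpow two_pos]
    · ring_nf
    · have : (0 : ℝ) ≤ 2 * p := by positivity
      linarith
  rw [← this, ofReal_integral_eq_lintegral_ofReal int]
  · refine lintegral_congr fun x => ?_
    rw [ENNReal.ofReal_mul (by rw [pow_mul]; positivity)]
  · refine .of_forall fun x => ?_
    have : 0 ≤ x ^ (2 * p) := by rw [pow_mul]; positivity
    show 0 ≤ x ^ (2 * p) * Real.exp (-x ^ 2)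
    positivity

theorem two_pow_mul_Gamma_le (p : ℕ) :
    2 ^ p * Real.Gamma (p + 1 / 2) ≤ (p : ℝ) ^ p * Real.Gamma (1 / 2) := by
  have hG : 0 < Real.Gamma (1 / 2) := Real.Gamma_pos_of_pos (by norm_num)
  induction p with
  | zero => simp
  | succ p ih =>
    rcases Nat.eq_zero_or_pos p with rfl | hp
    · have : Real.Gamma (((0 + 1 : ℕ) : ℝ) + 1 / 2) = 1 / 2 * Real.Gamma (1 / 2) := by
        rw [← Real.Gamma_add_one (by norm_num)]; norm_num
      rw [this]; norm_num
      linarith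
    · have : Real.Gamma (((p + 1 : ℕ) : ℝ) + 1 / 2) = (p + 1 / 2) * Real.Gamma (p + 1 / 2) := by
        rw [← Real.Gamma_add_one (by positivity)]; push_cast; ring_nf
      rw [this]
      have hb : 2 * (p : ℝ) ^ p ≤ ((p + 1 : ℕ) : ℝ) ^ p := by
        have hp' : (0 : ℝ) < p := by exact_mod_cast hp
        have := one_add_mul_le_pow (a := 1 / (p : ℝ)) (by
          have : 0 < 1 / (p : ℝ) := by positivity
          linarith) p
        rw [mul_one_div_cancel hp'.ne', one_add_div hp'.ne', div_pow, le_div_iff₀ (by positivity)]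
          at this
        push_cast
        linarith
      calc 2 ^ (p + 1) * ((p + 1 / 2) * Real.Gamma (p + 1 / 2))
          = (2 * p + 1) * (2 ^ p * Real.Gamma (p + 1 / 2)) := by ring
        _ ≤ (2 * p + 1) * ((p : ℝ) ^ p * Real.Gamma (1 / 2)) := by gcongr
        _ ≤ (2 * (p + 1)) * ((p : ℝ) ^ p * Real.Gamma (1 / 2)) := by gcongr; linarith
        _ = (p + 1) * Real.Gamma (1 / 2) * (2 * (p : ℝ) ^ p) := by ring
        _ ≤ (p + 1) * Real.Gamma (1 / 2) * ((p + 1 : ℕ) : ℝ) ^ p := by gcongr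
        _ = _ := by push_cast; ring

theorem pow_mul_Gamma_le (D p : ℕ) :
    (D : ℝ) ^ p * Real.Gamma ((D : ℝ) / 2 + 1) ≤ 2 ^ p * Real.Gamma ((D : ℝ) / 2 + p + 1) := by
  induction p with
  | zero => simp
  | succ p ih =>
    have : Real.Gamma ((D : ℝ) / 2 + (p + 1 : ℕ) + 1) =
        ((D : ℝ) / 2 + p + 1) * Real.Gamma ((D : ℝ) / 2 + p + 1) := by
      rw [← Real.Gamma_add_one (by positivity)]; push_cast; ring_nf
    rw [this]
    have hG : 0 < Real.Gamma ((D : ℝ) / 2 + p + 1) := Real.Gamma_pos_of_pos (by positivity)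
    calc (D : ℝ) ^ (p + 1) * Real.Gamma ((D : ℝ) / 2 + 1)
        = D * ((D : ℝ) ^ p * Real.Gamma ((D : ℝ) / 2 + 1)) := by ring
      _ ≤ D * (2 ^ p * Real.Gamma ((D : ℝ) / 2 + p + 1)) := by gcongr
      _ ≤ (D + 2 * p + 2) * (2 ^ p * Real.Gamma ((D : ℝ) / 2 + p + 1)) := by
          gcongr
          have : (0 : ℝ) ≤ p := by positivity
          linarith
      _ = _ := by ring

theorem setLIntegral_coord_pow_le {d : ℕ} (p : ℕ) :
    ENNReal.ofReal (((d + 1 : ℕ) : ℝ) ^ p) *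
        ∫⁻ a in {a : Fin (d + 1) → ℝ | ∑ i, a i ^ 2 ≤ 1}, ENNReal.ofReal (a 0 ^ (2 * p)) ≤
      ENNReal.ofReal ((p : ℝ) ^ p) * volume {a : Fin (d + 1) → ℝ | ∑ i, a i ^ 2 ≤ 1} := by
  have gauss : ∀ q : ℕ, ENNReal.ofReal (Real.Gamma (((d + 1 : ℕ) : ℝ) / 2 + q + 1)) *
      ∫⁻ a in {a : Fin (d + 1) → ℝ | ∑ i, a i ^ 2 ≤ 1}, ENNReal.ofReal (a 0 ^ (2 * q)) =
      ENNReal.ofReal (Real.Gamma (q + 1 / 2)) *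
        ∫⁻ y : Fin d → ℝ, ENNReal.ofReal (Real.exp (-∑ i, y i ^ 2)) := by
    intro q
    rw [← lintegral_mul_exp_neg_sq (by fun_prop)]
    · have e := (volume_preserving_piFinSuccAbove (fun _ : Fin (d + 1) => ℝ) 0).symm
      rw [← e.lintegral_comp (by fun_prop), Measure.volume_eq_prod]
      refine (lintegral_prod _ (by
        refine Measurable.aemeasurable (Measurable.comp (g := fun a : Fin (d + 1) → ℝ =>
          ENNReal.ofReal (a 0 ^ (2 * q)) * ENNReal.ofReal (Real.exp (-∑ i, a i ^ 2)))
          (by fun_prop) e.measurable))).trans ?_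
      rw [← lintegral_pow_mul_exp_neg_sq, ← lintegral_mul_const _ (by fun_prop)]
      refine lintegral_congr fun s => ?_
      rw [← lintegral_const_mul _ (by fun_prop)]
      refine lintegral_congr fun y => ?_
      simp only [MeasurableEquiv.piFinSuccAbove, Fin.insertNthEquiv]
      simp [Fin.sum_univ_succ, neg_add_rev, Real.exp_add, ENNReal.ofReal_mul, Real.exp_nonneg]
      ring
    · intro s hs a
      rw [Pi.smul_apply, smul_eq_mul, mul_pow, ENNReal.ofReal_mul (by positivity)]
  have g0 := gauss 0
  have gp := gauss p
  simp only [mul_zero, pow_zero, ofReal_one, lintegral_one, Measure.restrict_apply_univ,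
    Nat.cast_zero, add_zero, zero_add] at g0
  set J := ∫⁻ a in {a : Fin (d + 1) → ℝ | ∑ i, a i ^ 2 ≤ 1}, ENNReal.ofReal (a 0 ^ (2 * p))
  set V := volume {a : Fin (d + 1) → ℝ | ∑ i, a i ^ 2 ≤ 1}
  set Z := ∫⁻ y : Fin d → ℝ, ENNReal.ofReal (Real.exp (-∑ i, y i ^ 2))
  set x := ((d + 1 : ℕ) : ℝ)
  have hx : 0 ≤ x := by positivity
  have hc : 0 < Real.Gamma (x / 2 + 1) := Real.Gamma_pos_of_pos (by positivity)
  refine (ENNReal.mul_le_mul_iff_right (a := ENNReal.ofReal (Real.Gamma (x / 2 + 1)))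
    (by simpa using hc) ofReal_ne_top).1 ?_
  calc ENNReal.ofReal (Real.Gamma (x / 2 + 1)) * (ENNReal.ofReal (x ^ p) * J)
      = ENNReal.ofReal (x ^ p * Real.Gamma (x / 2 + 1)) * J := by
        rw [ENNReal.ofReal_mul (by positivity)]; ring
    _ ≤ ENNReal.ofReal (2 ^ p * Real.Gamma (x / 2 + p + 1)) * J := by
        exact mul_le_mul' (ENNReal.ofReal_le_ofReal (pow_mul_Gamma_le _ _)) le_rfl
    _ = ENNReal.ofReal (2 ^ p) * (ENNReal.ofReal (Real.Gamma (p + 1 / 2)) * Z) := by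
        rw [ENNReal.ofReal_mul (by positivity), mul_assoc, gp]
    _ = ENNReal.ofReal (2 ^ p * Real.Gamma (p + 1 / 2)) * Z := by
        rw [ENNReal.ofReal_mul (by positivity), mul_assoc]
    _ ≤ ENNReal.ofReal ((p : ℝ) ^ p * Real.Gamma (1 / 2)) * Z := by
        exact mul_le_mul' (ENNReal.ofReal_le_ofReal (two_pow_mul_Gamma_le p)) le_rfl
    _ = ENNReal.ofReal ((p : ℝ) ^ p) * (ENNReal.ofReal (Real.Gamma (x / 2 + 1)) * V) := by
        rw [ENNReal.ofReal_mul (by positivity), mul_assoc, g0]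
    _ = _ := by ring

theorem setLIntegral_dotProduct_pow_le (hD : 0 < D) {v : Fin D → ℝ} (hv : ∑ i, v i ^ 2 = D)
    (p : ℕ) :
    ∫⁻ a in {a : Fin D → ℝ | ∑ i, a i ^ 2 ≤ 1}, ENNReal.ofReal ((∑ i, a i * v i) ^ (2 * p)) ≤
      ENNReal.ofReal ((p : ℝ) ^ p) * volume {a : Fin D → ℝ | ∑ i, a i ^ 2 ≤ 1} := by
  obtain ⟨d, rfl⟩ := Nat.exists_eq_succ_of_ne_zero hD.ne'
  refine le_trans ?_ (setLIntegral_coord_pow_le p)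
  obtain ⟨Q, hQ, hQv⟩ := exists_orthogonal_mulVec_eq (Pi.single 0 (√((d + 1 : ℕ) : ℝ))) v (by
    rw [hv, Finset.sum_eq_single 0]
    · simp [Real.sq_sqrt (show (0 : ℝ) ≤ d + 1 by positivity)]
    · intro i _ hi; simp [hi]
    · simp)
  have hsq : ∀ a : Fin (d + 1) → ℝ, ∑ i, Q.mulVec a i ^ 2 = ∑ i, a i ^ 2 := by
    intro a
    have hQ' : Q.transpose * Q = 1 := mul_eq_one_comm.1 hQ
    have : Q.mulVec a ⬝ᵥ Q.mulVec a = a ⬝ᵥ a := by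
      rw [Matrix.dotProduct_mulVec, Matrix.vecMul_mulVec, hQ']
      simp
    simpa [dotProduct, sq] using this
  have hp := measurePreserving_of_sum_sq (L := Matrix.toLin' Q) (by simpa using hsq)
  have hS : MeasurableSet {a : Fin (d + 1) → ℝ | ∑ i, a i ^ 2 ≤ 1} :=
    measurableSet_le (by fun_prop) measurable_const
  rw [← lintegral_indicator hS, ← hp.lintegral_comp (Measurable.indicator (by fun_prop) hS),
    ← lintegral_const_mul' _ _ ofReal_ne_top, ← lintegral_indicator hS]
  refine lintegral_mono fun a => ?_
  have hmem : Matrix.toLin' Q a ∈ {a : Fin (d + 1) → ℝ | ∑ i, a i ^ 2 ≤ 1} ↔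
      a ∈ {a : Fin (d + 1) → ℝ | ∑ i, a i ^ 2 ≤ 1} := by
    simp only [mem_ofPred_eq, Matrix.toLin'_apply, hsq]
  by_cases ha : a ∈ {a : Fin (d + 1) → ℝ | ∑ i, a i ^ 2 ≤ 1}
  · rw [indicator_of_mem ha, indicator_of_mem (hmem.2 ha)]
    have : ∑ i, Matrix.toLin' Q a i * v i = a 0 * √((d + 1 : ℕ) : ℝ) := by
      have h1 : Q.mulVec a ⬝ᵥ v = a ⬝ᵥ Pi.single 0 (√((d + 1 : ℕ) : ℝ)) := by
        have hQ' : Q.transpose * Q = 1 := mul_eq_one_comm.1 hQ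
        rw [← hQv, Matrix.dotProduct_mulVec, Matrix.vecMul_mulVec, hQ']
        simp
      rw [dotProduct_single] at h1
      exact h1
    rw [this, mul_pow, pow_mul (√_), Real.sq_sqrt (by positivity), mul_comm,
      ENNReal.ofReal_mul (by positivity)]
  · rw [indicator_of_notMem ha, indicator_of_notMem (mt hmem.1 ha)]

end BallMoments

section BiformBasics
open BiformPaper Set Filter Topology
variable {n m : ℕ}

theorem continuous_beval (f : MvPolynomial (Fin n ⊕ Fin m) ℝ) :
    Continuous fun p : (Fin n → ℝ) × (Fin m → ℝ) => beval f p.1 p.2 := by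
  unfold beval
  refine (MvPolynomial.continuous_eval f).comp (continuous_pi fun i => ?_)
  rcases i with i | i
  · exact (continuous_apply i).comp continuous_fst
  · exact (continuous_apply i).comp continuous_snd

theorem isClosed_unitSphere (n : ℕ) : IsClosed (unitSphere n) :=
  isClosed_eq (by fun_prop) continuous_const

theorem isCompact_unitSphere (n : ℕ) : IsCompact (unitSphere n) := by
  refine Metric.isCompact_of_isClosed_isBounded (isClosed_unitSphere n) ?_
  refine (Metric.isBounded_closedBall (x := (0 : Fin n → ℝ)) (r := 1)).subset fun x hx => ?_
  rw [mem_closedBall_zero_iff, pi_norm_le_iff_of_nonneg zero_le_one]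
  intro i
  have h : x i ^ 2 ≤ ∑ j, x j ^ 2 :=
    Finset.single_le_sum (f := fun j => x j ^ 2) (fun _ _ => sq_nonneg _) (Finset.mem_univ i)
  rw [show ∑ j, x j ^ 2 = 1 from hx] at h
  rw [Real.norm_eq_abs]
  exact abs_le_one_iff_mul_self_le_one.2 (by nlinarith)

theorem isCompact_sphereProd (n m : ℕ) : IsCompact (unitSphere n ×ˢ unitSphere m) :=
  (isCompact_unitSphere n).prod (isCompact_unitSphere m)

theorem nonempty_unitSphere (hn : 0 < n) : (unitSphere n).Nonempty := by
  refine ⟨Pi.single ⟨0, hn⟩ 1, ?_⟩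
  change ∑ i, _ = (1 : ℝ)
  rw [Finset.sum_eq_single ⟨0, hn⟩] <;> simp +contextual

theorem exists_unitSphere_smul (hn : 0 < n) (x : Fin n → ℝ) :
    ∃ r : ℝ, 0 ≤ r ∧ ∃ u ∈ unitSphere n, x = r • u := by
  by_cases hx : ∑ i, x i ^ 2 = 0
  · obtain ⟨u, hu⟩ := nonempty_unitSphere hn
    refine ⟨0, le_rfl, u, hu, ?_⟩
    rw [Finset.sum_eq_zero_iff_of_nonneg fun _ _ => sq_nonneg _] at hx
    ext i; simpa using hx i (Finset.mem_univ i)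
  · have h0 : 0 < ∑ i, x i ^ 2 := lt_of_le_of_ne (Finset.sum_nonneg fun _ _ => sq_nonneg _)
      (Ne.symm hx)
    refine ⟨√(∑ i, x i ^ 2), Real.sqrt_nonneg _, (√(∑ i, x i ^ 2))⁻¹ • x, ?_, ?_⟩
    · change ∑ i, _ = (1 : ℝ)
      simp only [Pi.smul_apply, smul_eq_mul, mul_pow, ← Finset.mul_sum, inv_pow,
        Real.sq_sqrt h0.le]
      exact inv_mul_cancel₀ hx
    · rw [smul_smul, mul_inv_cancel₀ (Real.sqrt_ne_zero'.2 h0), one_smul]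

theorem sum_sq_mulVec {Q : Matrix (Fin n) (Fin n) ℝ} (hQ : Q * Q.transpose = 1)
    (x : Fin n → ℝ) : ∑ i, Q.mulVec x i ^ 2 = ∑ i, x i ^ 2 := by
  have hQ' : Q.transpose * Q = 1 := mul_eq_one_comm.1 hQ
  have : Q.mulVec x ⬝ᵥ Q.mulVec x = x ⬝ᵥ x := by
    rw [Matrix.dotProduct_mulVec, Matrix.vecMul_mulVec, hQ']; simp
  simpa [dotProduct, pow_two] using this

theorem beval_smul_smul {d₁ d₂ : ℕ} {f : MvPolynomial (Fin n ⊕ Fin m) ℝ}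
    (hf : f ∈ Biform n m d₁ d₂) (s t : ℝ) (x : Fin n → ℝ) (y : Fin m → ℝ) :
    beval f (s • x) (t • y) = s ^ d₁ * t ^ d₂ * beval f x y := by
  simp only [beval, eval_eq', Finset.mul_sum]
  refine Finset.sum_congr rfl fun d hd => ?_
  have h := hf (mem_support_iff.1 hd)
  rw [Finsupp.weight_apply, Finsupp.sum_fintype _ _ (by simp), Fintype.sum_sum_type] at h
  have h1 : ∑ i, d (Sum.inl i) = d₁ := by simpa [bw, Prod.fst_sum] using congrArg Prod.fst h
  have h2 : ∑ i, d (Sum.inr i) = d₂ := by simpa [bw, Prod.snd_sum] using congrArg Prod.snd h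
  simp only [Fintype.prod_sum_type, Sum.elim_inl, Sum.elim_inr, Pi.smul_apply, smul_eq_mul,
    mul_pow, Finset.prod_mul_distrib, Finset.prod_pow_eq_pow_sum, h1, h2]
  ring

theorem Biform.eq_zero_of_sphere (hn : 0 < n) (hm : 0 < m) {d₁ d₂ : ℕ}
    {f : MvPolynomial (Fin n ⊕ Fin m) ℝ} (hf : f ∈ Biform n m d₁ d₂)
    (h : ∀ x ∈ unitSphere n, ∀ y ∈ unitSphere m, beval f x y = 0) : f = 0 := by
  refine MvPolynomial.funext fun z => ?_
  obtain ⟨s, -, x, hx, hs⟩ := exists_unitSphere_smul hn (fun i => z (Sum.inl i))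
  obtain ⟨t, -, y, hy, ht⟩ := exists_unitSphere_smul hm (fun i => z (Sum.inr i))
  have e := beval_smul_smul hf s t x y
  rw [h x hx y hy, ← hs, ← ht, mul_zero, beval] at e
  rw [map_zero, ← e]
  congr
  ext i; rcases i with i | i <;> rfl

theorem aeval_mem_biform {d₁ d₂ : ℕ} {n' m' : ℕ} {f : MvPolynomial (Fin n ⊕ Fin m) ℝ}
    (hf : f ∈ Biform n m d₁ d₂) {g : Fin n ⊕ Fin m → MvPolynomial (Fin n' ⊕ Fin m') ℝ}
    (h1 : ∀ i, g (Sum.inl i) ∈ Biform n' m' 1 0) (h2 : ∀ i, g (Sum.inr i) ∈ Biform n' m' 0 1) :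
    aeval g f ∈ Biform n' m' d₁ d₂ := by
  change IsWeightedHomogeneous _ _ _
  rw [aeval_def, eval₂_eq']
  refine IsWeightedHomogeneous.sum _ _ _ fun d hd => ?_
  have h := hf (mem_support_iff.1 hd)
  rw [← h, ← zero_add (Finsupp.weight _ d)]
  refine (isWeightedHomogeneous_C _ _).mul ?_
  rw [Finsupp.weight_apply, Finsupp.sum_fintype _ _ (by simp)]
  refine IsWeightedHomogeneous.prod _ _ _ fun i _ => IsWeightedHomogeneous.pow ?_ _
  rcases i with i | i
  · exact h1 i
  · exact h2 i

/-- Composition of a polynomial in `(x, y)` with a pair of linear maps. -/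
def rotate (Q₁ : Matrix (Fin n) (Fin n) ℝ) (Q₂ : Matrix (Fin m) (Fin m) ℝ) :
    MvPolynomial (Fin n ⊕ Fin m) ℝ →ₐ[ℝ] MvPolynomial (Fin n ⊕ Fin m) ℝ :=
  aeval (Sum.elim (fun i => ∑ j, C (Q₁ i j) * X (Sum.inl j))
    (fun i => ∑ j, C (Q₂ i j) * X (Sum.inr j)))

theorem beval_rotate (Q₁ : Matrix (Fin n) (Fin n) ℝ) (Q₂ : Matrix (Fin m) (Fin m) ℝ)
    (f : MvPolynomial (Fin n ⊕ Fin m) ℝ) (x : Fin n → ℝ) (y : Fin m → ℝ) :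
    beval (rotate Q₁ Q₂ f) x y = beval f (Q₁.mulVec x) (Q₂.mulVec y) := by
  induction f using MvPolynomial.induction_on with
  | C a => simp [beval, rotate]
  | add f g hf hg => simp only [beval, map_add] at *; rw [hf, hg]
  | mul_X f i hf =>
    simp only [beval, map_mul] at *
    rw [hf]
    congr 1
    rcases i with i | i <;> simp [rotate, Matrix.mulVec, dotProduct]

theorem rotate_mem_biform {d₁ d₂ : ℕ} (Q₁ : Matrix (Fin n) (Fin n) ℝ)
    (Q₂ : Matrix (Fin m) (Fin m) ℝ) {f : MvPolynomial (Fin n ⊕ Fin m) ℝ}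
    (hf : f ∈ Biform n m d₁ d₂) : rotate Q₁ Q₂ f ∈ Biform n m d₁ d₂ := by
  refine aeval_mem_biform hf (fun i => ?_) (fun i => ?_) <;>
  · refine IsWeightedHomogeneous.sum _ _ _ fun j _ => ?_
    rw [← zero_add ((_, _) : ℕ × ℕ)]
    exact (isWeightedHomogeneous_C _ _).mul (isWeightedHomogeneous_X _ _ _)

variable {σ₁ : Measure (Fin n → ℝ)} {σ₂ : Measure (Fin m → ℝ)}

theorem BiformPaper.IsSphereMeasure.ae_mem_prod (hσ₁ : IsSphereMeasure n σ₁)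
    (hσ₂ : IsSphereMeasure m σ₂) : ∀ᵐ p ∂σ₁.prod σ₂, p ∈ unitSphere n ×ˢ unitSphere m := by
  have := hσ₁.prob; have := hσ₂.prob
  have h1 : ∀ᵐ x ∂σ₁, x ∈ unitSphere n := hσ₁.onSphere
  have h2 : ∀ᵐ x ∂σ₂, x ∈ unitSphere m := hσ₂.onSphere
  filter_upwards [Measure.quasiMeasurePreserving_fst.ae h1,
    Measure.quasiMeasurePreserving_snd.ae h2] with p hp1 hp2 using ⟨hp1, hp2⟩

theorem BiformPaper.IsSphereMeasure.integrable_prod (hσ₁ : IsSphereMeasure n σ₁)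
    (hσ₂ : IsSphereMeasure m σ₂) {E : Type*} [NormedAddCommGroup E]
    {g : (Fin n → ℝ) × (Fin m → ℝ) → E} (hg : Continuous g) : Integrable g (σ₁.prod σ₂) := by
  have := hσ₁.prob; have := hσ₂.prob
  rw [← Measure.restrict_eq_self_of_ae_mem (hσ₁.ae_mem_prod hσ₂)]
  exact ContinuousOn.integrableOn_compact (isCompact_sphereProd n m) hg.continuousOn

theorem BiformPaper.IsSphereMeasure.measurePreserving_prod (hσ₁ : IsSphereMeasure n σ₁)
    (hσ₂ : IsSphereMeasure m σ₂) {Q₁ : Matrix (Fin n) (Fin n) ℝ} {Q₂ : Matrix (Fin m) (Fin m) ℝ}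
    (hQ₁ : Q₁ * Q₁.transpose = 1) (hQ₂ : Q₂ * Q₂.transpose = 1) :
    MeasurePreserving (Prod.map Q₁.mulVec Q₂.mulVec) (σ₁.prod σ₂) (σ₁.prod σ₂) := by
  have := hσ₁.prob; have := hσ₂.prob
  exact MeasurePreserving.prod
    ⟨(Continuous.matrix_mulVec continuous_const continuous_id).measurable, hσ₁.invariant _ hQ₁⟩
    ⟨(Continuous.matrix_mulVec continuous_const continuous_id).measurable, hσ₂.invariant _ hQ₂⟩

theorem BiformPaper.IsSphereMeasure.integral_comp_mulVec (hσ₁ : IsSphereMeasure n σ₁)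
    (hσ₂ : IsSphereMeasure m σ₂) {Q₁ : Matrix (Fin n) (Fin n) ℝ} {Q₂ : Matrix (Fin m) (Fin m) ℝ}
    (hQ₁ : Q₁ * Q₁.transpose = 1) (hQ₂ : Q₂ * Q₂.transpose = 1)
    {g : (Fin n → ℝ) × (Fin m → ℝ) → ℝ} (hg : Continuous g) :
    ∫ p, g (Q₁.mulVec p.1, Q₂.mulVec p.2) ∂σ₁.prod σ₂ = ∫ p, g p ∂σ₁.prod σ₂ := by
  have h := hσ₁.measurePreserving_prod hσ₂ hQ₁ hQ₂
  conv_rhs => rw [← h.map_eq]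
  rw [integral_map h.measurable.aemeasurable hg.aestronglyMeasurable]
  rfl

theorem BiformPaper.IsSphereMeasure.eq_zero_of_integral_eq_zero (hσ₁ : IsSphereMeasure n σ₁)
    (hσ₂ : IsSphereMeasure m σ₂) {g : (Fin n → ℝ) × (Fin m → ℝ) → ℝ} (hg : Continuous g)
    (h0 : ∀ p, 0 ≤ g p) (h : ∫ p, g p ∂σ₁.prod σ₂ = 0) :
    ∀ x ∈ unitSphere n, ∀ y ∈ unitSphere m, g (x, y) = 0 := by
  have := hσ₁.prob; have := hσ₂.prob
  intro x hx y hy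
  by_contra hne
  have hae := (integral_eq_zero_iff_of_nonneg h0 (hσ₁.integrable_prod hσ₂ hg)).1 h
  have hU : (σ₁.prod σ₂) {p | g p ≠ 0} = 0 := hae
  have hT : (σ₁.prod σ₂) (unitSphere n ×ˢ unitSphere m) = 0 := by
    refine measure_null_of_locally_null _ fun p hp => ?_
    obtain ⟨Q₁, hQ₁, e1⟩ := exists_orthogonal_mulVec_eq p.1 x (Eq.trans hp.1 (Eq.symm hx))
    obtain ⟨Q₂, hQ₂, e2⟩ := exists_orthogonal_mulVec_eq p.2 y (Eq.trans hp.2 (Eq.symm hy))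
    have hmp := hσ₁.measurePreserving_prod hσ₂ hQ₁ hQ₂
    have hop : IsOpen {p | g p ≠ 0} := isOpen_ne_fun hg continuous_const
    refine ⟨Prod.map Q₁.mulVec Q₂.mulVec ⁻¹' {p | g p ≠ 0}, ?_, ?_⟩
    · refine mem_nhdsWithin_of_mem_nhds (IsOpen.mem_nhds (hop.preimage ?_) ?_)
      · exact (Continuous.matrix_mulVec continuous_const continuous_id).prodMap
          (Continuous.matrix_mulVec continuous_const continuous_id)
      · change g (Q₁.mulVec p.1, Q₂.mulVec p.2) ≠ 0
        rwa [e1, e2]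
    · rw [hmp.measure_preimage hop.measurableSet.nullMeasurableSet, hU]
  have h1 : (σ₁.prod σ₂) (unitSphere n ×ˢ unitSphere m) = 1 :=
    (prob_compl_eq_zero_iff (isCompact_sphereProd n m).measurableSet).1 (hσ₁.ae_mem_prod hσ₂)
  simp [hT] at h1

theorem bavg_eq (hσ₁ : IsSphereMeasure n σ₁) (hσ₂ : IsSphereMeasure m σ₂)
    (f : MvPolynomial (Fin n ⊕ Fin m) ℝ) :
    bavg σ₁ σ₂ f = ∫ p, beval f p.1 p.2 ∂σ₁.prod σ₂ := by
  have := hσ₁.prob; have := hσ₂.prob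
  rw [integral_prod _ (hσ₁.integrable_prod hσ₂ (continuous_beval f))]
  rfl

theorem bip_eq (hσ₁ : IsSphereMeasure n σ₁) (hσ₂ : IsSphereMeasure m σ₂)
    (f g : MvPolynomial (Fin n ⊕ Fin m) ℝ) :
    bip σ₁ σ₂ f g = ∫ p, beval f p.1 p.2 * beval g p.1 p.2 ∂σ₁.prod σ₂ := by
  have := hσ₁.prob; have := hσ₂.prob
  exact (integral_prod _
    (hσ₁.integrable_prod hσ₂ ((continuous_beval f).mul (continuous_beval g)))).symm

theorem bip_rotate (hσ₁ : IsSphereMeasure n σ₁) (hσ₂ : IsSphereMeasure m σ₂)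
    {Q₁ : Matrix (Fin n) (Fin n) ℝ} {Q₂ : Matrix (Fin m) (Fin m) ℝ}
    (hQ₁ : Q₁ * Q₁.transpose = 1) (hQ₂ : Q₂ * Q₂.transpose = 1)
    (f g : MvPolynomial (Fin n ⊕ Fin m) ℝ) :
    bip σ₁ σ₂ (rotate Q₁ Q₂ f) (rotate Q₁ Q₂ g) = bip σ₁ σ₂ f g := by
  simp only [bip_eq hσ₁ hσ₂, beval_rotate]
  exact hσ₁.integral_comp_mulVec hσ₂ hQ₁ hQ₂ ((continuous_beval f).mul (continuous_beval g))

theorem bavg_rotate (hσ₁ : IsSphereMeasure n σ₁) (hσ₂ : IsSphereMeasure m σ₂)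
    {Q₁ : Matrix (Fin n) (Fin n) ℝ} {Q₂ : Matrix (Fin m) (Fin m) ℝ}
    (hQ₁ : Q₁ * Q₁.transpose = 1) (hQ₂ : Q₂ * Q₂.transpose = 1)
    (f : MvPolynomial (Fin n ⊕ Fin m) ℝ) :
    bavg σ₁ σ₂ (rotate Q₁ Q₂ f) = bavg σ₁ σ₂ f := by
  simp only [bavg_eq hσ₁ hσ₂, beval_rotate]
  exact hσ₁.integral_comp_mulVec hσ₂ hQ₁ hQ₂ (continuous_beval f)

end BiformBasics

section UnitaryParam
open BiformPaper Set Filter Topology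
variable {n m D : ℕ} {σ₁ : Measure (Fin n → ℝ)} {σ₂ : Measure (Fin m → ℝ)}
  {M : Set (MvPolynomial (Fin n ⊕ Fin m) ℝ)}
  {ψ : (Fin D → ℝ) →ₗ[ℝ] MvPolynomial (Fin n ⊕ Fin m) ℝ}

/-- Evaluation at a point as a linear functional. -/
def bevalₗ (x : Fin n → ℝ) (y : Fin m → ℝ) : MvPolynomial (Fin n ⊕ Fin m) ℝ →ₗ[ℝ] ℝ :=
  (aeval (Sum.elim x y)).toLinearMap

theorem bevalₗ_apply (x : Fin n → ℝ) (y : Fin m → ℝ) (f : MvPolynomial (Fin n ⊕ Fin m) ℝ) :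
    bevalₗ x y f = beval f x y := by
  simp [bevalₗ, beval, aeval_eq_eval]

/-- The vector representing evaluation at `(x, y)` in the coordinates given by `ψ`. -/
def evalVec (ψ : (Fin D → ℝ) →ₗ[ℝ] MvPolynomial (Fin n ⊕ Fin m) ℝ) (x : Fin n → ℝ)
    (y : Fin m → ℝ) (i : Fin D) : ℝ :=
  beval (ψ (Pi.single i 1)) x y

theorem continuous_evalVec (ψ : (Fin D → ℝ) →ₗ[ℝ] MvPolynomial (Fin n ⊕ Fin m) ℝ) :
    Continuous fun p : (Fin n → ℝ) × (Fin m → ℝ) => evalVec ψ p.1 p.2 :=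
  continuous_pi fun _ => continuous_beval _

theorem beval_eq_sum_evalVec (ψ : (Fin D → ℝ) →ₗ[ℝ] MvPolynomial (Fin n ⊕ Fin m) ℝ)
    (a : Fin D → ℝ) (x : Fin n → ℝ) (y : Fin m → ℝ) :
    beval (ψ a) x y = ∑ i, a i * evalVec ψ x y i := by
  rw [← bevalₗ_apply, ← LinearMap.comp_apply, LinearMap.pi_apply_eq_sum_univ _ a]
  refine Finset.sum_congr rfl fun i _ => ?_
  rw [LinearMap.comp_apply, bevalₗ_apply, smul_eq_mul, evalVec]
  congr 3
  ext j; simp [Pi.single_apply, eq_comm]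

/-- A set of polynomials stable under orthogonal changes of the variables. -/
def IsRotationStable (M : Set (MvPolynomial (Fin n ⊕ Fin m) ℝ)) : Prop :=
  ∀ (Q₁ : Matrix (Fin n) (Fin n) ℝ) (Q₂ : Matrix (Fin m) (Fin m) ℝ), Q₁ * Q₁.transpose = 1 →
    Q₂ * Q₂.transpose = 1 → ∀ f ∈ M, rotate Q₁ Q₂ f ∈ M

theorem isRotationStable_biform (d₁ d₂ : ℕ) : IsRotationStable (Biform n m d₁ d₂) :=
  fun _ _ _ _ _ hf => rotate_mem_biform _ _ hf

theorem isRotationStable_mSet (hσ₁ : IsSphereMeasure n σ₁) (hσ₂ : IsSphereMeasure m σ₂)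
    (k₁ k₂ : ℕ) : IsRotationStable (MSet n m k₁ k₂ σ₁ σ₂) :=
  fun _ _ h₁ h₂ _ hf => ⟨rotate_mem_biform _ _ hf.1, by rw [bavg_rotate hσ₁ hσ₂ h₁ h₂, hf.2]⟩

theorem BiformPaper.IsUnitaryParam.bip_self (hψ : IsUnitaryParam n m D σ₁ σ₂ M ψ)
    (a : Fin D → ℝ) : bip σ₁ σ₂ (ψ a) (ψ a) = ∑ i, a i ^ 2 := by
  simp only [hψ.ip, pow_two]

theorem BiformPaper.IsUnitaryParam.mem (hψ : IsUnitaryParam n m D σ₁ σ₂ M ψ)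
    (a : Fin D → ℝ) : ψ a ∈ M := hψ.range ▸ mem_range_self a

theorem sum_evalVec_sq_eq_of_mem (hσ₁ : IsSphereMeasure n σ₁) (hσ₂ : IsSphereMeasure m σ₂)
    (hψ : IsUnitaryParam n m D σ₁ σ₂ M ψ) (hM : IsRotationStable M)
    {x : Fin n → ℝ} (hx : x ∈ unitSphere n) {y : Fin m → ℝ} (hy : y ∈ unitSphere m) :
    ∑ i, evalVec ψ x y i ^ 2 = D := by
  have := hσ₁.prob; have := hσ₂.prob
  have key : ∀ x₀ ∈ unitSphere n, ∀ y₀ ∈ unitSphere m, ∀ x₁ ∈ unitSphere n, ∀ y₁ ∈ unitSphere m,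
      ∑ i, evalVec ψ x₁ y₁ i ^ 2 ≤ ∑ i, evalVec ψ x₀ y₀ i ^ 2 := by
    intro x₀ hx₀ y₀ hy₀ x₁ hx₁ y₁ hy₁
    obtain ⟨Q₁, hQ₁, e1⟩ := exists_orthogonal_mulVec_eq x₀ x₁ (Eq.trans hx₀ (Eq.symm hx₁))
    obtain ⟨Q₂, hQ₂, e2⟩ := exists_orthogonal_mulVec_eq y₀ y₁ (Eq.trans hy₀ (Eq.symm hy₁))
    obtain ⟨c, hc⟩ : rotate Q₁ Q₂ (ψ (evalVec ψ x₁ y₁)) ∈ range ψ := by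
      rw [hψ.range]; exact hM _ _ hQ₁ hQ₂ _ (hψ.mem _)
    have h1 : ∑ i, c i ^ 2 = ∑ i, evalVec ψ x₁ y₁ i ^ 2 := by
      rw [← hψ.bip_self, hc, bip_rotate hσ₁ hσ₂ hQ₁ hQ₂, hψ.bip_self]
    have h2 : ∑ i, c i * evalVec ψ x₀ y₀ i = ∑ i, evalVec ψ x₁ y₁ i ^ 2 := by
      rw [← beval_eq_sum_evalVec, hc, beval_rotate, e1, e2, beval_eq_sum_evalVec]
      simp only [pow_two]
    have h3 := Finset.sum_mul_sq_le_sq_mul_sq Finset.univ c (evalVec ψ x₀ y₀)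
    rw [h1, h2, pow_two] at h3
    rcases (Finset.sum_nonneg fun i (_ : i ∈ Finset.univ) =>
      sq_nonneg (evalVec ψ x₁ y₁ i)).eq_or_lt with h0 | h0
    · rw [← h0]; positivity
    · exact le_of_mul_le_mul_left h3 h0
  have h_int : ∫ p, ∑ i, evalVec ψ p.1 p.2 i ^ 2 ∂σ₁.prod σ₂ = D := by
    simp only [evalVec]
    rw [integral_finsetSum _ fun i _ => hσ₁.integrable_prod hσ₂
      ((continuous_beval _).fun_pow 2)]
    have : ∀ i, ∫ p, beval (ψ (Pi.single i 1)) p.1 p.2 ^ 2 ∂σ₁.prod σ₂ = 1 := by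
      intro i
      have h := hψ.bip_self (Pi.single i 1)
      rw [bip_eq hσ₁ hσ₂] at h
      simp only [pow_two] at h ⊢
      rw [h, Finset.sum_eq_single i] <;> simp +contextual
    simp [this]
  rw [← h_int, integral_congr_ae (g := fun _ => ∑ i, evalVec ψ x y i ^ 2)]
  · simp
  · filter_upwards [hσ₁.ae_mem_prod hσ₂] with p hp
    exact le_antisymm (key _ hx _ hy _ hp.1 _ hp.2) (key _ hp.1 _ hp.2 _ hx _ hy)

theorem beval_sq_le_mul_bip (hσ₁ : IsSphereMeasure n σ₁) (hσ₂ : IsSphereMeasure m σ₂)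
    (hψ : IsUnitaryParam n m D σ₁ σ₂ M ψ) (hM : IsRotationStable M)
    {f : MvPolynomial (Fin n ⊕ Fin m) ℝ} (hf : f ∈ M)
    {x : Fin n → ℝ} (hx : x ∈ unitSphere n) {y : Fin m → ℝ} (hy : y ∈ unitSphere m) :
    beval f x y ^ 2 ≤ D * bip σ₁ σ₂ f f := by
  obtain ⟨a, rfl⟩ : f ∈ range ψ := by rwa [hψ.range]
  have h := Finset.sum_mul_sq_le_sq_mul_sq Finset.univ a (evalVec ψ x y)
  rwa [sum_evalVec_sq_eq_of_mem hσ₁ hσ₂ hψ hM hx hy, ← beval_eq_sum_evalVec, ← hψ.bip_self,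
    mul_comm] at h

/-- The submodule of biforms of bidegree `(d₁, d₂)`. -/
abbrev biformSubmodule (n m d₁ d₂ : ℕ) : Submodule ℝ (MvPolynomial (Fin n ⊕ Fin m) ℝ) :=
  weightedHomogeneousSubmodule ℝ (bw n m) (d₁, d₂)

/-- The pair of multisets of variables of a monomial of bidegree `(d₁, d₂)`. -/
def biformMonomialToSym (n m d₁ d₂ : ℕ)
    (d : {d : Fin n ⊕ Fin m →₀ ℕ | Finsupp.weight (bw n m) d = (d₁, d₂)}) :
    Sym (Fin n) d₁ × Sym (Fin m) d₂ :=
  have h : ∑ i, d.1 (Sum.inl i) = d₁ ∧ ∑ i, d.1 (Sum.inr i) = d₂ := by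
    have h := d.2
    rw [mem_ofPred_eq, Finsupp.weight_apply, Finsupp.sum_fintype _ _ (by simp),
      Fintype.sum_sum_type] at h
    exact ⟨by simpa [bw, Prod.fst_sum] using congrArg Prod.fst h,
      by simpa [bw, Prod.snd_sum] using congrArg Prod.snd h⟩
  ((Sym.equivNatSumOfFintype (Fin n) d₁).symm ⟨fun i => d.1 (Sum.inl i), h.1⟩,
    (Sym.equivNatSumOfFintype (Fin m) d₂).symm ⟨fun i => d.1 (Sum.inr i), h.2⟩)

theorem biformMonomialToSym_injective (n m d₁ d₂ : ℕ) :
    Function.Injective (biformMonomialToSym n m d₁ d₂) := by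
  intro d e h
  simp only [biformMonomialToSym, Prod.mk.injEq, EmbeddingLike.apply_eq_iff_eq,
    Subtype.mk.injEq] at h
  ext i
  rcases i with i | i
  · exact congrFun h.1 i
  · exact congrFun h.2 i

theorem finite_finrank_biformSubmodule_le (n m d₁ d₂ : ℕ) :
    FiniteDimensional ℝ (biformSubmodule n m d₁ d₂) ∧
    Module.finrank ℝ (biformSubmodule n m d₁ d₂) ≤
      (n + d₁ - 1).choose d₁ * (m + d₂ - 1).choose d₂ := by
  have hinj := biformMonomialToSym_injective n m d₁ d₂
  have : Finite {d : Fin n ⊕ Fin m →₀ ℕ | Finsupp.weight (bw n m) d = (d₁, d₂)} := Finite.of_injective _ hinj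
  have := Fintype.ofFinite {d : Fin n ⊕ Fin m →₀ ℕ | Finsupp.weight (bw n m) d = (d₁, d₂)}
  let L : biformSubmodule n m d₁ d₂ →ₗ[ℝ]
      ({d : Fin n ⊕ Fin m →₀ ℕ | Finsupp.weight (bw n m) d = (d₁, d₂)} → ℝ) :=
    LinearMap.pi fun d => (lcoeff ℝ d.1).comp (Submodule.subtype _)
  have hL : Function.Injective L := by
    intro f g h
    ext d
    by_cases hd : Finsupp.weight (bw n m) d = (d₁, d₂)
    · exact congrFun h ⟨d, hd⟩
    · have e : ∀ f : biformSubmodule n m d₁ d₂, coeff d f.1 = 0 := fun f => by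
        by_contra hc; exact hd (f.2 hc)
      rw [e, e]
  refine ⟨FiniteDimensional.of_injective L hL, (LinearMap.finrank_le_finrank_of_injective hL).trans ?_⟩
  rw [Module.finrank_fintype_fun_eq_card]
  refine (Fintype.card_le_of_injective _ hinj).trans_eq ?_
  rw [Fintype.card_prod, Sym.card_sym_eq_choose, Sym.card_sym_eq_choose]
  simp

theorem bip_add_left (hσ₁ : IsSphereMeasure n σ₁) (hσ₂ : IsSphereMeasure m σ₂)
    (f g h : MvPolynomial (Fin n ⊕ Fin m) ℝ) :
    bip σ₁ σ₂ (f + g) h = bip σ₁ σ₂ f h + bip σ₁ σ₂ g h := by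
  simp only [bip_eq hσ₁ hσ₂]
  rw [← integral_add (hσ₁.integrable_prod hσ₂ ((continuous_beval f).fun_mul (continuous_beval h)))
    (hσ₁.integrable_prod hσ₂ ((continuous_beval g).fun_mul (continuous_beval h)))]
  simp [beval, add_mul]

theorem bip_smul_left (hσ₁ : IsSphereMeasure n σ₁) (hσ₂ : IsSphereMeasure m σ₂) (c : ℝ)
    (f h : MvPolynomial (Fin n ⊕ Fin m) ℝ) : bip σ₁ σ₂ (c • f) h = c * bip σ₁ σ₂ f h := by
  simp only [bip_eq hσ₁ hσ₂]
  rw [← integral_const_mul]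
  simp [beval, mul_assoc, smul_eval]

theorem bip_comm (f g : MvPolynomial (Fin n ⊕ Fin m) ℝ) : bip σ₁ σ₂ f g = bip σ₁ σ₂ g f := by
  simp only [bip, mul_comm]

theorem bip_self_nonneg (f : MvPolynomial (Fin n ⊕ Fin m) ℝ) : 0 ≤ bip σ₁ σ₂ f f :=
  integral_nonneg fun _ => integral_nonneg fun _ => mul_self_nonneg _

theorem Biform.eq_zero_of_bip_self (hn : 0 < n) (hm : 0 < m) (hσ₁ : IsSphereMeasure n σ₁)
    (hσ₂ : IsSphereMeasure m σ₂) {d₁ d₂ : ℕ} {f : MvPolynomial (Fin n ⊕ Fin m) ℝ}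
    (hf : f ∈ Biform n m d₁ d₂) (h : bip σ₁ σ₂ f f = 0) : f = 0 := by
  refine Biform.eq_zero_of_sphere hn hm hf fun x hx y hy => ?_
  rw [bip_eq hσ₁ hσ₂] at h
  exact mul_self_eq_zero.1 (hσ₁.eq_zero_of_integral_eq_zero hσ₂
    ((continuous_beval f).fun_mul (continuous_beval f)) (fun _ => mul_self_nonneg _) h x hx y hy)

theorem exists_isUnitaryParam_biform (hn : 0 < n) (hm : 0 < m) (hσ₁ : IsSphereMeasure n σ₁)
    (hσ₂ : IsSphereMeasure m σ₂) (d₁ d₂ : ℕ) :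
    ∃ (D : ℕ) (ψ : (Fin D → ℝ) →ₗ[ℝ] MvPolynomial (Fin n ⊕ Fin m) ℝ),
      IsUnitaryParam n m D σ₁ σ₂ (Biform n m d₁ d₂) ψ ∧
      D ≤ (n + d₁ - 1).choose d₁ * (m + d₂ - 1).choose d₂ := by
  obtain ⟨hfin, hle⟩ := finite_finrank_biformSubmodule_le n m d₁ d₂
  let core : InnerProductSpace.Core ℝ (biformSubmodule n m d₁ d₂) :=
    { inner := fun f g => bip σ₁ σ₂ f.1 g.1
      conj_inner_symm := fun f g => bip_comm _ _
      re_inner_nonneg := fun f => bip_self_nonneg _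
      add_left := fun f g h => bip_add_left hσ₁ hσ₂ _ _ _
      smul_left := fun f g r => bip_smul_left hσ₁ hσ₂ _ _ _
      definite := fun f h => Subtype.ext (Biform.eq_zero_of_bip_self hn hm hσ₁ hσ₂ f.2 h) }
  let _ := core.toNormedAddCommGroup
  let _ : InnerProductSpace ℝ (biformSubmodule n m d₁ d₂) := InnerProductSpace.ofCore core.toCore
  let b := stdOrthonormalBasis ℝ (biformSubmodule n m d₁ d₂)
  let e : (Fin (Module.finrank ℝ (biformSubmodule n m d₁ d₂)) → ℝ) ≃ₗ[ℝ]
      biformSubmodule n m d₁ d₂ := (WithLp.linearEquiv 2 ℝ _).symm.trans b.repr.symm.toLinearEquiv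
  refine ⟨_, (Submodule.subtype _).comp e.toLinearMap, ⟨?_, ?_, ?_⟩, hle⟩
  · exact Subtype.val_injective.comp e.injective
  · ext f
    constructor
    · rintro ⟨a, rfl⟩; exact (e a).2
    · intro hf; exact ⟨e.symm ⟨f, hf⟩, by simp⟩
  · intro a c
    have : inner ℝ (e a) (e c) = ∑ i, a i * c i := by
      have h := b.repr.symm.inner_map_map (WithLp.toLp 2 a) (WithLp.toLp 2 c)
      refine h.trans ?_
      simp [PiLp.inner_apply, mul_comm]
    exact this

end UnitaryParam

section LowerBound
open BiformPaper Set Filter Topology Pointwise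
variable {n m k₁ k₂ D : ℕ} {σ₁ : Measure (Fin n → ℝ)} {σ₂ : Measure (Fin m → ℝ)}
  {ψ : (Fin D → ℝ) →ₗ[ℝ] MvPolynomial (Fin n ⊕ Fin m) ℝ}

theorem qpoly_mem_biform (n m k₁ k₂ : ℕ) : qpoly n m k₁ k₂ ∈ Biform n m (2 * k₁) (2 * k₂) := by
  have h : ((2 * k₁, 2 * k₂) : ℕ × ℕ) = k₁ • (2, 0) + k₂ • (0, 2) := by
    ext <;> simp [mul_comm]
  change IsWeightedHomogeneous _ _ _
  rw [h]
  exact ((IsWeightedHomogeneous.sum _ _ _ fun i _ =>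
      (isWeightedHomogeneous_X ℝ (bw n m) (Sum.inl i)).pow 2).pow k₁).mul
    ((IsWeightedHomogeneous.sum _ _ _ fun i _ =>
      (isWeightedHomogeneous_X ℝ (bw n m) (Sum.inr i)).pow 2).pow k₂)

theorem beval_qpoly {x : Fin n → ℝ} (hx : x ∈ unitSphere n) {y : Fin m → ℝ}
    (hy : y ∈ unitSphere m) : beval (qpoly n m k₁ k₂) x y = 1 := by
  have hx' : ∑ i, x i ^ 2 = 1 := hx
  have hy' : ∑ i, y i ^ 2 = 1 := hy
  simp [beval, qpoly, hx', hy']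

theorem mem_preimage_tilde_iff (hn : 0 < n) (hm : 0 < m)
    (hψ : IsUnitaryParam n m D σ₁ σ₂ (MSet n m k₁ k₂ σ₁ σ₂) ψ) (a : Fin D → ℝ) :
    a ∈ ψ ⁻¹' tilde n m k₁ k₂ σ₁ σ₂ (PosSet n m k₁ k₂) ↔
      ∀ x ∈ unitSphere n, ∀ y ∈ unitSphere m, -1 ≤ beval (ψ a) x y := by
  have hadd : ∀ x y, beval (ψ a + qpoly n m k₁ k₂) x y =
      beval (ψ a) x y + beval (qpoly n m k₁ k₂) x y := fun x y => by simp [beval]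
  constructor
  · rintro ⟨-, -, h⟩ x hx y hy
    have := h x y
    rw [hadd, beval_qpoly hx hy] at this
    linarith
  · intro h
    have hmem : ψ a + qpoly n m k₁ k₂ ∈ Biform n m (2 * k₁) (2 * k₂) :=
      IsWeightedHomogeneous.add (hψ.mem a).1 (qpoly_mem_biform n m k₁ k₂)
    refine ⟨hψ.mem a, hmem, fun x y => ?_⟩
    obtain ⟨s, -, x, hx, rfl⟩ := exists_unitSphere_smul hn x
    obtain ⟨t, -, y, hy, rfl⟩ := exists_unitSphere_smul hm y
    rw [beval_smul_smul hmem, hadd, beval_qpoly hx hy]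
    have := h x hx y hy
    have h1 : 0 ≤ s ^ (2 * k₁) := by rw [pow_mul]; positivity
    have h2 : 0 ≤ t ^ (2 * k₂) := by rw [pow_mul]; positivity
    exact mul_nonneg (mul_nonneg h1 h2) (by linarith)

theorem preimage_bball_eq (hψ : IsUnitaryParam n m D σ₁ σ₂ (MSet n m k₁ k₂ σ₁ σ₂) ψ) :
    ψ ⁻¹' bball n m k₁ k₂ σ₁ σ₂ = {a | ∑ i, a i ^ 2 ≤ 1} := by
  ext a
  change ψ a ∈ MSet _ _ _ _ _ _ ∧ _ ↔ _
  rw [hψ.bip_self]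
  exact and_iff_right (hψ.mem a)

theorem volume_unitBall_pos (D : ℕ) : 0 < volume {a : Fin D → ℝ | ∑ i, a i ^ 2 ≤ 1} := by
  refine Measure.measure_pos_of_mem_nhds (x := 0) volume ?_
  refine mem_of_superset (IsOpen.mem_nhds (isOpen_lt (f := fun a : Fin D → ℝ => ∑ i, a i ^ 2)
    (g := fun _ => 1) (by fun_prop) continuous_const) (by simp)) fun a ha => ?_
  exact le_of_lt (mem_ofPred_eq ▸ ha)

theorem isCompact_unitBall (D : ℕ) : IsCompact {a : Fin D → ℝ | ∑ i, a i ^ 2 ≤ 1} := by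
  refine Metric.isCompact_of_isClosed_isBounded (isClosed_le (by fun_prop) continuous_const) ?_
  refine (Metric.isBounded_closedBall (x := (0 : Fin D → ℝ)) (r := 1)).subset fun x hx => ?_
  rw [mem_closedBall_zero_iff, pi_norm_le_iff_of_nonneg zero_le_one]
  intro i
  have h : x i ^ 2 ≤ ∑ j, x j ^ 2 :=
    Finset.single_le_sum (f := fun j => x j ^ 2) (fun _ _ => sq_nonneg _) (Finset.mem_univ i)
  have h' : x i ^ 2 ≤ 1 := h.trans hx
  rw [Real.norm_eq_abs]
  exact abs_le_one_iff_mul_self_le_one.2 (by nlinarith)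

theorem beval_pow_le (hn : 0 < n) (hm : 0 < m) (hσ₁ : IsSphereMeasure n σ₁)
    (hσ₂ : IsSphereMeasure m σ₂) {f : MvPolynomial (Fin n ⊕ Fin m) ℝ} {d₁ d₂ : ℕ}
    (hf : f ∈ Biform n m d₁ d₂) (p : ℕ) {x : Fin n → ℝ} (hx : x ∈ unitSphere n) {y : Fin m → ℝ}
    (hy : y ∈ unitSphere m) :
    beval f x y ^ (2 * p) ≤ ((n + d₁ * p - 1).choose (d₁ * p) * (m + d₂ * p - 1).choose (d₂ * p) :
      ℕ) * ∫ t, beval f t.1 t.2 ^ (2 * p) ∂σ₁.prod σ₂ := by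
  obtain ⟨W, φ, hφ, hW⟩ := exists_isUnitaryParam_biform hn hm hσ₁ hσ₂ (d₁ * p) (d₂ * p)
  have hfp : f ^ p ∈ Biform n m (d₁ * p) (d₂ * p) := by
    have := IsWeightedHomogeneous.pow hf p
    simpa [mul_comm, Biform] using this
  have h := beval_sq_le_mul_bip hσ₁ hσ₂ hφ (isRotationStable_biform _ _) hfp hx hy
  have e : ∀ x y, beval (f ^ p) x y = beval f x y ^ p := fun x y => by simp [beval]
  simp only [bip_eq hσ₁ hσ₂, e, ← pow_two, ← pow_mul, mul_comm p 2] at h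
  refine h.trans ?_
  gcongr
  exact integral_nonneg fun t => by simp only [pow_mul]; positivity

theorem setLIntegral_moment_le (hσ₁ : IsSphereMeasure n σ₁)
    (hσ₂ : IsSphereMeasure m σ₂) (hD : 0 < D)
    (hψ : IsUnitaryParam n m D σ₁ σ₂ (MSet n m k₁ k₂ σ₁ σ₂) ψ) (p : ℕ) :
    ∫⁻ a in {a : Fin D → ℝ | ∑ i, a i ^ 2 ≤ 1},
      ENNReal.ofReal (∫ t, beval (ψ a) t.1 t.2 ^ (2 * p) ∂σ₁.prod σ₂) ≤
      ENNReal.ofReal ((p : ℝ) ^ p) * volume {a : Fin D → ℝ | ∑ i, a i ^ 2 ≤ 1} := by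
  have := hσ₁.prob; have := hσ₂.prob
  have e : ∀ a, ENNReal.ofReal (∫ t, beval (ψ a) t.1 t.2 ^ (2 * p) ∂σ₁.prod σ₂) =
      ∫⁻ t, ENNReal.ofReal ((∑ i, a i * evalVec ψ t.1 t.2 i) ^ (2 * p)) ∂σ₁.prod σ₂ := by
    intro a
    rw [ofReal_integral_eq_lintegral_ofReal
      (hσ₁.integrable_prod hσ₂ ((continuous_beval _).fun_pow _))
      (Eventually.of_forall fun t => by simp only [pow_mul, Pi.zero_apply]; positivity)]
    simp only [beval_eq_sum_evalVec]
  simp only [e]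
  rw [lintegral_lintegral_swap]
  · calc _ ≤ ∫⁻ t, ENNReal.ofReal ((p : ℝ) ^ p) *
        volume {a : Fin D → ℝ | ∑ i, a i ^ 2 ≤ 1} ∂σ₁.prod σ₂ := by
          refine lintegral_mono_ae ?_
          filter_upwards [hσ₁.ae_mem_prod hσ₂] with t ht
          exact setLIntegral_dotProduct_pow_le hD (sum_evalVec_sq_eq_of_mem hσ₁ hσ₂ hψ
            (isRotationStable_mSet hσ₁ hσ₂ k₁ k₂) ht.1 ht.2) p
      _ = _ := by simp
  · refine (Continuous.measurable ?_).ennreal_ofReal.aemeasurable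
    refine (continuous_finsetSum _ fun i _ => ?_).pow _
    exact ((continuous_apply i).comp continuous_fst).mul
      ((continuous_beval _).comp continuous_snd)

theorem mul_volume_unitBall_le (hn : 0 < n) (hm : 0 < m) (hσ₁ : IsSphereMeasure n σ₁)
    (hσ₂ : IsSphereMeasure m σ₂) (hD : 0 < D)
    (hψ : IsUnitaryParam n m D σ₁ σ₂ (MSet n m k₁ k₂ σ₁ σ₂) ψ) {p : ℕ} (hp : 0 < p) {s : ℝ}
    (hs : 0 < s)
    (hsp : s ^ (2 * p) * (((n + 2 * k₁ * p - 1).choose (2 * k₁ * p) *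
      (m + 2 * k₂ * p - 1).choose (2 * k₂ * p) : ℕ) * (4 * (p : ℝ) ^ p)) ≤ 1) :
    ENNReal.ofReal (3 / 4 * s ^ D) * volume {a : Fin D → ℝ | ∑ i, a i ^ 2 ≤ 1} ≤
      volume (ψ ⁻¹' tilde n m k₁ k₂ σ₁ σ₂ (PosSet n m k₁ k₂)) := by
  set B := {a : Fin D → ℝ | ∑ i, a i ^ 2 ≤ 1} with hB
  set K := ψ ⁻¹' tilde n m k₁ k₂ σ₁ σ₂ (PosSet n m k₁ k₂) with hK
  set N : (Fin D → ℝ) → ℝ := fun a => ∫ t, beval (ψ a) t.1 t.2 ^ (2 * p) ∂σ₁.prod σ₂ with hN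
  have hBtop : volume B ≠ ⊤ := (isCompact_unitBall D).measure_ne_top
  set c : ℝ := (p : ℝ) ^ p with hc
  have hc0 : 0 < c := by positivity
  have hNm : Measurable N := by
    have := hσ₁.prob; have := hσ₂.prob
    refine (StronglyMeasurable.integral_prod_right (ν := σ₁.prod σ₂)
      (f := fun a t => beval (ψ a) t.1 t.2 ^ (2 * p)) ?_).measurable
    refine Continuous.stronglyMeasurable ?_
    simp only [Function.uncurry_def, beval_eq_sum_evalVec]
    refine (continuous_finsetSum _ fun i _ => ?_).pow _
    exact ((continuous_apply i).comp continuous_fst).mul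
      ((continuous_beval _).comp continuous_snd)
  have hmarkov : volume {a ∈ B | 4 * c ≤ N a} ≤ ENNReal.ofReal (1 / 4) * volume B := by
    have h1 : ENNReal.ofReal (4 * c) * volume {a ∈ B | 4 * c ≤ N a} ≤
        ENNReal.ofReal c * volume B := by
      refine le_trans ?_ (setLIntegral_moment_le hσ₁ hσ₂ hD hψ p)
      refine le_trans (le_of_eq ?_) (mul_meas_ge_le_lintegral hNm.ennreal_ofReal
        (ENNReal.ofReal (4 * c)))
      rw [Measure.restrict_apply' (isCompact_unitBall D).measurableSet]
      congr 2
      ext a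
      have hNa : 0 ≤ N a := integral_nonneg fun t => by
        simp only [pow_mul, Pi.zero_apply]; positivity
      rw [mem_inter_iff, mem_ofPred_eq, mem_ofPred_eq, mem_ofPred_eq, ENNReal.ofReal_le_ofReal_iff hNa,
        and_comm]
    refine (ENNReal.mul_le_mul_iff_right (a := ENNReal.ofReal (4 * c)) (by simpa using hc0)
      ENNReal.ofReal_ne_top).1 (h1.trans_eq ?_)
    rw [← mul_assoc, ← ENNReal.ofReal_mul (by positivity)]
    congr 2; ring
  have hA : ENNReal.ofReal (3 / 4) * volume B ≤ volume {a ∈ B | N a < 4 * c} := by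
    have h1 : volume B ≤ volume {a ∈ B | N a < 4 * c} + ENNReal.ofReal (1 / 4) * volume B := by
      refine le_trans ?_ (add_le_add le_rfl hmarkov)
      refine (measure_mono fun a ha => ?_).trans (measure_union_le _ _)
      rcases lt_or_ge (N a) (4 * c) with h | h
      · exact Or.inl ⟨ha, h⟩
      · exact Or.inr ⟨ha, h⟩
    refine (ENNReal.add_le_add_iff_right (a := ENNReal.ofReal (1 / 4) * volume B)
      (ENNReal.mul_ne_top ENNReal.ofReal_ne_top hBtop)).1 (le_trans ?_ h1)
    rw [← add_mul, ← ENNReal.ofReal_add (by norm_num) (by norm_num)]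
    norm_num
  have hsub : s • {a ∈ B | N a < 4 * c} ⊆ K := by
    rintro _ ⟨a, ⟨-, ha⟩, rfl⟩
    rw [hK, mem_preimage_tilde_iff hn hm hψ]
    intro x hx y hy
    have h1 := beval_pow_le hn hm hσ₁ hσ₂ (hψ.mem a).1 p hx hy
    have h2 : (beval (ψ (s • a)) x y) ^ (2 * p) ≤ 1 := by
      have : beval (ψ (s • a)) x y = s * beval (ψ a) x y := by
        rw [map_smul]; simp [beval, smul_eval]
      rw [this, mul_pow]
      refine le_trans (mul_le_mul_of_nonneg_left (h1.trans (mul_le_mul_of_nonneg_left ha.le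
        (Nat.cast_nonneg _))) (by positivity)) hsp
    have h3 := (pow_le_one_iff_of_nonneg (abs_nonneg (beval (ψ (s • a)) x y))
      (by omega : 2 * p ≠ 0)).1 (by rw [pow_mul, sq_abs, ← pow_mul]; exact h2)
    exact (abs_le.1 h3).1
  calc ENNReal.ofReal (3 / 4 * s ^ D) * volume B
      = ENNReal.ofReal (s ^ D) * (ENNReal.ofReal (3 / 4) * volume B) := by
        rw [mul_comm (3 / 4 : ℝ), ENNReal.ofReal_mul (by positivity), mul_assoc]
    _ ≤ ENNReal.ofReal (s ^ D) * volume {a ∈ B | N a < 4 * c} := by gcongr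
    _ = volume (s • {a ∈ B | N a < 4 * c}) := by
        rw [Measure.addHaar_smul]; simp [abs_of_pos hs]
    _ ≤ _ := measure_mono hsub

end LowerBound

section LowerBoundConstants
open BiformPaper Set Filter Topology
variable {n m k₁ k₂ D : ℕ} {σ₁ : Measure (Fin n → ℝ)} {σ₂ : Measure (Fin m → ℝ)}
  {ψ : (Fin D → ℝ) →ₗ[ℝ] MvPolynomial (Fin n ⊕ Fin m) ℝ}

theorem choose_mul_pow_le {x : ℝ} (hx : 0 ≤ x) (N j : ℕ) :
    (N.choose j : ℝ) * x ^ j ≤ (1 + x) ^ N := by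
  rcases le_or_gt j N with h | h
  · rw [add_comm, add_pow]
    have := Finset.single_le_sum (s := Finset.range (N + 1))
      (f := fun i => x ^ i * 1 ^ (N - i) * (N.choose i : ℝ)) (fun i _ => by positivity)
      (Finset.mem_range_succ_iff.2 h)
    simpa [mul_comm] using this
  · rw [Nat.choose_eq_zero_of_lt h]; simp; positivity

theorem ofReal_le_rpow_volume_ratio (hn : 0 < n) (hm : 0 < m) (hσ₁ : IsSphereMeasure n σ₁)
    (hσ₂ : IsSphereMeasure m σ₂) (hD : 2 ≤ D)
    (hψ : IsUnitaryParam n m D σ₁ σ₂ (MSet n m k₁ k₂ σ₁ σ₂) ψ) {p : ℕ} (hp : 0 < p) {c : ℝ}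
    (hc : 0 < c)
    (h : (4 / 3 * c ^ 2) ^ p * (((n + 2 * k₁ * p - 1).choose (2 * k₁ * p) *
      (m + 2 * k₂ * p - 1).choose (2 * k₂ * p) : ℕ) * (4 * (p : ℝ) ^ p)) ≤ 1) :
    ENNReal.ofReal c ≤ (volume (ψ ⁻¹' tilde n m k₁ k₂ σ₁ σ₂ (PosSet n m k₁ k₂)) /
      volume (ψ ⁻¹' bball n m k₁ k₂ σ₁ σ₂)) ^ ((1 : ℝ) / (D : ℝ)) := by
  set s := √(4 / 3) * c with hs
  have hs2 : s ^ 2 = 4 / 3 * c ^ 2 := by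
    rw [hs, mul_pow, Real.sq_sqrt (by norm_num)]
  have hs0 : 0 < s := by positivity
  have h1 := mul_volume_unitBall_le hn hm hσ₁ hσ₂ (by omega) hψ hp hs0 (by rwa [pow_mul, hs2])
  rw [← preimage_bball_eq hψ] at h1
  have hB : volume (ψ ⁻¹' bball n m k₁ k₂ σ₁ σ₂) ≠ 0 := by
    rw [preimage_bball_eq hψ]; exact (volume_unitBall_pos D).ne'
  have hB' : volume (ψ ⁻¹' bball n m k₁ k₂ σ₁ σ₂) ≠ ⊤ := by
    rw [preimage_bball_eq hψ]; exact (isCompact_unitBall D).measure_ne_top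
  have h2 : ENNReal.ofReal (c ^ D) ≤ ENNReal.ofReal (3 / 4 * s ^ D) := by
    refine ENNReal.ofReal_le_ofReal ?_
    have h3 : (4 / 3 : ℝ) ≤ √(4 / 3) ^ D := by
      have : √(4 / 3) ^ 2 ≤ √(4 / 3 : ℝ) ^ D :=
        pow_le_pow_right₀ (Real.one_le_sqrt.2 (by norm_num)) hD
      rwa [Real.sq_sqrt (by norm_num)] at this
    rw [hs, mul_pow]
    have : 0 < c ^ D := by positivity
    nlinarith
  have h3 : ENNReal.ofReal (c ^ D) ≤ volume (ψ ⁻¹' tilde n m k₁ k₂ σ₁ σ₂ (PosSet n m k₁ k₂)) /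
      volume (ψ ⁻¹' bball n m k₁ k₂ σ₁ σ₂) :=
    h2.trans ((ENNReal.le_div_iff_mul_le (Or.inl hB) (Or.inl hB')).2 h1)
  rw [ENNReal.ofReal_pow hc.le] at h3
  rw [one_div, ENNReal.le_rpow_inv_iff (by positivity)]
  simpa using h3

theorem choose_le_exp {K M p a k : ℕ} (hK : 0 < K) (hk : k ≤ K) (ha0 : 0 < a) (ha : a ≤ M)
    (hMp : M ≤ p) (hp : (M : ℝ) * Real.log (2 * K + 1) ≤ p) :
    ((a + 2 * k * p - 1).choose (2 * k * p) : ℝ) ≤ Real.exp (2 * p) := by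
  obtain ⟨a, rfl⟩ := Nat.exists_eq_succ_of_ne_zero ha0.ne'
  have e : (a + 1 + 2 * k * p - 1).choose (2 * k * p) = (a + 2 * k * p).choose a := by
    rw [show a + 1 + 2 * k * p - 1 = a + 2 * k * p by omega]
    exact (Nat.choose_symm_add).symm
  rw [Nat.succ_eq_add_one, e]
  have hK0 : (0 : ℝ) < 2 * K + 1 := by positivity
  have h1 := choose_mul_pow_le (x := (2 * (K : ℝ) + 1)⁻¹) (by positivity) (a + 2 * k * p) a
  have h2 : (1 + (2 * (K : ℝ) + 1)⁻¹) ^ (a + 2 * k * p) ≤ Real.exp p := by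
    have h3 : 1 + (2 * (K : ℝ) + 1)⁻¹ ≤ Real.exp (2 * (K : ℝ) + 1)⁻¹ := by
      rw [add_comm]; exact Real.add_one_le_exp _
    refine (pow_le_pow_left₀ (by positivity) h3 _).trans ?_
    rw [← Real.exp_nat_mul, Real.exp_le_exp, ← div_eq_mul_inv, div_le_iff₀ hK0]
    have : a + 2 * k * p ≤ p * (2 * K + 1) := by nlinarith [Nat.mul_le_mul_right p hk]
    exact_mod_cast this
  have h3 : (2 * (K : ℝ) + 1) ^ a ≤ Real.exp p := by
    have : (2 * (K : ℝ) + 1) ^ a ≤ (2 * (K : ℝ) + 1) ^ M :=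
      pow_le_pow_right₀ (by linarith [(Nat.cast_nonneg K : (0 : ℝ) ≤ K)]) (by omega)
    refine this.trans ?_
    rw [← Real.exp_log (by positivity : 0 < (2 * (K : ℝ) + 1) ^ M), Real.log_pow]
    exact Real.exp_le_exp.2 hp
  rw [inv_pow, mul_inv_le_iff₀ (by positivity)] at h1
  refine h1.trans ?_
  rw [two_mul (p : ℝ), Real.exp_add]
  exact mul_le_mul h2 h3 (by positivity) (by positivity)

theorem choose_le_pow {M a : ℕ} (ha0 : 0 < a) (ha : a ≤ M) :
    ((a + 2 * 1 * (3 * M) - 1).choose (2 * 1 * (3 * M)) : ℝ) ≤ (7 ^ 7 / 6 ^ 6 : ℝ) ^ M := by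
  have h1 := choose_mul_pow_le (x := 6) (by norm_num) (7 * M) (6 * M)
  have h2 : ((a + 2 * 1 * (3 * M) - 1).choose (2 * 1 * (3 * M)) : ℝ) ≤
      (7 * M).choose (6 * M) := by
    rw [show 2 * 1 * (3 * M) = 6 * M by ring]
    exact_mod_cast Nat.choose_le_choose _ (by omega)
  rw [div_pow, le_div_iff₀ (by positivity), ← pow_mul, ← pow_mul]
  refine (mul_le_mul_of_nonneg_right h2 (by positivity)).trans (h1.trans_eq ?_)
  norm_num

theorem ofReal_exp_le_rpow_volume_ratio (hn : 0 < n) (hm : 0 < m) (hk₁ : 0 < k₁)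
    (hσ₁ : IsSphereMeasure n σ₁) (hσ₂ : IsSphereMeasure m σ₂) (hD : 2 ≤ D)
    (hψ : IsUnitaryParam n m D σ₁ σ₂ (MSet n m k₁ k₂ σ₁ σ₂) ψ) :
    ENNReal.ofReal (Real.exp (-3) *
      ((2 : ℝ) * (⌈((max n m : ℕ) : ℝ) * Real.log (2 * ((max k₁ k₂ : ℕ) : ℝ) + 1)⌉ : ℝ))
        ^ (-(1 : ℝ) / 2)) ≤ (volume (ψ ⁻¹' tilde n m k₁ k₂ σ₁ σ₂ (PosSet n m k₁ k₂)) /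
      volume (ψ ⁻¹' bball n m k₁ k₂ σ₁ σ₂)) ^ ((1 : ℝ) / (D : ℝ)) := by
  set M := max n m with hM
  set K := max k₁ k₂ with hK
  have hM0 : 0 < M := lt_of_lt_of_le hn (le_max_left _ _)
  have hK0 : 0 < K := lt_of_lt_of_le hk₁ (le_max_left _ _)
  have hK1 : (1 : ℝ) ≤ K := by exact_mod_cast hK0
  have hlog : 1 ≤ Real.log (2 * (K : ℝ) + 1) := by
    rw [Real.le_log_iff_exp_le (by positivity)]
    linarith [Real.exp_one_lt_d9]
  set p := ⌈(M : ℝ) * Real.log (2 * (K : ℝ) + 1)⌉₊ with hp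
  have hle : (M : ℝ) * Real.log (2 * (K : ℝ) + 1) ≤ p := Nat.le_ceil _
  have hMp : M ≤ p := by
    have : (M : ℝ) ≤ p := le_trans (le_mul_of_one_le_right (Nat.cast_nonneg _) hlog) hle
    exact_mod_cast this
  have hp0 : 0 < p := hM0.trans_le hMp
  have hpR : (0 : ℝ) < p := by exact_mod_cast hp0
  rw [← natCast_ceil_eq_intCast_ceil (by positivity), ← hp]
  refine ofReal_le_rpow_volume_ratio hn hm hσ₁ hσ₂ hD hψ hp0 (by positivity) ?_
  have hc : 4 / 3 * (Real.exp (-3) * ((2 : ℝ) * p) ^ (-(1 : ℝ) / 2)) ^ 2 =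
      2 / 3 * Real.exp (-6) / p := by
    rw [mul_pow, ← Real.rpow_natCast (_ ^ _), ← Real.rpow_mul (by positivity),
      ← Real.exp_nat_mul]
    norm_num
    rw [Real.rpow_neg_one]
    field_simp
    norm_num
  rw [hc]
  have hW := mul_le_mul (choose_le_exp hK0 (le_max_left k₁ k₂) hn (le_max_left n m) hMp hle)
    (choose_le_exp hK0 (le_max_right k₁ k₂) hm (le_max_right n m) hMp hle)
    (Nat.cast_nonneg _) (Real.exp_nonneg _)
  rw [Nat.cast_mul]
  calc _ ≤ (2 / 3 * Real.exp (-6) / p) ^ p *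
        (Real.exp (2 * p) * Real.exp (2 * p) * (4 * (p : ℝ) ^ p)) := by gcongr
    _ = 4 * (2 / 3 * Real.exp (-2)) ^ p := by
        rw [div_pow, mul_pow, mul_pow, ← Real.exp_nat_mul, ← Real.exp_nat_mul, ← Real.exp_add]
        rw [show Real.exp (p * (-2)) = Real.exp (p * (-6)) * Real.exp (2 * p + 2 * p) by
          rw [← Real.exp_add]; congr 1; ring]
        field_simp
    _ ≤ 4 * (2 / 3 * Real.exp (-2)) ^ 1 := by
        gcongr 4 * ?_
        refine pow_le_pow_of_le_one (by positivity) ?_ hp0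
        have : Real.exp (-2) ≤ 1 := by simp
        linarith
    _ ≤ 1 := by
        have h1 : (2.7 : ℝ) ≤ Real.exp 1 := by linarith [Real.exp_one_gt_d9]
        have h2 : Real.exp (-2) = (Real.exp 1 ^ 2)⁻¹ := by
          rw [← Real.exp_nat_mul, ← Real.exp_neg]; norm_num
        have h3 : (7.2 : ℝ) ≤ Real.exp 1 ^ 2 := by nlinarith
        have h4 : (Real.exp 1 ^ 2)⁻¹ ≤ (7.2 : ℝ)⁻¹ := inv_anti₀ (by norm_num) h3
        rw [h2, pow_one]
        norm_num at h4 ⊢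
        linarith

theorem ofReal_ten_rpow_le_rpow_volume_ratio (hn : 0 < n) (hm : 0 < m) (hnm : 2 ≤ max n m)
    (hσ₁ : IsSphereMeasure n σ₁) (hσ₂ : IsSphereMeasure m σ₂) (hD : 2 ≤ D)
    (hψ : IsUnitaryParam n m D σ₁ σ₂ (MSet n m 1 1 σ₁ σ₂) ψ) :
    ENNReal.ofReal ((3 : ℝ) ^ 3 * (10 : ℝ) ^ (-(20 : ℝ) / 9) *
      ((max n m : ℕ) : ℝ) ^ (-(1 : ℝ) / 2)) ≤
      (volume (ψ ⁻¹' tilde n m 1 1 σ₁ σ₂ (PosSet n m 1 1)) /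
      volume (ψ ⁻¹' bball n m 1 1 σ₁ σ₂)) ^ ((1 : ℝ) / (D : ℝ)) := by
  set M := max n m with hM
  have hMR : (0 : ℝ) < M := by exact_mod_cast (by omega : 0 < M)
  refine ofReal_le_rpow_volume_ratio (p := 3 * M) hn hm hσ₁ hσ₂ hD hψ (by omega)
    (by positivity) ?_
  set t : ℝ := (10 : ℝ) ^ (-(20 : ℝ) / 9) with ht
  have ht6 : t ^ 6 ≤ 4.642 / 10 ^ 14 := by
    have h0 : 0 ≤ t := by positivity
    have h9 : (t ^ 6) ^ 3 = 1 / 10 ^ 40 := by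
      rw [← pow_mul, ht, ← Real.rpow_natCast, ← Real.rpow_mul (by norm_num)]
      norm_num
    refine le_of_pow_le_pow_left₀ (n := 3) (by norm_num) (by norm_num) ?_
    rw [h9]; norm_num
  have hc : 4 / 3 * ((3 : ℝ) ^ 3 * t * (M : ℝ) ^ (-(1 : ℝ) / 2)) ^ 2 = 972 * t ^ 2 / M := by
    rw [mul_pow, ← Real.rpow_natCast ((M : ℝ) ^ _), ← Real.rpow_mul hMR.le]
    norm_num
    rw [Real.rpow_neg_one]
    ring
  rw [hc, Nat.cast_mul]
  have hW := mul_le_mul (choose_le_pow hn (le_max_left n m)) (choose_le_pow hm (le_max_right n m))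
    (Nat.cast_nonneg _) (by positivity)
  rw [← hM] at hW
  calc _ ≤ (972 * t ^ 2 / M) ^ (3 * M) * ((7 ^ 7 / 6 ^ 6 : ℝ) ^ M * (7 ^ 7 / 6 ^ 6 : ℝ) ^ M *
        (4 * ((3 * M : ℕ) : ℝ) ^ (3 * M))) := by gcongr
    _ = 4 * (2916 ^ 3 * t ^ 6 * (7 ^ 7 / 6 ^ 6) ^ 2) ^ M := by
        have e : (972 * t ^ 2 / M) ^ (3 * M) * ((3 * M : ℕ) : ℝ) ^ (3 * M) =
            (2916 ^ 3 * t ^ 6) ^ M := by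
          rw [← mul_pow, pow_mul]
          congr 1
          push_cast
          field_simp
          ring
        rw [mul_pow _ (_ ^ 2), ← e, pow_right_comm]
        ring
    _ ≤ 4 * (0.36 : ℝ) ^ M := by
        gcongr
        refine (mul_le_mul_of_nonneg_right (mul_le_mul_of_nonneg_left ht6 (by norm_num))
          (by norm_num)).trans ?_
        norm_num
    _ ≤ 4 * (0.36 : ℝ) ^ 2 := by
        gcongr 4 * ?_
        exact pow_le_pow_of_le_one (by norm_num) (by norm_num) hnm
    _ ≤ 1 := by norm_num

theorem three_le_choose_of_two_le {a k : ℕ} (ha : 2 ≤ a) (hk : 0 < k) :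
    3 ≤ (a + 2 * k - 1).choose (2 * k) := by
  calc 3 ≤ 2 * k + 1 := by omega
    _ = (2 * k + 1).choose (2 * k) := by simp
    _ ≤ _ := Nat.choose_le_choose _ (by omega)

end LowerBoundConstants

section BernsteinPolynomial
open Set Filter Topology Polynomial

theorem norm_eval_le_of_forall_real {P : ℂ[X]} {N : ℕ} (hP : P.natDegree ≤ N) {ζ : ℂ}
    (hζ : ζ.im < 0) (h : ∀ s : ℝ, ‖P.eval (s : ℂ)‖ ≤ ‖(s : ℂ) - ζ‖ ^ N) {z : ℂ} (hz : 0 ≤ z.im) :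
    ‖P.eval z‖ ≤ ‖z - ζ‖ ^ N := by
  have hδ : ∀ w : ℂ, 0 ≤ w.im → -ζ.im ≤ ‖w - ζ‖ := fun w hw => by
    have := Complex.abs_im_le_norm (w - ζ)
    rw [Complex.sub_im, abs_of_pos (by linarith)] at this
    linarith
  have hpos : ∀ w : ℂ, 0 ≤ w.im → 0 < ‖w - ζ‖ := fun w hw => by have := hδ w hw; linarith
  have hne : ∀ w : ℂ, 0 ≤ w.im → w - ζ ≠ 0 := fun w hw => norm_pos_iff.1 (hpos w hw)
  set F : ℂ → ℂ := fun w => P.eval (Complex.I * w) / (Complex.I * w - ζ) ^ N with hF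
  have him : ∀ w : ℂ, (Complex.I * w).im = w.re := fun w => by simp
  have hbd : ∃ M : ℝ, ∀ w : ℂ, 0 ≤ w.re → ‖F w‖ ≤ M := by
    refine ⟨∑ k ∈ Finset.range (N + 1), ‖(taylor ζ P).coeff k‖ * ((-ζ.im)⁻¹) ^ (N - k),
      fun w hw => ?_⟩
    have hw' : 0 ≤ (Complex.I * w).im := by rw [him]; exact hw
    have e : P.eval (Complex.I * w) = ∑ k ∈ Finset.range (N + 1),
        (taylor ζ P).coeff k * (Complex.I * w - ζ) ^ k := by
      rw [← eval_eq_sum_range' (by rw [natDegree_taylor]; omega), taylor_eval]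
      simp
    simp only [hF]
    rw [e, Finset.sum_div]
    refine (norm_sum_le _ _).trans (Finset.sum_le_sum fun k hk => ?_)
    have hk' : k ≤ N := by simpa [Nat.lt_succ_iff] using hk
    rw [mul_div_assoc, norm_mul]
    refine mul_le_mul_of_nonneg_left ?_ (norm_nonneg _)
    rw [div_eq_mul_inv, ← pow_sub_mul_pow _ hk', mul_inv, mul_comm _ ((_ ^ k)⁻¹), ← mul_assoc,
      mul_inv_cancel₀ (pow_ne_zero _ (hne _ hw')), one_mul, norm_inv, norm_pow, ← inv_pow]
    exact pow_le_pow_left₀ (inv_nonneg.2 (norm_nonneg _))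
      (inv_anti₀ (by linarith) (hδ _ hw')) _
  obtain ⟨M, hM⟩ := hbd
  have key : ‖F (-Complex.I * z)‖ ≤ 1 := by
    have hdiff : DifferentiableOn ℂ F {w | 0 ≤ w.re} := by
      intro w hw
      refine DifferentiableAt.differentiableWithinAt ?_
      refine DifferentiableAt.div ?_ (by fun_prop)
        (pow_ne_zero _ (hne _ (by rw [him]; exact hw)))
      exact (Polynomial.differentiable P).differentiableAt.comp w (by fun_prop)
    refine PhragmenLindelof.right_half_plane_of_bounded_on_real (C := 1) ?_ ?_ ?_ ?_ ?_
    · refine ⟨hdiff.mono fun w (hw : 0 < w.re) => hw.le, ?_⟩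
      rw [Complex.closure_setOfPred_lt_re]
      exact hdiff.continuousOn
    · refine ⟨1, by norm_num, 0, Asymptotics.IsBigO.of_bound M ?_⟩
      rw [Filter.eventually_inf_principal]
      refine Eventually.of_forall fun w hw => ?_
      simpa using hM w (le_of_lt hw)
    · refine ⟨M, ?_⟩
      rw [eventually_map]
      filter_upwards [eventually_ge_atTop 0] with x hx
      exact hM x (by simpa using hx)
    · intro x
      simp only [hF]
      have e : Complex.I * ((x : ℂ) * Complex.I) = ((-x : ℝ) : ℂ) := by
        push_cast; ring_nf; simp
      rw [e, norm_div, norm_pow]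
      exact div_le_one_of_le₀ (h _) (by positivity)
    · simpa using hz
  have e : Complex.I * (-Complex.I * z) = z := by ring_nf; simp
  simp only [hF] at key
  rw [e, norm_div, norm_pow, div_le_one (pow_pos (hpos z hz) _)] at key
  exact key

theorem norm_eval_derivative_le_of_forall_real {P : ℂ[X]} {N : ℕ} (hN : 0 < N)
    (hP : P.natDegree ≤ N) {ζ : ℂ} (hζ : ζ.im < 0)
    (h : ∀ s : ℝ, ‖P.eval (s : ℂ)‖ ≤ ‖(s : ℂ) - ζ‖ ^ N) (s₀ : ℝ) :
    ‖P.derivative.eval (s₀ : ℂ)‖ ≤ N * ‖(s₀ : ℂ) - ζ‖ ^ (N - 1) := by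
  by_contra! hlt
  have hne : ∀ w : ℂ, 0 ≤ w.im → w - ζ ≠ 0 := fun w hw e => by
    have := congrArg Complex.im e
    simp at this; linarith
  have hs₀ : (s₀ : ℂ) - ζ ≠ 0 := hne _ (by simp)
  have hN' : (N : ℂ) ≠ 0 := by exact_mod_cast hN.ne'
  set l : ℂ := P.derivative.eval (s₀ : ℂ) / (N * ((s₀ : ℂ) - ζ) ^ (N - 1)) with hl
  have hl1 : 1 < ‖l‖ := by
    rw [hl, norm_div, norm_mul, norm_pow, Complex.norm_natCast, one_lt_div]
    · exact hlt
    · exact mul_pos (by exact_mod_cast hN) (pow_pos (norm_pos_iff.2 hs₀) _)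
  set Q : ℂ[X] := P - Polynomial.C l * (Polynomial.X - Polynomial.C ζ) ^ N with hQ
  have hQe : ∀ z, Q.eval z = P.eval z - l * (z - ζ) ^ N := fun z => by simp [hQ]
  have hQ0 : ∀ z : ℂ, Q.eval z = 0 → z.im < 0 := fun z hz => by
    by_contra! hz0
    rw [hQe, sub_eq_zero] at hz
    have := norm_eval_le_of_forall_real hP hζ h hz0
    rw [hz, norm_mul, norm_pow] at this
    have hp : 0 < ‖z - ζ‖ ^ N := pow_pos (norm_pos_iff.2 (hne z hz0)) _
    nlinarith
  have hQ' : Q.derivative.eval (s₀ : ℂ) = 0 := by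
    simp only [hQ, derivative_sub, derivative_C_mul, derivative_X_sub_C_pow,
      Polynomial.eval_sub, Polynomial.eval_mul, Polynomial.eval_C, Polynomial.eval_pow,
      Polynomial.eval_X]
    rw [hl]
    field_simp
    ring
  have hdeg : 0 < Q.degree := by
    by_contra! hd
    obtain ⟨c, hc⟩ : ∃ c, Q = Polynomial.C c := ⟨_, eq_C_of_degree_le_zero hd⟩
    set t : ℝ := ‖c‖ / (‖l‖ - 1) + 1 with ht
    have ht1 : 1 ≤ t := by
      have : 0 ≤ ‖c‖ / (‖l‖ - 1) := div_nonneg (norm_nonneg _) (by linarith)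
      linarith
    have h1 := h (ζ.re + t)
    have h2 := hQe ((ζ.re + t : ℝ) : ℂ)
    rw [hc, Polynomial.eval_C] at h2
    have h3 : t ≤ ‖((ζ.re + t : ℝ) : ℂ) - ζ‖ := by
      have := Complex.abs_re_le_norm (((ζ.re + t : ℝ) : ℂ) - ζ)
      rw [Complex.sub_re, Complex.ofReal_re, add_sub_cancel_left] at this
      exact (le_abs_self t).trans this
    set r := ‖((ζ.re + t : ℝ) : ℂ) - ζ‖ with hr
    have h4 : t ≤ r ^ N := h3.trans (le_self_pow₀ (ht1.trans h3) hN.ne')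
    have h5 : ‖l‖ * r ^ N ≤ ‖c‖ + r ^ N := by
      rw [hr, ← norm_pow, ← norm_mul]
      rw [show l * (((ζ.re + t : ℝ) : ℂ) - ζ) ^ N = P.eval ((ζ.re + t : ℝ) : ℂ) - c by
        rw [h2]; ring]
      refine (norm_sub_le _ _).trans ?_
      rw [add_comm, norm_pow]
      gcongr
    have h6 : (‖l‖ - 1) * t = ‖c‖ + (‖l‖ - 1) := by
      rw [ht]; field_simp [show ‖l‖ - 1 ≠ 0 by linarith]
    nlinarith
  have hmem := Polynomial.rootSet_derivative_subset_convexHull_rootSet hdeg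
    (show (s₀ : ℂ) ∈ Q.derivative.rootSet ℂ from by
      rw [mem_rootSet]
      refine ⟨fun h0 => ?_, by simpa using hQ'⟩
      have := Polynomial.derivative_eq_zero.1 h0
      exact (natDegree_pos_iff_degree_pos.2 hdeg).ne' this)
  have hconv : convexHull ℝ (Q.rootSet ℂ) ⊆ {z : ℂ | z.im < 0} := by
    refine convexHull_min (fun z hz => ?_) ?_
    · rw [mem_rootSet] at hz
      exact hQ0 z (by simpa using hz.2)
    · exact convex_halfSpace_im_lt 0
  have := hconv hmem
  simp at this

end BernsteinPolynomial

section BiformCalculus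
open BiformPaper Set Filter Topology

variable {n m : ℕ}

theorem pderiv_mem_biform {d₁ d₂ : ℕ} {f : MvPolynomial (Fin n ⊕ Fin m) ℝ}
    (hf : f ∈ Biform n m (d₁ + 1) d₂) (i : Fin n) : pderiv (Sum.inl i) f ∈ Biform n m d₁ d₂ :=
  IsWeightedHomogeneous.pderiv hf rfl

theorem mul_mem_biform {d₁ d₂ e₁ e₂ : ℕ} {f g : MvPolynomial (Fin n ⊕ Fin m) ℝ}
    (hf : f ∈ Biform n m d₁ d₂) (hg : g ∈ Biform n m e₁ e₂) :
    f * g ∈ Biform n m (d₁ + e₁) (d₂ + e₂) :=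
  IsWeightedHomogeneous.mul hf hg

theorem sum_mem_biform {ι : Type*} {d₁ d₂ : ℕ} {s : Finset ι}
    {f : ι → MvPolynomial (Fin n ⊕ Fin m) ℝ} (hf : ∀ i ∈ s, f i ∈ Biform n m d₁ d₂) :
    ∑ i ∈ s, f i ∈ Biform n m d₁ d₂ :=
  IsWeightedHomogeneous.sum _ _ _ hf

theorem X_inl_mem_biform (i : Fin n) :
    (X (Sum.inl i) : MvPolynomial (Fin n ⊕ Fin m) ℝ) ∈ Biform n m 1 0 :=
  isWeightedHomogeneous_X _ _ _

theorem sum_X_mul_pderiv_inl {d₁ d₂ : ℕ} {f : MvPolynomial (Fin n ⊕ Fin m) ℝ}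
    (hf : f ∈ Biform n m d₁ d₂) :
    ∑ i : Fin n, X (Sum.inl i) * pderiv (Sum.inl i) f = C (d₁ : ℝ) * f := by
  have h : IsWeightedHomogeneous (Sum.elim (fun _ => 1) (fun _ => 0) : Fin n ⊕ Fin m → ℕ) f d₁ := by
    intro d hd
    have h := congrArg Prod.fst (hf hd)
    refine Eq.trans ?_ h
    rw [Finsupp.weight_apply, Finsupp.weight_apply, Finsupp.sum_fintype _ _ (by simp),
      Finsupp.sum_fintype _ _ (by simp), Prod.fst_sum]
    refine Finset.sum_congr rfl fun i _ => ?_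
    rcases i with i | i <;> simp [bw]
  have := h.sum_weight_X_mul_pderiv
  simpa [Fintype.sum_sum_type, nsmul_eq_mul] using this

theorem sum_mul_beval_pderiv {d₁ d₂ : ℕ} {f : MvPolynomial (Fin n ⊕ Fin m) ℝ}
    (hf : f ∈ Biform n m d₁ d₂) (x : Fin n → ℝ) (y : Fin m → ℝ) :
    ∑ i, x i * beval (pderiv (Sum.inl i) f) x y = d₁ * beval f x y := by
  have := congrArg (fun g => beval g x y) (sum_X_mul_pderiv_inl hf)
  simpa [beval] using this

/-- The restriction of a biform to the line `s ↦ (x + s w, y)`, as a polynomial in `s`. -/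
def lineRestrict (x w : Fin n → ℝ) (y : Fin m → ℝ) :
    MvPolynomial (Fin n ⊕ Fin m) ℝ →ₐ[ℝ] Polynomial ℝ :=
  aeval (Sum.elim (fun i => Polynomial.C (x i) + Polynomial.C (w i) * Polynomial.X)
    (fun j => Polynomial.C (y j)))

theorem eval_lineRestrict (x w : Fin n → ℝ) (y : Fin m → ℝ)
    (f : MvPolynomial (Fin n ⊕ Fin m) ℝ) (s : ℝ) :
    (lineRestrict x w y f).eval s = beval f (x + s • w) y := by
  induction f using MvPolynomial.induction_on with
  | C a => simp [beval, lineRestrict]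
  | add f g hf hg => simp only [beval, map_add, Polynomial.eval_add] at *; rw [hf, hg]
  | mul_X f i hf =>
    simp only [beval, map_mul, Polynomial.eval_mul] at *
    rw [hf]
    congr 1
    rcases i with i | i <;> simp [lineRestrict]
    ring

theorem derivative_lineRestrict (x w : Fin n → ℝ) (y : Fin m → ℝ)
    (f : MvPolynomial (Fin n ⊕ Fin m) ℝ) :
    (lineRestrict x w y f).derivative =
      ∑ i, Polynomial.C (w i) * lineRestrict x w y (pderiv (Sum.inl i) f) := by
  induction f using MvPolynomial.induction_on with
  | C a => simp [lineRestrict]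
  | add f g hf hg => simp only [map_add, hf, hg, mul_add, Finset.sum_add_distrib]
  | mul_X f k hf =>
    simp only [map_mul, Polynomial.derivative_mul, Derivation.leibniz, smul_eq_mul, map_add,
      hf, mul_add, Finset.sum_add_distrib]
    rw [add_comm]
    congr 1
    · rcases k with k | k
      · rw [Finset.sum_eq_single k]
        · simp [lineRestrict]; ring
        · intro b _ hb
          simp [pderiv_X_of_ne (R := ℝ)
            (show (Sum.inl k : Fin n ⊕ Fin m) ≠ Sum.inl b from fun h => hb (Sum.inl.inj h).symm)]
        · simp
      · simp [lineRestrict]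
    · rw [Finset.sum_mul]
      exact Finset.sum_congr rfl fun i _ => by ring

theorem natDegree_lineRestrict_le {d₁ d₂ : ℕ} {f : MvPolynomial (Fin n ⊕ Fin m) ℝ}
    (hf : f ∈ Biform n m d₁ d₂) (x w : Fin n → ℝ) (y : Fin m → ℝ) :
    (lineRestrict x w y f).natDegree ≤ d₁ := by
  rw [lineRestrict, aeval_def, eval₂_eq']
  refine Polynomial.natDegree_sum_le_of_forall_le _ _ fun d hd => ?_
  have h := congrArg Prod.fst (hf (mem_support_iff.1 hd))
  rw [Finsupp.weight_apply, Finsupp.sum_fintype _ _ (by simp), Fintype.sum_sum_type] at h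
  have h1 : ∑ i, d (Sum.inl i) = d₁ := by simpa [bw, Prod.fst_sum] using h
  rw [Fintype.prod_sum_type]
  simp only [Sum.elim_inl, Sum.elim_inr]
  refine (Polynomial.natDegree_C_mul_le _ _).trans ?_
  refine Polynomial.natDegree_mul_le.trans ?_
  have a1 : (∏ i, (Polynomial.C (x i) + Polynomial.C (w i) * Polynomial.X) ^
      d (Sum.inl i)).natDegree ≤ d₁ := by
    rw [← h1]
    refine (Polynomial.natDegree_prod_le _ _).trans (Finset.sum_le_sum fun i _ => ?_)
    refine Polynomial.natDegree_pow_le.trans ?_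
    have : (Polynomial.C (x i) + Polynomial.C (w i) * Polynomial.X).natDegree ≤ 1 := by
      compute_degree
    exact (Nat.mul_le_mul_left _ this).trans (by simp)
  have a2 : (∏ i, (Polynomial.C (y i)) ^ d (Sum.inr i)).natDegree ≤ 0 := by
    refine (Polynomial.natDegree_prod_le _ _).trans ?_
    simp [← Polynomial.C_pow, -map_pow]
  omega

/-- **Bernstein–Szegő inequality** for biforms: the gradient in `x` of a biform of degree `d` in `x`
bounded by `1` on the product of spheres has norm at most `d` there. -/
theorem sum_sq_beval_pderiv_le (hn : 0 < n) {d₁ d₂ : ℕ} (hd : 0 < d₁)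
    {f : MvPolynomial (Fin n ⊕ Fin m) ℝ} (hf : f ∈ Biform n m d₁ d₂)
    (h : ∀ x ∈ unitSphere n, ∀ y ∈ unitSphere m, |beval f x y| ≤ 1)
    {x : Fin n → ℝ} {y : Fin m → ℝ} (hx : x ∈ unitSphere n) (hy : y ∈ unitSphere m) :
    ∑ i, beval (pderiv (Sum.inl i) f) x y ^ 2 ≤ (d₁ : ℝ) ^ 2 := by
  set v : Fin n → ℝ := fun i => beval (pderiv (Sum.inl i) f) x y with hv
  obtain ⟨V, hV, w, hw, hvw⟩ := exists_unitSphere_smul hn v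
  change ∑ i, v i ^ 2 ≤ _
  have hx' : ∑ i, x i ^ 2 = 1 := hx
  have hw' : ∑ i, w i ^ 2 = 1 := hw
  have hV2 : ∑ i, v i ^ 2 = V ^ 2 := by
    simp [hvw, mul_pow, ← Finset.mul_sum, hw']
  rw [hV2]
  refine pow_le_pow_left₀ hV ?_ 2
  set c : ℝ := ∑ i, x i * w i with hc
  have hwv : ∑ i, w i * v i = V := by
    have : ∀ i, w i * v i = V * w i ^ 2 := fun i => by
      rw [hvw]; simp only [Pi.smul_apply, smul_eq_mul]; ring
    simp only [this, ← Finset.mul_sum, hw', mul_one]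
  have hsq : ∀ s : ℝ, ∑ i, (x i + s * w i) ^ 2 = 1 + 2 * c * s + s ^ 2 := fun s => by
    have : ∀ i, (x i + s * w i) ^ 2 = x i ^ 2 + 2 * s * (x i * w i) + s ^ 2 * w i ^ 2 :=
      fun i => by ring
    simp only [this, Finset.sum_add_distrib, ← Finset.mul_sum, hx', hw', ← hc]
    ring
  have hc1 : c ^ 2 ≤ 1 := by
    have h0 : 0 ≤ ∑ i, (x i + (-c) * w i) ^ 2 := Finset.sum_nonneg fun _ _ => sq_nonneg _
    rw [hsq] at h0
    nlinarith
  rcases hc1.lt_or_eq with hlt | heq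
  · set ζ : ℂ := ⟨-c, -√(1 - c ^ 2)⟩ with hζ
    have hs : 0 < √(1 - c ^ 2) := Real.sqrt_pos.2 (by linarith)
    have hnorm : ∀ s : ℝ, ‖(s : ℂ) - ζ‖ ^ 2 = 1 + 2 * c * s + s ^ 2 := fun s => by
      rw [← Complex.normSq_eq_norm_sq, Complex.normSq_apply]
      simp only [hζ, Complex.sub_re, Complex.sub_im, Complex.ofReal_re, Complex.ofReal_im]
      have := Real.mul_self_sqrt (show 0 ≤ 1 - c ^ 2 by linarith)
      nlinarith
    have hbound : ∀ s : ℝ, |beval f (x + s • w) y| ≤ ‖(s : ℂ) - ζ‖ ^ d₁ := fun s => by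
      obtain ⟨r, hr, u, hu, e⟩ := exists_unitSphere_smul hn (x + s • w)
      have hu' : ∑ i, u i ^ 2 = 1 := hu
      have hr2 : ‖(s : ℂ) - ζ‖ = r := by
        rw [← sq_eq_sq₀ (norm_nonneg _) hr, hnorm, ← hsq]
        have : ∀ i, x i + s * w i = r * u i := fun i => by simpa using congrFun e i
        simp only [this, mul_pow, ← Finset.mul_sum, hu', mul_one]
      have := beval_smul_smul hf r 1 u y
      rw [one_smul, one_pow, mul_one] at this
      rw [e, this, hr2, abs_mul, abs_pow, abs_of_nonneg hr]
      exact mul_le_of_le_one_right (by positivity) (h u hu y hy)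
    have key := norm_eval_derivative_le_of_forall_real (N := d₁) hd
      (P := (lineRestrict x w y f).map (algebraMap ℝ ℂ)) (ζ := ζ)
      ((Polynomial.natDegree_map_le).trans (natDegree_lineRestrict_le hf x w y))
      (by simpa [hζ] using hs) (fun s => by
        have := hbound s
        rw [← eval_lineRestrict] at this
        rw [Polynomial.eval_map_algebraMap, ← Complex.coe_algebraMap,
          Polynomial.aeval_algebraMap_apply, Polynomial.coe_aeval_eq_eval, Complex.coe_algebraMap,
          Complex.norm_real]
        exact this) 0
    have h1 : ‖((0 : ℝ) : ℂ) - ζ‖ = 1 := by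
      rw [← sq_eq_sq₀ (norm_nonneg _) zero_le_one, hnorm]; ring
    rw [h1, one_pow, mul_one, Polynomial.derivative_map, Polynomial.eval_map_algebraMap,
      ← Complex.coe_algebraMap, Polynomial.aeval_algebraMap_apply, Polynomial.coe_aeval_eq_eval,
      Complex.coe_algebraMap, Complex.norm_real, derivative_lineRestrict,
      Polynomial.eval_finsetSum] at key
    simp only [Polynomial.eval_mul, Polynomial.eval_C, eval_lineRestrict, zero_smul, add_zero]
      at key
    change ‖∑ i, w i * v i‖ ≤ _ at key
    rw [hwv] at key
    exact (le_abs_self V).trans key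
  · have h0 : ∑ i, (x i + (-c) * w i) ^ 2 = 0 := by rw [hsq]; linarith
    rw [Finset.sum_eq_zero_iff_of_nonneg fun _ _ => sq_nonneg _] at h0
    have hxw : ∀ i, x i = c * w i := fun i => by
      have := pow_eq_zero_iff (two_ne_zero) |>.1 (h0 i (Finset.mem_univ i))
      linarith
    have hE := sum_mul_beval_pderiv hf x y
    change ∑ i, x i * v i = _ at hE
    simp only [hxw, mul_assoc, ← Finset.mul_sum, hwv] at hE
    have e : V = d₁ * (c * beval f x y) := by
      have e1 : c * (c * V) = V := by rw [← mul_assoc, ← pow_two, heq, one_mul]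
      rw [← e1, hE]; ring
    rw [e]
    refine mul_le_of_le_one_right (by positivity) ((le_abs_self _).trans ?_)
    rw [abs_mul]
    have hc' : |c| ≤ 1 := (sq_le_one_iff_abs_le_one c).1 hc1
    exact mul_le_one₀ hc' (abs_nonneg _) (h x hx y hy)

end BiformCalculus

section SphericalDivergence
open BiformPaper Set Filter Topology

variable {n m : ℕ}

open scoped Matrix.Norms.Operator in
theorem exists_rotation_curve (A : Matrix (Fin n) (Fin n) ℝ) (hA : A.transpose = -A) :
    ∃ Q : ℝ → Matrix (Fin n) (Fin n) ℝ, Q 0 = 1 ∧ (∀ t, Q t * (Q t).transpose = 1) ∧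
      ∀ t x i, HasDerivAt (fun s => (Q s).mulVec x i) (A.mulVec ((Q t).mulVec x) i) t := by
  refine ⟨fun t => NormedSpace.exp (t • A), by simp, fun t => ?_, fun t x i => ?_⟩
  · rw [← Matrix.exp_transpose, Matrix.transpose_smul, hA, ← Matrix.exp_add_of_commute]
    · simp
    · simp
  · have h := hasDerivAt_exp_smul_const' A t
    have h2 : HasDerivAt (fun s => (NormedSpace.exp (s • A)).mulVec x)
        ((A * NormedSpace.exp (t • A)).mulVec x) t := by
      let L : Matrix (Fin n) (Fin n) ℝ →ₗ[ℝ] (Fin n → ℝ) :=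
        { toFun := fun M => M.mulVec x
          map_add' := fun M N => Matrix.add_mulVec M N x
          map_smul' := fun c M => Matrix.smul_mulVec c M x }
      exact (LinearMap.toContinuousLinearMap L).hasFDerivAt.comp_hasDerivAt t h
    rw [Matrix.mulVec_mulVec]
    exact (hasDerivAt_pi.1 h2) i

/-- The derivative of a polynomial along the linear vector field `x ↦ A x`. -/
def fieldDeriv (A : Matrix (Fin n) (Fin n) ℝ) (h : MvPolynomial (Fin n ⊕ Fin m) ℝ) :
    MvPolynomial (Fin n ⊕ Fin m) ℝ :=
  ∑ i, (∑ j, C (A i j) * X (Sum.inl j)) * pderiv (Sum.inl i) h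

theorem beval_fieldDeriv (A : Matrix (Fin n) (Fin n) ℝ) (h : MvPolynomial (Fin n ⊕ Fin m) ℝ)
    (x : Fin n → ℝ) (y : Fin m → ℝ) :
    beval (fieldDeriv A h) x y = ∑ i, A.mulVec x i * beval (pderiv (Sum.inl i) h) x y := by
  simp [beval, fieldDeriv, Matrix.mulVec, dotProduct]

theorem hasDerivAt_beval_curve {A : Matrix (Fin n) (Fin n) ℝ} {c : ℝ → Fin n → ℝ} {t : ℝ}
    (hc : ∀ i, HasDerivAt (fun s => c s i) (A.mulVec (c t) i) t)
    (h : MvPolynomial (Fin n ⊕ Fin m) ℝ) (y : Fin m → ℝ) :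
    HasDerivAt (fun s => beval h (c s) y) (beval (fieldDeriv A h) (c t) y) t := by
  rw [beval_fieldDeriv]
  induction h using MvPolynomial.induction_on with
  | C a => simpa [beval] using hasDerivAt_const t a
  | add f g hf hg =>
    convert! hf.add hg using 1
    · ext s; simp [beval]
    · simp [beval, mul_add, Finset.sum_add_distrib]
  | mul_X f k hf =>
    rcases k with k | k
    · convert! hf.mul (hc k) using 1
      · ext s; simp [beval]
      · rw [Finset.sum_mul, add_comm]
        have : ∀ i, A.mulVec (c t) i * beval (pderiv (Sum.inl i) (f * X (Sum.inl k))) (c t) y =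
            A.mulVec (c t) i * beval f (c t) y * (if i = k then 1 else 0) +
            A.mulVec (c t) i * beval (pderiv (Sum.inl i) f) (c t) y * c t k := fun i => by
          simp only [beval, Derivation.leibniz, smul_eq_mul, map_add, map_mul, eval_X,
            Sum.elim_inl, pderiv_X, Pi.single_apply]
          by_cases hik : i = k
          · subst hik; simp; ring
          · simp [hik, Ne.symm hik]; ring
        simp only [this, Finset.sum_add_distrib]
        congr 1
        simp [mul_comm]
    · convert! hf.mul_const (y k) using 1
      · ext s; simp [beval]
      · rw [Finset.sum_mul]
        refine Finset.sum_congr rfl fun i _ => ?_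
        simp [beval]; ring

variable {σ₁ : Measure (Fin n → ℝ)} {σ₂ : Measure (Fin m → ℝ)}

theorem mulVec_mem_unitSphere {Q : Matrix (Fin n) (Fin n) ℝ} (hQ : Q * Q.transpose = 1)
    {x : Fin n → ℝ} (hx : x ∈ unitSphere n) : Q.mulVec x ∈ unitSphere n :=
  (sum_sq_mulVec hQ x).trans hx

theorem bavg_fieldDeriv (hσ₁ : IsSphereMeasure n σ₁) (hσ₂ : IsSphereMeasure m σ₂)
    {A : Matrix (Fin n) (Fin n) ℝ} (hA : A.transpose = -A)
    (h : MvPolynomial (Fin n ⊕ Fin m) ℝ) : bavg σ₁ σ₂ (fieldDeriv A h) = 0 := by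
  have := hσ₁.prob; have := hσ₂.prob
  rw [bavg_eq hσ₁ hσ₂]
  obtain ⟨Q, hQ0, hQ, hQd⟩ := exists_rotation_curve A hA
  obtain ⟨M, hM⟩ := (isCompact_sphereProd n m).exists_bound_of_continuousOn
    (continuous_beval (fieldDeriv A h)).continuousOn
  have hcont : ∀ (g : MvPolynomial (Fin n ⊕ Fin m) ℝ) t, Continuous
      fun p : (Fin n → ℝ) × (Fin m → ℝ) => beval g ((Q t).mulVec p.1) p.2 := fun g t => by
    have h1 : Continuous fun p : (Fin n → ℝ) × (Fin m → ℝ) => ((Q t).mulVec p.1, p.2) :=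
      Continuous.prodMk (Continuous.matrix_mulVec continuous_const continuous_fst) continuous_snd
    have h2 := (continuous_beval g).comp h1
    exact h2
  have hder : HasDerivAt (fun t => ∫ p, beval h ((Q t).mulVec p.1) p.2 ∂σ₁.prod σ₂)
      (∫ p, beval (fieldDeriv A h) ((Q 0).mulVec p.1) p.2 ∂σ₁.prod σ₂) 0 := by
    refine (hasDerivAt_integral_of_dominated_loc_of_deriv_le
      (F' := fun t p => beval (fieldDeriv A h) ((Q t).mulVec p.1) p.2)
      (bound := fun _ => M) (s := univ) univ_mem
      (Eventually.of_forall fun t => (hcont h t).aestronglyMeasurable)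
      (hσ₁.integrable_prod hσ₂ (hcont h 0))
      (hcont (fieldDeriv A h) 0).aestronglyMeasurable ?_ (integrable_const _) ?_).2
    · filter_upwards [hσ₁.ae_mem_prod hσ₂] with p hp t _
      exact hM (_, _) ⟨mulVec_mem_unitSphere (hQ t) hp.1, hp.2⟩
    · exact Eventually.of_forall fun p t _ => hasDerivAt_beval_curve (hQd t p.1) h p.2
  have hconst : (fun t => ∫ p, beval h ((Q t).mulVec p.1) p.2 ∂σ₁.prod σ₂) =
      fun _ => ∫ p, beval h p.1 p.2 ∂σ₁.prod σ₂ := by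
    ext t
    have e := hσ₁.integral_comp_mulVec hσ₂ (hQ t) (Q₂ := 1) (by simp) (continuous_beval h)
    simpa only [Matrix.one_mulVec] using e
  rw [hconst] at hder
  have h3 := hder.unique (hasDerivAt_const 0 _)
  simpa only [hQ0, Matrix.one_mulVec] using h3

theorem bavg_add (hσ₁ : IsSphereMeasure n σ₁) (hσ₂ : IsSphereMeasure m σ₂)
    (f g : MvPolynomial (Fin n ⊕ Fin m) ℝ) :
    bavg σ₁ σ₂ (f + g) = bavg σ₁ σ₂ f + bavg σ₁ σ₂ g := by
  simp only [bavg_eq hσ₁ hσ₂]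
  rw [← integral_add (hσ₁.integrable_prod hσ₂ (continuous_beval f))
    (hσ₁.integrable_prod hσ₂ (continuous_beval g))]
  simp [beval]

theorem bavg_C_mul (hσ₁ : IsSphereMeasure n σ₁) (hσ₂ : IsSphereMeasure m σ₂)
    (c : ℝ) (f : MvPolynomial (Fin n ⊕ Fin m) ℝ) :
    bavg σ₁ σ₂ (C c * f) = c * bavg σ₁ σ₂ f := by
  simp only [bavg_eq hσ₁ hσ₂]
  rw [← integral_const_mul]
  simp [beval]

/-- The average over the product of spheres, as a linear functional. -/
def bavgₗ (hσ₁ : IsSphereMeasure n σ₁) (hσ₂ : IsSphereMeasure m σ₂) :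
    MvPolynomial (Fin n ⊕ Fin m) ℝ →ₗ[ℝ] ℝ where
  toFun := bavg σ₁ σ₂
  map_add' := bavg_add hσ₁ hσ₂
  map_smul' c f := by rw [smul_eq_C_mul, bavg_C_mul hσ₁ hσ₂]; rfl

theorem bavg_sum (hσ₁ : IsSphereMeasure n σ₁) (hσ₂ : IsSphereMeasure m σ₂) {ι : Type*}
    (s : Finset ι) (f : ι → MvPolynomial (Fin n ⊕ Fin m) ℝ) :
    bavg σ₁ σ₂ (∑ i ∈ s, f i) = ∑ i ∈ s, bavg σ₁ σ₂ (f i) :=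
  map_sum (bavgₗ hσ₁ hσ₂) f s

theorem bavg_congr (hσ₁ : IsSphereMeasure n σ₁) (hσ₂ : IsSphereMeasure m σ₂)
    {f g : MvPolynomial (Fin n ⊕ Fin m) ℝ}
    (h : ∀ x ∈ unitSphere n, ∀ y ∈ unitSphere m, beval f x y = beval g x y) :
    bavg σ₁ σ₂ f = bavg σ₁ σ₂ g := by
  simp only [bavg_eq hσ₁ hσ₂]
  refine integral_congr_ae ?_
  filter_upwards [hσ₁.ae_mem_prod hσ₂] with p hp using h _ hp.1 _ hp.2

theorem bip_eq_bavg_mul (f g : MvPolynomial (Fin n ⊕ Fin m) ℝ) :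
    bip σ₁ σ₂ f g = bavg σ₁ σ₂ (f * g) := by
  simp [bip, bavg, beval]

theorem bavg_pderiv (hσ₁ : IsSphereMeasure n σ₁) (hσ₂ : IsSphereMeasure m σ₂) {d₁ d₂ : ℕ}
    {h : MvPolynomial (Fin n ⊕ Fin m) ℝ} (hh : h ∈ Biform n m d₁ d₂) (i : Fin n) :
    bavg σ₁ σ₂ (pderiv (Sum.inl i) h) =
      ((n : ℝ) + d₁ - 1) * bavg σ₁ σ₂ (X (Sum.inl i) * h) := by
  have key : ∀ j : Fin n, bavg σ₁ σ₂ (X (Sum.inl i) * pderiv (Sum.inl j) (X (Sum.inl j) * h) -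
      X (Sum.inl j) * pderiv (Sum.inl i) (X (Sum.inl j) * h)) = 0 := fun j => by
    rw [← bavg_fieldDeriv hσ₁ hσ₂ (A := Matrix.single j i 1 - Matrix.single i j 1) (by simp)
      (X (Sum.inl j) * h)]
    refine bavg_congr hσ₁ hσ₂ fun x _ y _ => ?_
    rw [beval_fieldDeriv]
    simp only [Matrix.sub_mulVec, Matrix.single_mulVec, Pi.sub_apply, sub_mul,
      Finset.sum_sub_distrib, Function.update_apply]
    simp [beval]
  have hsum := Finset.sum_congr (rfl : (Finset.univ : Finset (Fin n)) = Finset.univ)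
    fun j _ => key j
  rw [← bavg_sum hσ₁ hσ₂, Finset.sum_const_zero] at hsum
  have e : ∑ j : Fin n, (X (Sum.inl i) * pderiv (Sum.inl j) (X (Sum.inl j) * h) -
      X (Sum.inl j) * pderiv (Sum.inl i) (X (Sum.inl j) * h)) =
      C ((n : ℝ) + d₁ - 1) * (X (Sum.inl i) * h) +
        C (-1) * ((∑ j : Fin n, X (Sum.inl j) ^ 2) * pderiv (Sum.inl i) h) := by
    have a1 : ∀ j : Fin n, X (Sum.inl i) * pderiv (Sum.inl j) (X (Sum.inl j) * h) -
      X (Sum.inl j) * pderiv (Sum.inl i) (X (Sum.inl j) * h) =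
      X (Sum.inl i) * h + X (Sum.inl i) * (X (Sum.inl j) * pderiv (Sum.inl j) h) -
      (if j = i then X (Sum.inl i) * h else 0) -
        X (Sum.inl j) ^ 2 * pderiv (Sum.inl i) h := fun j => by
      by_cases hij : j = i
      · subst hij; simp; ring
      · simp [hij, pderiv_X_of_ne (R := ℝ)
          (show (Sum.inl j : Fin n ⊕ Fin m) ≠ Sum.inl i from fun h => hij (Sum.inl.inj h))]
        ring
    simp only [a1, Finset.sum_add_distrib, Finset.sum_sub_distrib, ← Finset.mul_sum,
      sum_X_mul_pderiv_inl hh, ← Finset.sum_mul]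
    simp
    ring
  rw [e, bavg_add hσ₁ hσ₂, bavg_C_mul hσ₁ hσ₂, bavg_C_mul hσ₁ hσ₂] at hsum
  have e2 : bavg σ₁ σ₂ ((∑ j : Fin n, X (Sum.inl j) ^ 2) * pderiv (Sum.inl i) h) =
      bavg σ₁ σ₂ (pderiv (Sum.inl i) h) := bavg_congr hσ₁ hσ₂ fun x hx y _ => by
    have hx' : ∑ j, x j ^ 2 = 1 := hx
    simp [beval, hx']
  rw [e2] at hsum
  linarith

/-- The Laplacian in the variables `x`. -/
def laplaceX : MvPolynomial (Fin n ⊕ Fin m) ℝ →ₗ[ℝ] MvPolynomial (Fin n ⊕ Fin m) ℝ :=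
  ∑ i : Fin n, (pderiv (Sum.inl i)).toLinearMap ∘ₗ (pderiv (Sum.inl i)).toLinearMap

theorem laplaceX_apply (f : MvPolynomial (Fin n ⊕ Fin m) ℝ) :
    laplaceX f = ∑ i : Fin n, pderiv (Sum.inl i) (pderiv (Sum.inl i) f) := by
  simp [laplaceX]

theorem bavg_laplaceX (hσ₁ : IsSphereMeasure n σ₁) (hσ₂ : IsSphereMeasure m σ₂) {d₁ d₂ : ℕ}
    {f : MvPolynomial (Fin n ⊕ Fin m) ℝ} (hf : f ∈ Biform n m (d₁ + 1) d₂) :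
    bavg σ₁ σ₂ (laplaceX f) = ((n : ℝ) + d₁ - 1) * ((d₁ + 1 : ℝ) * bavg σ₁ σ₂ f) := by
  rw [laplaceX_apply, bavg_sum hσ₁ hσ₂]
  simp only [bavg_pderiv hσ₁ hσ₂ (pderiv_mem_biform hf _)]
  rw [← Finset.mul_sum, ← bavg_sum hσ₁ hσ₂, sum_X_mul_pderiv_inl hf, bavg_C_mul hσ₁ hσ₂]
  push_cast; ring

/-- The Green formula for biforms on the product of spheres. -/
theorem sum_bip_pderiv (hσ₁ : IsSphereMeasure n σ₁) (hσ₂ : IsSphereMeasure m σ₂) {d₁ d₂ : ℕ}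
    {f g : MvPolynomial (Fin n ⊕ Fin m) ℝ} (hf : f ∈ Biform n m (d₁ + 1) d₂)
    (hg : g ∈ Biform n m (d₁ + 1) d₂) :
    ∑ i : Fin n, bip σ₁ σ₂ (pderiv (Sum.inl i) f) (pderiv (Sum.inl i) g) =
      ((d₁ : ℝ) + 1) * (n + 2 * d₁) * bip σ₁ σ₂ f g - bip σ₁ σ₂ (laplaceX f) g := by
  have h1 : ∀ i : Fin n, bavg σ₁ σ₂ (pderiv (Sum.inl i) (g * pderiv (Sum.inl i) f)) =
      ((n : ℝ) + 2 * d₁) * bavg σ₁ σ₂ (X (Sum.inl i) * (g * pderiv (Sum.inl i) f)) := fun i => by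
    rw [bavg_pderiv hσ₁ hσ₂ (mul_mem_biform hg (pderiv_mem_biform hf i))]
    push_cast; ring
  have h2 := Finset.sum_congr (rfl : (Finset.univ : Finset (Fin n)) = Finset.univ)
    fun i _ => h1 i
  rw [← Finset.mul_sum, ← bavg_sum hσ₁ hσ₂, ← bavg_sum hσ₁ hσ₂] at h2
  have e1 : ∑ i : Fin n, X (Sum.inl i) * (g * pderiv (Sum.inl i) f) =
      C ((d₁ : ℝ) + 1) * (f * g) := by
    have := sum_X_mul_pderiv_inl hf
    push_cast at this
    rw [← mul_assoc, ← this, Finset.sum_mul]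
    exact Finset.sum_congr rfl fun i _ => by ring
  have e2 : ∑ i : Fin n, pderiv (Sum.inl i) (g * pderiv (Sum.inl i) f) =
      (∑ i : Fin n, pderiv (Sum.inl i) f * pderiv (Sum.inl i) g) + laplaceX f * g := by
    simp only [Derivation.leibniz, smul_eq_mul, laplaceX_apply, Finset.sum_add_distrib,
      Finset.sum_mul]
    rw [add_comm]
    congr 1
    exact Finset.sum_congr rfl fun i _ => by ring
  rw [e1, e2, bavg_add hσ₁ hσ₂, bavg_C_mul hσ₁ hσ₂, bavg_sum hσ₁ hσ₂] at h2
  simp only [bip_eq_bavg_mul]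
  linarith

end SphericalDivergence

section SpectralGap
open BiformPaper Set Filter Topology

variable {n m : ℕ}

/-- The squared norm `x₁² + ⋯ + xₙ²` as a polynomial. -/
def normSqX (n m : ℕ) : MvPolynomial (Fin n ⊕ Fin m) ℝ := ∑ i : Fin n, X (Sum.inl i) ^ 2

theorem normSqX_mem_biform : normSqX n m ∈ Biform n m 2 0 :=
  sum_mem_biform fun i _ => by
    rw [pow_two]; exact mul_mem_biform (X_inl_mem_biform i) (X_inl_mem_biform i)

theorem beval_normSqX {x : Fin n → ℝ} (hx : x ∈ unitSphere n) (y : Fin m → ℝ) :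
    beval (normSqX n m) x y = 1 := by
  have hx' : ∑ i, x i ^ 2 = 1 := hx
  simp [beval, normSqX, hx']

theorem normSqX_ne_zero (hn : 0 < n) : normSqX n m ≠ 0 := fun h => by
  obtain ⟨x, hx⟩ := nonempty_unitSphere hn
  have := beval_normSqX hx (0 : Fin m → ℝ)
  rw [h] at this
  simp [beval] at this

theorem laplaceX_mem_biform {d₁ d₂ : ℕ} {f : MvPolynomial (Fin n ⊕ Fin m) ℝ}
    (hf : f ∈ Biform n m (d₁ + 2) d₂) : laplaceX f ∈ Biform n m d₁ d₂ := by
  rw [laplaceX_apply]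
  exact sum_mem_biform fun i _ => pderiv_mem_biform (pderiv_mem_biform hf i) i

theorem pderiv_normSqX (i : Fin n) :
    pderiv (Sum.inl i) (normSqX n m) = C 2 * X (Sum.inl i) := by
  rw [normSqX, map_sum, Finset.sum_eq_single i]
  · simp only [Derivation.leibniz_pow, pderiv_X_self, smul_eq_mul, nsmul_eq_mul]
    simp [map_ofNat]
  · intro j _ hj
    simp [pderiv_X_of_ne (R := ℝ)
      (show (Sum.inl j : Fin n ⊕ Fin m) ≠ Sum.inl i from fun h => hj (Sum.inl.inj h))]
  · simp

theorem laplaceX_normSqX_mul {d₁ d₂ : ℕ} {g : MvPolynomial (Fin n ⊕ Fin m) ℝ}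
    (hg : g ∈ Biform n m d₁ d₂) :
    laplaceX (normSqX n m * g) =
      normSqX n m * laplaceX g + C (4 * (d₁ : ℝ) + 2 * n) * g := by
  have h1 : ∀ i : Fin n, pderiv (Sum.inl i) (pderiv (Sum.inl i) (normSqX n m * g)) =
      C 2 * g + C 4 * (X (Sum.inl i) * pderiv (Sum.inl i) g) +
        normSqX n m * pderiv (Sum.inl i) (pderiv (Sum.inl i) g) := fun i => by
    have h4 : (C 4 : MvPolynomial (Fin n ⊕ Fin m) ℝ) = C 2 + C 2 := by
      rw [← C_add]; norm_num
    simp only [Derivation.leibniz, map_add, smul_eq_mul, pderiv_normSqX, pderiv_C, pderiv_X_self,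
      h4]
    ring
  simp only [laplaceX_apply, h1, Finset.sum_add_distrib, ← Finset.mul_sum,
    sum_X_mul_pderiv_inl hg]
  simp only [Finset.sum_const, Finset.card_univ, Fintype.card_fin, nsmul_eq_mul, C_add, C_mul,
    map_natCast]
  ring

theorem spectral_gap (hn : 0 < n) {e : ℕ} (k : ℕ) :
    ∀ (f : MvPolynomial (Fin n ⊕ Fin m) ℝ) (ν : ℝ), f ∈ Biform n m (2 * k) e →
      normSqX n m * laplaceX f = C (2 * (k : ℝ) * (2 * k + n - 2) - ν) * f →
      f = 0 ∨ 2 * (n : ℝ) ≤ ν ∨ ∃ h ∈ Biform n m 0 e, f = normSqX n m ^ k * h := by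
  induction k with
  | zero => exact fun f ν hf _ => Or.inr (Or.inr ⟨f, hf, by simp⟩)
  | succ k ih =>
    intro f ν hf h
    set c : ℝ := 2 * ((k + 1 : ℕ) : ℝ) * (2 * ((k + 1 : ℕ) : ℝ) + n - 2) - ν with hc
    by_cases hc0 : c = 0
    · right; left
      have : ν = 2 * ((k : ℝ) + 1) * (2 * k + n) := by
        rw [hc] at hc0; push_cast at hc0; linarith
      rw [this]
      have hk : (0 : ℝ) ≤ k := Nat.cast_nonneg k
      have hn' : (0 : ℝ) ≤ n := Nat.cast_nonneg n
      nlinarith [mul_nonneg hk hn']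
    · set g := C c⁻¹ * laplaceX f with hg
      have hfg : f = normSqX n m * g := by
        rw [hg, mul_left_comm, h, ← mul_assoc, ← C_mul, inv_mul_cancel₀ hc0, C_1, one_mul]
      have hgm : g ∈ Biform n m (2 * k) e := by
        have := IsWeightedHomogeneous.mul (isWeightedHomogeneous_C (bw n m) c⁻¹)
          (laplaceX_mem_biform (d₁ := 2 * k) hf)
        rwa [zero_add] at this
      have h2 : laplaceX (normSqX n m * g) = C c * g := by
        refine mul_left_cancel₀ (normSqX_ne_zero (m := m) hn) ?_
        rw [← hfg, h, mul_left_comm, ← hfg]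
      rw [laplaceX_normSqX_mul hgm] at h2
      have h3 : normSqX n m * laplaceX g = C (2 * (k : ℝ) * (2 * k + n - 2) - ν) * g := by
        rw [eq_sub_of_add_eq h2, ← sub_mul, ← C_sub, hc]
        congr 2
        push_cast; ring
      rcases ih g ν hgm h3 with h0 | h0 | ⟨h, hh, e⟩
      · left; rw [hfg, h0, mul_zero]
      · exact Or.inr (Or.inl h0)
      · exact Or.inr (Or.inr ⟨h, hh, by rw [hfg, e, pow_succ]; ring⟩)

variable {σ₁ : Measure (Fin n → ℝ)} {σ₂ : Measure (Fin m → ℝ)}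

theorem bip_self_le_gradient (hσ₁ : IsSphereMeasure n σ₁) (hσ₂ : IsSphereMeasure m σ₂)
    {d₁ d₂ : ℕ} {f : MvPolynomial (Fin n ⊕ Fin m) ℝ} (hf : f ∈ Biform n m d₁ d₂) :
    (d₁ : ℝ) ^ 2 * bip σ₁ σ₂ f f ≤
      ∑ i : Fin n, bip σ₁ σ₂ (pderiv (Sum.inl i) f) (pderiv (Sum.inl i) f) := by
  simp only [bip_eq hσ₁ hσ₂]
  rw [← integral_finsetSum _ fun i _ => hσ₁.integrable_prod hσ₂
    ((continuous_beval _).fun_mul (continuous_beval _)), ← integral_const_mul]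
  refine integral_mono_ae (hσ₁.integrable_prod hσ₂
    (continuous_const.fun_mul ((continuous_beval _).fun_mul (continuous_beval _))))
    (hσ₁.integrable_prod hσ₂ (continuous_finsetSum _ fun i _ =>
    ((continuous_beval _).fun_mul (continuous_beval _)))) ?_
  filter_upwards [hσ₁.ae_mem_prod hσ₂] with p hp
  have h := sum_mul_beval_pderiv hf p.1 p.2
  have hx : ∑ i, p.1 i ^ 2 = 1 := hp.1
  have hcs := Finset.sum_mul_sq_le_sq_mul_sq Finset.univ p.1
    (fun i => beval (pderiv (Sum.inl i) f) p.1 p.2)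
  rw [h, hx, one_mul] at hcs
  calc (d₁ : ℝ) ^ 2 * (beval f p.1 p.2 * beval f p.1 p.2) = (d₁ * beval f p.1 p.2) ^ 2 := by ring
    _ ≤ _ := hcs
    _ = _ := Finset.sum_congr rfl fun i _ => pow_two _

theorem eigenform_eq (hn : 0 < n) (hm : 0 < m) {k₁ k₂ : ℕ} (hk₁ : 0 < k₁)
    (hσ₁ : IsSphereMeasure n σ₁)
    (hσ₂ : IsSphereMeasure m σ₂) {f : MvPolynomial (Fin n ⊕ Fin m) ℝ} {γ : ℝ}
    (hf : f ∈ MSet n m k₁ k₂ σ₁ σ₂)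
    (h : ∀ g ∈ MSet n m k₁ k₂ σ₁ σ₂, ∑ i : Fin n,
      bip σ₁ σ₂ (pderiv (Sum.inl i) f) (pderiv (Sum.inl i) g) =
        (2 * (k₁ : ℝ)) ^ 2 * γ * bip σ₁ σ₂ f g)
    (hf0 : f ≠ 0) (hγ : γ < 1 + n / (2 * (k₁ : ℝ) ^ 2)) :
    ∃ h ∈ Biform n m 0 (2 * k₂), f = normSqX n m ^ k₁ * h := by
  obtain ⟨k, rfl⟩ : ∃ k, k₁ = k + 1 := ⟨k₁ - 1, by omega⟩
  set ν : ℝ := (2 * ((k + 1 : ℕ) : ℝ)) ^ 2 * γ - (2 * ((k + 1 : ℕ) : ℝ)) ^ 2 with hν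
  set c : ℝ := 2 * ((k + 1 : ℕ) : ℝ) * (2 * ((k + 1 : ℕ) : ℝ) + n - 2) - ν with hc
  have hfB : f ∈ Biform n m (2 * k + 1 + 1) (2 * k₂) := hf.1
  set w := normSqX n m * laplaceX f + C (-c) * f with hw
  have hwB : w ∈ Biform n m (2 * (k + 1)) (2 * k₂) := by
    have h1 := mul_mem_biform (normSqX_mem_biform (n := n) (m := m))
      (laplaceX_mem_biform (d₁ := 2 * k) hfB)
    rw [zero_add, show 2 + 2 * k = 2 * (k + 1) by ring] at h1
    have h2 := IsWeightedHomogeneous.mul (isWeightedHomogeneous_C (bw n m) (-c)) hf.1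
    rw [zero_add] at h2
    exact IsWeightedHomogeneous.add h1 h2
  have hR : ∀ p : MvPolynomial (Fin n ⊕ Fin m) ℝ,
      bavg σ₁ σ₂ (normSqX n m * p) = bavg σ₁ σ₂ p := fun p =>
    bavg_congr hσ₁ hσ₂ fun x hx y _ => by
      have := beval_normSqX hx y
      simp only [beval, map_mul] at *
      rw [this, one_mul]
  have hwM : w ∈ MSet n m (k + 1) k₂ σ₁ σ₂ := by
    refine ⟨hwB, ?_⟩
    rw [hw, bavg_add hσ₁ hσ₂, bavg_C_mul hσ₁ hσ₂, hR, hf.2, bavg_laplaceX hσ₁ hσ₂ hfB, hf.2]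
    simp
  have hwg : ∀ g ∈ MSet n m (k + 1) k₂ σ₁ σ₂, bip σ₁ σ₂ w g = 0 := fun g hg => by
    have h1 := h g hg
    rw [sum_bip_pderiv hσ₁ hσ₂ hfB (show g ∈ Biform n m (2 * k + 1 + 1) (2 * k₂) from hg.1)] at h1
    rw [bip_eq_bavg_mul, hw, add_mul, mul_assoc, mul_assoc, bavg_add hσ₁ hσ₂, hR,
      bavg_C_mul hσ₁ hσ₂, ← bip_eq_bavg_mul, ← bip_eq_bavg_mul, hc, hν]
    push_cast at h1 ⊢
    linear_combination -h1
  have hw0 : w = 0 := Biform.eq_zero_of_bip_self hn hm hσ₁ hσ₂ hwB (hwg w hwM)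
  have heq : normSqX n m * laplaceX f = C c * f := by
    rw [hw, C_neg] at hw0
    linear_combination hw0
  rcases spectral_gap hn (k + 1) f ν hf.1 heq with h0 | h0 | h0
  · exact absurd h0 hf0
  · exfalso
    have hk : (0 : ℝ) < ((k + 1 : ℕ) : ℝ) := by positivity
    have h4 : (2 * ((k + 1 : ℕ) : ℝ)) ^ 2 * γ <
        (2 * ((k + 1 : ℕ) : ℝ)) ^ 2 * (1 + n / (2 * ((k + 1 : ℕ) : ℝ) ^ 2)) :=
      mul_lt_mul_of_pos_left hγ (by positivity)
    have h5 : (2 * ((k + 1 : ℕ) : ℝ)) ^ 2 * (1 + n / (2 * ((k + 1 : ℕ) : ℝ) ^ 2)) =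
        (2 * ((k + 1 : ℕ) : ℝ)) ^ 2 + 2 * n := by field_simp
    rw [hν] at h0
    linarith
  · exact h0

end SpectralGap

section GradientForm
open BiformPaper Set Filter Topology

theorem exists_orthogonal_eigenbasis {D : ℕ} (B : (Fin D → ℝ) →ₗ[ℝ] (Fin D → ℝ) →ₗ[ℝ] ℝ)
    (hB : ∀ a b, B a b = B b a) :
    ∃ (U : Matrix (Fin D) (Fin D) ℝ) (γ : Fin D → ℝ), U * U.transpose = 1 ∧
      ∀ i b, B (U i) b = γ i * ∑ j, U i j * b j := by
  let A : Matrix (Fin D) (Fin D) ℝ := LinearMap.toMatrix₂' ℝ B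
  have hA : A.IsHermitian := by
    ext i j
    simp only [A, Matrix.conjTranspose_apply, LinearMap.toMatrix₂'_apply, star_trivial]
    exact hB _ _
  have hBA : ∀ a b, B a b = ∑ j, A.mulVec a j * b j := by
    intro a b
    have h : B = Matrix.toLinearMap₂' ℝ A := (Matrix.toLinearMap₂'_toMatrix' B).symm
    rw [hB a b, h, Matrix.toLinearMap₂'_apply']
    simp [dotProduct, mul_comm]
  refine ⟨Matrix.of fun i => (hA.eigenvectorBasis i).ofLp, hA.eigenvalues, ?_, fun i b => ?_⟩
  · ext i j
    have h := orthonormal_iff_ite.1 hA.eigenvectorBasis.orthonormal i j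
    rw [Matrix.mul_apply, Matrix.one_apply, ← h, PiLp.inner_apply]
    simp [mul_comm]
  · rw [hBA]
    change ∑ j, A.mulVec (hA.eigenvectorBasis i).ofLp j * b j = _
    rw [hA.mulVec_eigenvectorBasis, Finset.mul_sum]
    simp [mul_assoc]

/-- A symmetric form whose eigenvalues are at least `1`, and at least `c` outside a set of at most
`s` eigenvectors, dominates the square of a linear map with determinant `c ^ ((D - s) / 2)`. -/
theorem exists_linearMap_sum_sq_le {D : ℕ} {U : Matrix (Fin D) (Fin D) ℝ}
    (hU : U * U.transpose = 1) {B : (Fin D → ℝ) →ₗ[ℝ] (Fin D → ℝ) →ₗ[ℝ] ℝ} {γ : Fin D → ℝ}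
    (hB : ∀ i b, B (U i) b = γ i * ∑ j, U i j * b j) {c : ℝ} (hc : 0 < c) (h1 : ∀ i, 1 ≤ γ i) :
    ∃ T : (Fin D → ℝ) →ₗ[ℝ] (Fin D → ℝ),
      LinearMap.det T ^ 2 = c ^ (D - (Finset.univ.filter fun i => γ i < c).card) ∧
      ∀ a, ∑ i, T a i ^ 2 ≤ B a a := by
  classical
  let w : Fin D → ℝ := fun i => if γ i < c then 1 else c
  have hw : ∀ i, 0 ≤ w i := fun i => by simp only [w]; split_ifs <;> positivity
  refine ⟨Matrix.toLin' (Matrix.diagonal (fun i => Real.sqrt (w i)) * U), ?_, fun a => ?_⟩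
  · have hdU : U.det ^ 2 = 1 := by
      have := congrArg Matrix.det hU
      rwa [Matrix.det_mul, Matrix.det_transpose, Matrix.det_one, ← pow_two] at this
    rw [LinearMap.det_toLin', Matrix.det_mul, mul_pow, hdU, mul_one, Matrix.det_diagonal,
      ← Finset.prod_pow]
    simp only [Real.sq_sqrt (hw _), w]
    rw [Finset.prod_ite, Finset.prod_const_one, one_mul, Finset.prod_const]
    congr 1
    have := Finset.card_filter_add_card_filter_not (s := (Finset.univ : Finset (Fin D)))
      (fun i => γ i < c)
    rw [Finset.card_univ, Fintype.card_fin] at this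
    omega
  · have ha : a = ∑ i, (U.mulVec a i) • U i := by
      have h2 : U.transpose * U = 1 := mul_eq_one_comm.1 hU
      have : a = U.transpose.mulVec (U.mulVec a) := by
        rw [Matrix.mulVec_mulVec, h2, Matrix.one_mulVec]
      conv_lhs => rw [this]
      ext j
      simp [Matrix.mulVec, dotProduct, mul_comm]
    have hBa : B a a = ∑ i, γ i * U.mulVec a i ^ 2 := by
      have h3 : B a a = B (∑ i, U.mulVec a i • U i) a := by rw [← ha]
      rw [h3, map_sum, LinearMap.sum_apply]
      refine Finset.sum_congr rfl fun i _ => ?_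
      rw [map_smul, LinearMap.smul_apply, hB, smul_eq_mul]
      simp only [Matrix.mulVec, dotProduct]
      ring
    rw [hBa]
    refine Finset.sum_le_sum fun i _ => ?_
    rw [Matrix.toLin'_apply, ← Matrix.mulVec_mulVec, Matrix.mulVec_diagonal, mul_pow,
      Real.sq_sqrt (hw i)]
    refine mul_le_mul_of_nonneg_right ?_ (sq_nonneg _)
    simp only [w]
    split_ifs with h
    · exact h1 i
    · exact not_lt.1 h

variable {n m D k₁ k₂ : ℕ} {σ₁ : Measure (Fin n → ℝ)} {σ₂ : Measure (Fin m → ℝ)}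
  {ψ : (Fin D → ℝ) →ₗ[ℝ] MvPolynomial (Fin n ⊕ Fin m) ℝ}

/-- The bilinear form `∫_T ⟨∇ₓ f, ∇ₓ g⟩ dσ` in the coordinates given by `ψ`. -/
def gradientForm (hσ₁ : IsSphereMeasure n σ₁) (hσ₂ : IsSphereMeasure m σ₂)
    (ψ : (Fin D → ℝ) →ₗ[ℝ] MvPolynomial (Fin n ⊕ Fin m) ℝ) :
    (Fin D → ℝ) →ₗ[ℝ] (Fin D → ℝ) →ₗ[ℝ] ℝ :=
  have hadd (a a' b : Fin D → ℝ) : ∑ i : Fin n,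
      bip σ₁ σ₂ (pderiv (Sum.inl i) (ψ (a + a'))) (pderiv (Sum.inl i) (ψ b)) =
      ∑ i : Fin n, bip σ₁ σ₂ (pderiv (Sum.inl i) (ψ a)) (pderiv (Sum.inl i) (ψ b)) +
      ∑ i : Fin n, bip σ₁ σ₂ (pderiv (Sum.inl i) (ψ a')) (pderiv (Sum.inl i) (ψ b)) := by
    simp only [map_add, bip_add_left hσ₁ hσ₂, Finset.sum_add_distrib]
  have hsmul (c : ℝ) (a b : Fin D → ℝ) : ∑ i : Fin n,
      bip σ₁ σ₂ (pderiv (Sum.inl i) (ψ (c • a))) (pderiv (Sum.inl i) (ψ b)) =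
      c • ∑ i : Fin n, bip σ₁ σ₂ (pderiv (Sum.inl i) (ψ a)) (pderiv (Sum.inl i) (ψ b)) := by
    simp only [map_smul, Derivation.map_smul, bip_smul_left hσ₁ hσ₂, Finset.mul_sum, smul_eq_mul]
  have hcomm (a b : Fin D → ℝ) : ∑ i : Fin n,
      bip σ₁ σ₂ (pderiv (Sum.inl i) (ψ a)) (pderiv (Sum.inl i) (ψ b)) =
      ∑ i : Fin n, bip σ₁ σ₂ (pderiv (Sum.inl i) (ψ b)) (pderiv (Sum.inl i) (ψ a)) := by
    simp only [bip_comm]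
  LinearMap.mk₂ ℝ (fun a b => ∑ i : Fin n,
    bip σ₁ σ₂ (pderiv (Sum.inl i) (ψ a)) (pderiv (Sum.inl i) (ψ b))) hadd hsmul
    (fun a b b' => by rw [hcomm, hadd, hcomm b, hcomm b'])
    (fun c a b => by rw [hcomm, hsmul, hcomm b])

theorem gradientForm_apply (hσ₁ : IsSphereMeasure n σ₁) (hσ₂ : IsSphereMeasure m σ₂)
    (a b : Fin D → ℝ) : gradientForm hσ₁ hσ₂ ψ a b = ∑ i : Fin n,
      bip σ₁ σ₂ (pderiv (Sum.inl i) (ψ a)) (pderiv (Sum.inl i) (ψ b)) :=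
  rfl

theorem gradientForm_comm (hσ₁ : IsSphereMeasure n σ₁) (hσ₂ : IsSphereMeasure m σ₂)
    (a b : Fin D → ℝ) : gradientForm hσ₁ hσ₂ ψ a b = gradientForm hσ₁ hσ₂ ψ b a := by
  simp only [gradientForm_apply, bip_comm]

theorem card_add_one_le_of_eq_mul (hσ₁ : IsSphereMeasure n σ₁)
    (hσ₂ : IsSphereMeasure m σ₂)
    (hψ : IsUnitaryParam n m D σ₁ σ₂ (MSet n m k₁ k₂ σ₁ σ₂) ψ) {s : Finset (Fin D)}
    {u : Fin D → Fin D → ℝ} (hu : LinearIndependent ℝ u)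
    (h : ∀ i ∈ s, ∃ h ∈ Biform n m 0 (2 * k₂), ψ (u i) = normSqX n m ^ k₁ * h) :
    s.card + 1 ≤ (m + 2 * k₂ - 1).choose (2 * k₂) := by
  have := hσ₁.prob; have := hσ₂.prob
  obtain ⟨hfin, hrank⟩ := finite_finrank_biformSubmodule_le n m 0 (2 * k₂)
  rw [Nat.choose_zero_right, one_mul] at hrank
  let W : Submodule ℝ (MvPolynomial (Fin n ⊕ Fin m) ℝ) :=
    (biformSubmodule n m 0 (2 * k₂)).map (LinearMap.mulLeft ℝ (normSqX n m ^ k₁))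
  have hq : qpoly n m k₁ k₂ ∈ W := by
    refine ⟨(∑ j : Fin m, X (Sum.inr j) ^ 2) ^ k₂, ?_, rfl⟩
    change IsWeightedHomogeneous _ _ _
    have h' : ((0, 2 * k₂) : ℕ × ℕ) = k₂ • (0, 2) := by ext <;> simp [mul_comm]
    rw [h']
    refine IsWeightedHomogeneous.pow (IsWeightedHomogeneous.sum _ _ _ fun j _ => ?_) _
    have h2 : ((0, 2) : ℕ × ℕ) = 2 • bw n m (Sum.inr j) := by simp [bw]
    rw [h2]
    exact (isWeightedHomogeneous_X ℝ _ _).pow 2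
  have hli : LinearIndependent ℝ fun o : Option s =>
      o.elim (qpoly n m k₁ k₂) fun i => ψ (u i) := by
    rw [linearIndependent_option]
    refine ⟨(hu.map' ψ (LinearMap.ker_eq_bot.2 hψ.inj)).comp _ Subtype.val_injective, fun hmem => ?_⟩
    have hle : Submodule.span ℝ (range ((fun o : Option s =>
        o.elim (qpoly n m k₁ k₂) fun i => ψ (u i)) ∘ some)) ≤
        LinearMap.ker (bavgₗ hσ₁ hσ₂) := by
      rw [Submodule.span_le]
      rintro _ ⟨i, rfl⟩
      exact (hψ.mem _).2
    have h0 : bavg σ₁ σ₂ (qpoly n m k₁ k₂) = 0 := hle hmem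
    have h1 : bavg σ₁ σ₂ (qpoly n m k₁ k₂) = bavg σ₁ σ₂ (1 : MvPolynomial (Fin n ⊕ Fin m) ℝ) :=
      bavg_congr hσ₁ hσ₂ fun x hx y hy => by rw [beval_qpoly hx hy]; simp [beval]
    rw [h0] at h1
    simp [bavg, beval] at h1
  let f : Option s → W := fun o => ⟨o.elim (qpoly n m k₁ k₂) fun i => ψ (u i), by
    rcases o with _ | i
    · exact hq
    · obtain ⟨g, hg, e⟩ := h i.1 i.2
      exact ⟨g, hg, e.symm⟩⟩
  have hf : LinearIndependent ℝ f := LinearIndependent.of_comp W.subtype hli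
  have h3 := hf.fintype_card_le_finrank
  simp only [Fintype.card_option, Fintype.card_coe] at h3
  exact h3.trans ((Submodule.finrank_map_le _ _).trans hrank)

theorem exists_linearMap_sum_sq_le_gradientForm (hn : 0 < n) (hm : 0 < m) (hk₁ : 0 < k₁)
    (hσ₁ : IsSphereMeasure n σ₁) (hσ₂ : IsSphereMeasure m σ₂)
    (hψ : IsUnitaryParam n m D σ₁ σ₂ (MSet n m k₁ k₂ σ₁ σ₂) ψ) :
    ∃ (T : (Fin D → ℝ) →ₗ[ℝ] (Fin D → ℝ)) (s : ℕ),
      s + 1 ≤ (m + 2 * k₂ - 1).choose (2 * k₂) ∧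
      LinearMap.det T ^ 2 = (1 + n / (2 * (k₁ : ℝ) ^ 2)) ^ (D - s) ∧
      ∀ a, ∑ i, T a i ^ 2 ≤ (1 / (2 * (k₁ : ℝ)) ^ 2) * gradientForm hσ₁ hσ₂ ψ a a := by
  obtain ⟨U, γ, hU, hB⟩ := exists_orthogonal_eigenbasis
    ((1 / (2 * (k₁ : ℝ)) ^ 2) • gradientForm hσ₁ hσ₂ ψ) fun a b => by
      simp only [LinearMap.smul_apply, gradientForm_comm hσ₁ hσ₂ a b]
  have hk : (0 : ℝ) < (2 * (k₁ : ℝ)) ^ 2 := by positivity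
  have hB' : ∀ i b, gradientForm hσ₁ hσ₂ ψ (U i) b =
      (2 * (k₁ : ℝ)) ^ 2 * γ i * ∑ j, U i j * b j := by
    intro i b
    rw [mul_assoc, ← hB, LinearMap.smul_apply, LinearMap.smul_apply, smul_eq_mul]
    field_simp
  have hUU : ∀ i, ∑ j, U i j * U i j = 1 := fun i => by
    have := congrFun (congrFun hU i) i
    rwa [Matrix.mul_apply, Matrix.one_apply_eq] at this
  have h1 : ∀ i, 1 ≤ γ i := by
    intro i
    have h2 := bip_self_le_gradient hσ₁ hσ₂ (hψ.mem (U i)).1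
    rw [← gradientForm_apply hσ₁ hσ₂, hB', hψ.ip, hUU] at h2
    push_cast at h2
    nlinarith
  obtain ⟨T, hT, hTB⟩ := exists_linearMap_sum_sq_le hU hB
    (c := 1 + n / (2 * (k₁ : ℝ) ^ 2)) (by positivity) h1
  refine ⟨T, _, ?_, hT, fun a => by simpa using hTB a⟩
  refine card_add_one_le_of_eq_mul hσ₁ hσ₂ hψ (u := U) ?_ fun i hi => ?_
  · exact Matrix.linearIndependent_rows_iff_isUnit.2
      ((Matrix.isUnit_iff_isUnit_det _).2 (Matrix.isUnit_det_of_right_inverse hU))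
  · refine eigenform_eq hn hm hk₁ hσ₁ hσ₂ (hψ.mem (U i)) (γ := γ i) (fun g hg => ?_) ?_
      (Finset.mem_filter.1 hi).2
    · obtain ⟨b, rfl⟩ : g ∈ range ψ := by rwa [hψ.range]
      rw [← gradientForm_apply hσ₁ hσ₂, hB', hψ.ip]
    · intro h0
      have h3 := hUU i
      rw [← hψ.ip, h0] at h3
      simp [bip, beval] at h3

end GradientForm

section Symmetrization
open BiformPaper Set Filter Topology
open scoped Pointwise

variable {n m D k₁ k₂ : ℕ} {σ₁ : Measure (Fin n → ℝ)} {σ₂ : Measure (Fin m → ℝ)}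
  {ψ : (Fin D → ℝ) →ₗ[ℝ] MvPolynomial (Fin n ⊕ Fin m) ℝ}
  {M : Set (MvPolynomial (Fin n ⊕ Fin m) ℝ)}

theorem continuous_beval_param (ψ : (Fin D → ℝ) →ₗ[ℝ] MvPolynomial (Fin n ⊕ Fin m) ℝ)
    (x : Fin n → ℝ) (y : Fin m → ℝ) : Continuous fun a => beval (ψ a) x y := by
  simp only [beval_eq_sum_evalVec]
  fun_prop

theorem convex_preimage_tilde_posSet (hn : 0 < n) (hm : 0 < m)
    (hψ : IsUnitaryParam n m D σ₁ σ₂ (MSet n m k₁ k₂ σ₁ σ₂) ψ) :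
    Convex ℝ (ψ ⁻¹' tilde n m k₁ k₂ σ₁ σ₂ (PosSet n m k₁ k₂)) := by
  intro a ha b hb s t hs ht hst
  rw [mem_preimage_tilde_iff hn hm hψ] at *
  intro x hx y hy
  have e : beval (ψ (s • a + t • b)) x y = s * beval (ψ a) x y + t * beval (ψ b) x y := by
    simp [beval, smul_eval]
  rw [e]
  nlinarith [mul_le_mul_of_nonneg_left (ha x hx y hy) hs,
    mul_le_mul_of_nonneg_left (hb x hx y hy) ht]

theorem sum_sq_le_of_mem_preimage_tilde (hn : 0 < n) (hm : 0 < m) (hσ₁ : IsSphereMeasure n σ₁)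
    (hσ₂ : IsSphereMeasure m σ₂)
    (hψ : IsUnitaryParam n m D σ₁ σ₂ (MSet n m k₁ k₂ σ₁ σ₂) ψ) {a : Fin D → ℝ}
    (ha : a ∈ ψ ⁻¹' tilde n m k₁ k₂ σ₁ σ₂ (PosSet n m k₁ k₂)) : ∑ i, a i ^ 2 ≤ D := by
  have := hσ₁.prob; have := hσ₂.prob
  rw [mem_preimage_tilde_iff hn hm hψ] at ha
  set S := ∑ i, a i ^ 2 with hS
  have hS0 : 0 ≤ S := Finset.sum_nonneg fun i _ => sq_nonneg _
  have hmean : ∫ p, beval (ψ a) p.1 p.2 ∂σ₁.prod σ₂ = 0 := by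
    rw [← bavg_eq hσ₁ hσ₂]; exact (hψ.mem a).2
  have hsq : ∫ p, beval (ψ a) p.1 p.2 * beval (ψ a) p.1 p.2 ∂σ₁.prod σ₂ = S := by
    rw [← bip_eq hσ₁ hσ₂, hψ.bip_self]
  have hi := hσ₁.integrable_prod hσ₂ (continuous_beval (ψ a))
  have hle : ∫ p, beval (ψ a) p.1 p.2 * beval (ψ a) p.1 p.2 ∂σ₁.prod σ₂ ≤
      ∫ p, (Real.sqrt (D * S) + (Real.sqrt (D * S) - 1) * beval (ψ a) p.1 p.2) ∂σ₁.prod σ₂ := by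
    refine integral_mono_ae (hσ₁.integrable_prod hσ₂
      ((continuous_beval _).fun_mul (continuous_beval _)))
      ((integrable_const _).add (hi.const_mul _)) ?_
    filter_upwards [hσ₁.ae_mem_prod hσ₂] with p hp
    have h1 := ha p.1 hp.1 p.2 hp.2
    have h2 := beval_sq_le_mul_bip hσ₁ hσ₂ hψ (isRotationStable_mSet hσ₁ hσ₂ k₁ k₂)
      (hψ.mem a) hp.1 hp.2
    rw [hψ.bip_self] at h2
    have h3 := Real.abs_le_sqrt h2
    nlinarith [mul_le_mul_of_nonneg_right ((le_abs_self _).trans h3)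
      (show 0 ≤ beval (ψ a) p.1 p.2 + 1 by linarith)]
  rw [hsq, integral_add (integrable_const _) (hi.const_mul _), integral_const_mul, hmean] at hle
  simp only [integral_const, probReal_univ, one_smul, mul_zero, add_zero] at hle
  rcases hS0.eq_or_lt with h | h
  · rw [← h]; positivity
  · have := (Real.le_sqrt' h).1 hle
    nlinarith

theorem isCompact_preimage_tilde_posSet (hn : 0 < n) (hm : 0 < m) (hσ₁ : IsSphereMeasure n σ₁)
    (hσ₂ : IsSphereMeasure m σ₂)
    (hψ : IsUnitaryParam n m D σ₁ σ₂ (MSet n m k₁ k₂ σ₁ σ₂) ψ) :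
    IsCompact (ψ ⁻¹' tilde n m k₁ k₂ σ₁ σ₂ (PosSet n m k₁ k₂)) := by
  refine Metric.isCompact_of_isClosed_isBounded ?_ ?_
  · have e : ψ ⁻¹' tilde n m k₁ k₂ σ₁ σ₂ (PosSet n m k₁ k₂) =
        ⋂ x ∈ unitSphere n, ⋂ y ∈ unitSphere m, {a | -1 ≤ beval (ψ a) x y} := by
      ext a
      simp only [mem_preimage_tilde_iff hn hm hψ, mem_iInter, mem_ofPred_eq]
    rw [e]
    exact isClosed_biInter fun x _ => isClosed_biInter fun y _ =>
      isClosed_le continuous_const (continuous_beval_param ψ x y)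
  · refine (Metric.isBounded_closedBall (x := (0 : Fin D → ℝ)) (r := Real.sqrt D)).subset
      fun a ha => ?_
    rw [mem_closedBall_zero_iff, pi_norm_le_iff_of_nonneg (Real.sqrt_nonneg _)]
    exact fun i => Real.abs_le_sqrt ((Finset.single_le_sum (f := fun i => a i ^ 2)
      (fun i _ => sq_nonneg _) (Finset.mem_univ i)).trans
      (sum_sq_le_of_mem_preimage_tilde hn hm hσ₁ hσ₂ hψ ha))

theorem exists_linearMap_eq_rotate (hψ : IsUnitaryParam n m D σ₁ σ₂ M ψ)
    (hM : IsRotationStable M) {Q₁ : Matrix (Fin n) (Fin n) ℝ} {Q₂ : Matrix (Fin m) (Fin m) ℝ}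
    (hQ₁ : Q₁ * Q₁.transpose = 1) (hQ₂ : Q₂ * Q₂.transpose = 1) :
    ∃ L : (Fin D → ℝ) →ₗ[ℝ] (Fin D → ℝ), ∀ a, ψ (L a) = rotate Q₁ Q₂ (ψ a) := by
  have hmem : ∀ a, ((rotate Q₁ Q₂).toLinearMap ∘ₗ ψ) a ∈ LinearMap.range ψ := fun a => by
    have : rotate Q₁ Q₂ (ψ a) ∈ range ψ := by
      rw [hψ.range]; exact hM Q₁ Q₂ hQ₁ hQ₂ _ (hψ.mem a)
    exact this
  refine ⟨(LinearEquiv.ofInjective ψ hψ.inj).symm.toLinearMap ∘ₗ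
    LinearMap.codRestrict _ ((rotate Q₁ Q₂).toLinearMap ∘ₗ ψ) hmem, fun a => ?_⟩
  exact congrArg Subtype.val ((LinearEquiv.ofInjective ψ hψ.inj).apply_symm_apply
    (LinearMap.codRestrict _ ((rotate Q₁ Q₂).toLinearMap ∘ₗ ψ) hmem a))

theorem volume_preimage_tilde_le_two_pow_mul (hn : 0 < n) (hm : 0 < m)
    (hσ₁ : IsSphereMeasure n σ₁) (hσ₂ : IsSphereMeasure m σ₂)
    (hψ : IsUnitaryParam n m D σ₁ σ₂ (MSet n m k₁ k₂ σ₁ σ₂) ψ) :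
    volume (ψ ⁻¹' tilde n m k₁ k₂ σ₁ σ₂ (PosSet n m k₁ k₂)) ≤
      2 ^ D * volume (ψ ⁻¹' tilde n m k₁ k₂ σ₁ σ₂ (PosSet n m k₁ k₂) ∩
        -(ψ ⁻¹' tilde n m k₁ k₂ σ₁ σ₂ (PosSet n m k₁ k₂))) := by
  have := hσ₁.prob; have := hσ₂.prob
  refine volume_le_two_pow_mul_volume_inter_neg
    (isCompact_preimage_tilde_posSet hn hm hσ₁ hσ₂ hψ)
    (convex_preimage_tilde_posSet hn hm hψ)
    {L | ∃ (Q₁ : Matrix (Fin n) (Fin n) ℝ) (Q₂ : Matrix (Fin m) (Fin m) ℝ),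
      Q₁ * Q₁.transpose = 1 ∧ Q₂ * Q₂.transpose = 1 ∧ ∀ a, ψ (L a) = rotate Q₁ Q₂ (ψ a)} ?_ ?_ ?_
  · rintro L ⟨Q₁, Q₂, hQ₁, hQ₂, hL⟩ a
    rw [← hψ.bip_self, hL, bip_rotate hσ₁ hσ₂ hQ₁ hQ₂, hψ.bip_self]
  · rintro L ⟨Q₁, Q₂, hQ₁, hQ₂, hL⟩ a
    simp only [mem_preimage_tilde_iff hn hm hψ, hL, beval_rotate]
    refine ⟨fun h x hx y hy => ?_, fun h x hx y hy =>
      h _ (mulVec_mem_unitSphere hQ₁ hx) _ (mulVec_mem_unitSphere hQ₂ hy)⟩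
    have hT₁ : Q₁.transpose * Q₁.transpose.transpose = 1 := by
      rw [Matrix.transpose_transpose]; exact mul_eq_one_comm.1 hQ₁
    have hT₂ : Q₂.transpose * Q₂.transpose.transpose = 1 := by
      rw [Matrix.transpose_transpose]; exact mul_eq_one_comm.1 hQ₂
    have h1 := h _ (mulVec_mem_unitSphere hT₁ hx) _ (mulVec_mem_unitSphere hT₂ hy)
    rwa [Matrix.mulVec_mulVec, Matrix.mulVec_mulVec, hQ₁, hQ₂, Matrix.one_mulVec,
      Matrix.one_mulVec] at h1
  · intro a ha
    have hconst : ∀ x ∈ unitSphere n, ∀ y ∈ unitSphere m, ∀ x' ∈ unitSphere n,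
        ∀ y' ∈ unitSphere m, beval (ψ a) x' y' = beval (ψ a) x y := by
      intro x hx y hy x' hx' y' hy'
      obtain ⟨Q₁, hQ₁, e1⟩ := exists_orthogonal_mulVec_eq x x' (Eq.trans hx (Eq.symm hx'))
      obtain ⟨Q₂, hQ₂, e2⟩ := exists_orthogonal_mulVec_eq y y' (Eq.trans hy (Eq.symm hy'))
      obtain ⟨L, hL⟩ := exists_linearMap_eq_rotate hψ (isRotationStable_mSet hσ₁ hσ₂ k₁ k₂) hQ₁ hQ₂
      have h1 := congrArg ψ (ha L ⟨Q₁, Q₂, hQ₁, hQ₂, hL⟩)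
      rw [← e1, ← e2, ← beval_rotate, ← hL, h1]
    apply hψ.inj
    rw [map_zero]
    refine Biform.eq_zero_of_sphere hn hm (hψ.mem a).1 fun x hx y hy => ?_
    have h2 : bavg σ₁ σ₂ (ψ a) = bavg σ₁ σ₂ (C (beval (ψ a) x y)) :=
      bavg_congr hσ₁ hσ₂ fun x' hx' y' hy' => by
        rw [hconst x hx y hy x' hx' y' hy']; simp [beval]
    rw [(hψ.mem a).2] at h2
    simpa [bavg, beval] using h2.symm

end Symmetrization

section BernsteinBody
open BiformPaper Set Filter Topology
open scoped Pointwise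

variable {n m D k₁ k₂ : ℕ} {σ₁ : Measure (Fin n → ℝ)} {σ₂ : Measure (Fin m → ℝ)}
  {ψ : (Fin D → ℝ) →ₗ[ℝ] MvPolynomial (Fin n ⊕ Fin m) ℝ}

/-- The `x`-gradient at `(x, y)`, divided by `d`, in the coordinates given by `ψ`. -/
def gradientAt (d : ℝ) (ψ : (Fin D → ℝ) →ₗ[ℝ] MvPolynomial (Fin n ⊕ Fin m) ℝ) (x : Fin n → ℝ)
    (y : Fin m → ℝ) : (Fin D → ℝ) →ₗ[ℝ] EuclideanSpace ℝ (Fin n) :=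
  (WithLp.linearEquiv 2 ℝ (Fin n → ℝ)).symm.toLinearMap ∘ₗ
    LinearMap.pi fun i => d⁻¹ • (bevalₗ x y ∘ₗ (pderiv (Sum.inl i)).toLinearMap ∘ₗ ψ)

theorem norm_gradientAt_sq (d : ℝ) (x : Fin n → ℝ) (y : Fin m → ℝ) (a : Fin D → ℝ) :
    ‖gradientAt d ψ x y a‖ ^ 2 =
      (1 / d ^ 2) * ∑ i, beval (pderiv (Sum.inl i) (ψ a)) x y ^ 2 := by
  rw [EuclideanSpace.norm_sq_eq, Finset.mul_sum]
  refine Finset.sum_congr rfl fun i _ => ?_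
  rw [← bevalₗ_apply, Real.norm_eq_abs, sq_abs]
  change (d⁻¹ * bevalₗ x y (pderiv (Sum.inl i) (ψ a))) ^ 2 = _
  rw [mul_pow, inv_pow, one_div]

theorem continuous_norm_gradientAt_sq (d : ℝ) : Continuous
    fun q : (Fin D → ℝ) × ((Fin n → ℝ) × (Fin m → ℝ)) =>
      ‖gradientAt d ψ q.2.1 q.2.2 q.1‖ ^ 2 := by
  simp only [norm_gradientAt_sq]
  refine continuous_const.fun_mul (continuous_finsetSum _ fun i _ => Continuous.fun_pow ?_ 2)
  have e : ∀ q : (Fin D → ℝ) × ((Fin n → ℝ) × (Fin m → ℝ)),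
      beval (pderiv (Sum.inl i) (ψ q.1)) q.2.1 q.2.2 =
      ∑ j, q.1 j * evalVec ((pderiv (Sum.inl i)).toLinearMap ∘ₗ ψ) q.2.1 q.2.2 j := fun q =>
    beval_eq_sum_evalVec ((pderiv (Sum.inl i)).toLinearMap ∘ₗ ψ) q.1 q.2.1 q.2.2
  simp only [e]
  refine continuous_finsetSum _ fun j _ => Continuous.fun_mul (by fun_prop) ?_
  have h := ((continuous_apply j).comp
    (continuous_evalVec ((pderiv (Sum.inl i)).toLinearMap ∘ₗ ψ))).comp
    (continuous_snd (X := Fin D → ℝ))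
  exact h

theorem gradientForm_eq_integral (hσ₁ : IsSphereMeasure n σ₁) (hσ₂ : IsSphereMeasure m σ₂)
    (d : ℝ) (a : Fin D → ℝ) : (1 / d ^ 2) * gradientForm hσ₁ hσ₂ ψ a a =
      ∫ t, ‖gradientAt d ψ t.1 t.2 a‖ ^ 2 ∂σ₁.prod σ₂ := by
  simp only [norm_gradientAt_sq, gradientForm_apply, bip_eq hσ₁ hσ₂]
  rw [integral_const_mul, integral_finsetSum _ fun i _ =>
    hσ₁.integrable_prod hσ₂ ((continuous_beval _).fun_pow 2)]
  simp only [pow_two]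

theorem mem_preimage_tilde_inter_neg_iff (hn : 0 < n) (hm : 0 < m)
    (hψ : IsUnitaryParam n m D σ₁ σ₂ (MSet n m k₁ k₂ σ₁ σ₂) ψ) (a : Fin D → ℝ) :
    a ∈ ψ ⁻¹' tilde n m k₁ k₂ σ₁ σ₂ (PosSet n m k₁ k₂) ∩
        -(ψ ⁻¹' tilde n m k₁ k₂ σ₁ σ₂ (PosSet n m k₁ k₂)) ↔
      ∀ x ∈ unitSphere n, ∀ y ∈ unitSphere m, |beval (ψ a) x y| ≤ 1 := by
  have e : ∀ x y, beval (ψ (-a)) x y = - beval (ψ a) x y := fun x y => by simp [beval]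
  rw [mem_inter_iff, Set.mem_neg, mem_preimage_tilde_iff hn hm hψ,
    mem_preimage_tilde_iff hn hm hψ]
  simp only [e, abs_le, neg_le_neg_iff]
  exact ⟨fun h x hx y hy => ⟨h.1 x hx y hy, h.2 x hx y hy⟩,
    fun h => ⟨fun x hx y hy => (h x hx y hy).1, fun x hx y hy => (h x hx y hy).2⟩⟩

theorem setIntegral_gradientForm_le (hn : 0 < n) (hk₁ : 0 < k₁)
    (hσ₁ : IsSphereMeasure n σ₁) (hσ₂ : IsSphereMeasure m σ₂)
    (hψ : IsUnitaryParam n m D σ₁ σ₂ (MSet n m k₁ k₂ σ₁ σ₂) ψ) {K : Set (Fin D → ℝ)}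
    (hK : IsCompact K) (hKc : Convex ℝ K)
    (h : ∀ a, a ∈ K ↔ ∀ x ∈ unitSphere n, ∀ y ∈ unitSphere m, |beval (ψ a) x y| ≤ 1) :
    ∫ a in K, (1 / (2 * (k₁ : ℝ)) ^ 2) * gradientForm hσ₁ hσ₂ ψ a a ≤
      (n : ℝ) / (n + 2) * volume.real K := by
  have := hσ₁.prob; have := hσ₂.prob
  have hKs : ∀ a ∈ K, -a ∈ K := fun a ha => (h _).2 fun x hx y hy => by
    have e : beval (ψ (-a)) x y = - beval (ψ a) x y := by simp [beval]
    rw [e, abs_neg]; exact (h a).1 ha x hx y hy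
  simp only [gradientForm_eq_integral]
  have : IsFiniteMeasure (volume.restrict K) := ⟨by
    rw [Measure.restrict_apply_univ]; exact hK.measure_lt_top⟩
  have hT := isCompact_sphereProd n m
  have h_int : Integrable (fun q : (Fin D → ℝ) × ((Fin n → ℝ) × (Fin m → ℝ)) =>
      ‖gradientAt (2 * (k₁ : ℝ)) ψ q.2.1 q.2.2 q.1‖ ^ 2)
      ((volume.restrict K).prod (σ₁.prod σ₂)) := by
    rw [← Measure.restrict_eq_self_of_ae_mem (hσ₁.ae_mem_prod hσ₂), Measure.prod_restrict]
    exact ContinuousOn.integrableOn_compact (hK.prod hT)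
      (continuous_norm_gradientAt_sq _).continuousOn
  rw [integral_integral_swap h_int]
  have hle : ∀ t ∈ unitSphere n ×ˢ unitSphere m,
      ∫ a in K, ‖gradientAt (2 * (k₁ : ℝ)) ψ t.1 t.2 a‖ ^ 2 ≤
        (n : ℝ) / (n + 2) * volume.real K := by
    intro t ht
    refine setIntegral_norm_sq_le hK hKc hKs _ fun a ha => ?_
    rw [← sq_le_one_iff₀ (norm_nonneg _), norm_gradientAt_sq]
    have h1 := sum_sq_beval_pderiv_le hn (by omega) (hψ.mem a).1 ((h a).1 ha) ht.1 ht.2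
    push_cast at h1
    rw [one_div, inv_mul_le_iff₀ (by positivity), mul_one]
    exact h1
  calc _ ≤ ∫ _, (n : ℝ) / (n + 2) * volume.real K ∂σ₁.prod σ₂ := by
        refine integral_mono_ae h_int.integral_prod_right (integrable_const _) ?_
        filter_upwards [hσ₁.ae_mem_prod hσ₂] with t ht using hle t ht
    _ = _ := by simp

theorem volume_preimage_tilde_le (hn : 0 < n) (hm : 0 < m) (hk₁ : 0 < k₁)
    (hσ₁ : IsSphereMeasure n σ₁) (hσ₂ : IsSphereMeasure m σ₂) (hD : 0 < D)
    (hψ : IsUnitaryParam n m D σ₁ σ₂ (MSet n m k₁ k₂ σ₁ σ₂) ψ) :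
    ∃ s : ℕ, s + 1 ≤ (m + 2 * k₂ - 1).choose (2 * k₂) ∧
      volume (ψ ⁻¹' tilde n m k₁ k₂ σ₁ σ₂ (PosSet n m k₁ k₂)) ≤
        2 ^ D * ENNReal.ofReal (((n : ℝ) / (n + 2) * (D + 2) / D) ^ ((D : ℝ) / 2) *
          (Real.sqrt ((1 + n / (2 * (k₁ : ℝ) ^ 2)) ^ (D - s)))⁻¹) *
          volume {a : Fin D → ℝ | ∑ i, a i ^ 2 ≤ 1} := by
  obtain ⟨T, s, hs, hT, hTG⟩ :=
    exists_linearMap_sum_sq_le_gradientForm hn hm hk₁ hσ₁ hσ₂ hψ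
  refine ⟨s, hs, ?_⟩
  have hpos : (0 : ℝ) < (1 + n / (2 * (k₁ : ℝ) ^ 2)) ^ (D - s) := by positivity
  have hT0 : LinearMap.det T ≠ 0 := fun h0 => by rw [h0] at hT; simp at hT; linarith
  have hTabs : |(LinearMap.det T)⁻¹| = (Real.sqrt ((1 + n / (2 * (k₁ : ℝ) ^ 2)) ^ (D - s)))⁻¹ := by
    rw [← hT, Real.sqrt_sq_eq_abs, abs_inv]
  have hKcpt := isCompact_preimage_tilde_posSet hn hm hσ₁ hσ₂ hψ
  have hKc := convex_preimage_tilde_posSet hn hm hψ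
  have hK'cpt := hKcpt.inter_right hKcpt.neg.isClosed
  have h1 := setIntegral_gradientForm_le hn hk₁ hσ₁ hσ₂ hψ hK'cpt (hKc.inter hKc.neg)
    (mem_preimage_tilde_inter_neg_iff hn hm hψ)
  have hcont : Continuous fun a => (1 / (2 * (k₁ : ℝ)) ^ 2) * gradientForm hσ₁ hσ₂ ψ a a := by
    have e : (fun a => gradientForm hσ₁ hσ₂ ψ a a) =
        fun a => ∑ i, a i * ∑ j, a j * gradientForm hσ₁ hσ₂ ψ (Pi.single i 1) (Pi.single j 1) := by
      ext a
      have ha : a = ∑ i, a i • (Pi.single i 1 : Fin D → ℝ) := by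
        ext j; simp [Finset.sum_apply, Pi.single_apply]
      have h2 : ∀ b, gradientForm hσ₁ hσ₂ ψ b a =
          ∑ j, a j * gradientForm hσ₁ hσ₂ ψ b (Pi.single j 1) := fun b => by
        conv_lhs => rw [ha]
        simp
      have h3 : gradientForm hσ₁ hσ₂ ψ a a =
          gradientForm hσ₁ hσ₂ ψ (∑ i, a i • (Pi.single i 1 : Fin D → ℝ)) a := by rw [← ha]
      rw [h3, map_sum, LinearMap.sum_apply]
      simp [h2]
    refine continuous_const.fun_mul ?_
    rw [e]
    fun_prop
  have h2 := volume_le_of_setIntegral_le hcont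
    (fun a => (Finset.sum_nonneg fun i _ => sq_nonneg _).trans (hTG a))
    (fun t a => by simp only [map_smul, LinearMap.smul_apply, smul_eq_mul]; ring) hD hK'cpt
    (by positivity) h1
  have h3 := volume_sublevel_le_of_le T hT0 hTG
  calc _ ≤ _ := volume_preimage_tilde_le_two_pow_mul hn hm hσ₁ hσ₂ hψ
    _ ≤ 2 ^ D * (ENNReal.ofReal (((n : ℝ) / (n + 2) * (D + 2) / D) ^ ((D : ℝ) / 2)) *
        (ENNReal.ofReal |(LinearMap.det T)⁻¹| *
      volume {a : Fin D → ℝ | ∑ i, a i ^ 2 ≤ 1})) := by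
        refine mul_le_mul_right (h2.trans (mul_le_mul_right h3 _)) _
    _ = _ := by
        rw [hTabs, ENNReal.ofReal_mul (by positivity)]
        ring

end BernsteinBody

section UpperBound
open BiformPaper Set Filter Topology

variable {n m D k₁ k₂ : ℕ} {σ₁ : Measure (Fin n → ℝ)} {σ₂ : Measure (Fin m → ℝ)}
  {ψ : (Fin D → ℝ) →ₗ[ℝ] MvPolynomial (Fin n ⊕ Fin m) ℝ}

theorem mul_succ_le_two_mul_choose {n k : ℕ} (hn : 0 < n) (hk : 0 < k) :
    n * (n + 1) ≤ 2 * (n + 2 * k - 1).choose (2 * k) := by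
  obtain ⟨p, rfl⟩ : ∃ p, n = p + 1 := ⟨n - 1, by omega⟩
  have e : p + 1 + 2 * k - 1 = p + 2 * k := by omega
  rw [e, ← Nat.choose_symm_add]
  have h1 : (p + 2).choose p ≤ (p + 2 * k).choose p := Nat.choose_le_choose p (by omega)
  have h2 : (p + 2).choose p = (p + 2).choose 2 := Nat.choose_symm_add
  have h3 : (p + 2) * (p + 1) = 2 * (p + 2).choose 2 := by
    have := Nat.add_one_mul_choose_eq (p + 1) 1
    rw [Nat.choose_one_right] at this
    rw [mul_comm 2]; exact this
  rw [h2] at h1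
  have : (p + 1) * (p + 1 + 1) = (p + 2) * (p + 1) := by ring
  omega

theorem pow_le_inv_pow_of_dim {n N E D s : ℕ} {r : ℝ} (hn : 0 < n)
    (hN : n * (n + 1) ≤ 2 * N) (hs : s + 1 ≤ E) (hD : D = N * E - 1) (hD2 : 2 ≤ D)
    (hr1 : 1 ≤ r) (hr : r ≤ 1 + n / 2) :
    r ^ s ≤ (((n : ℝ) / (n + 2) * (D + 2) / D)⁻¹) ^ D := by
  have hn' : (0 : ℝ) < n := by exact_mod_cast hn
  have hD' : (0 : ℝ) < D := by exact_mod_cast (by omega : 0 < D)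
  have hNpos : 0 < N := by nlinarith
  have hρ : ((n : ℝ) / (n + 2) * (D + 2) / D)⁻¹ = (n + 2) * D / (n * (D + 2)) := by
    field_simp
  rw [hρ]
  rcases Nat.lt_or_ge E 2 with hE | hE
  · obtain rfl : s = 0 := by omega
    obtain rfl : E = 1 := by omega
    have hnD : n ≤ D := by
      rcases Nat.lt_or_ge n 2 with h | h
      · omega
      · have : n * 3 ≤ n * (n + 1) := Nat.mul_le_mul_left _ (by omega)
        omega
    rw [pow_zero]
    refine one_le_pow₀ ?_
    rw [one_le_div (by positivity)]
    have : (n : ℝ) ≤ D := by exact_mod_cast hnD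
    nlinarith
  · have hnD : 2 * n ≤ D := by
      have h2 : N * 2 ≤ N * E := Nat.mul_le_mul_left _ hE
      rcases Nat.lt_or_ge n 2 with h | h
      · omega
      · have : n * 3 ≤ n * (n + 1) := Nat.mul_le_mul_left _ (by omega)
        omega
    have hnD' : 2 * (n : ℝ) ≤ D := by exact_mod_cast hnD
    have hβ : 1 + 1 / ((n : ℝ) + 1) ≤ (n + 2) * D / (n * (D + 2)) := by
      rw [le_div_iff₀ (by positivity), one_add_div (by positivity), div_mul_eq_mul_div,
        div_le_iff₀ (by positivity)]
      nlinarith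
    have hβ1 : 1 ≤ 1 + 1 / ((n : ℝ) + 1) := by
      have : (0 : ℝ) ≤ 1 / ((n : ℝ) + 1) := by positivity
      linarith
    have hrβ : r ≤ (1 + 1 / ((n : ℝ) + 1)) ^ N := by
      have hN' : (n : ℝ) * (n + 1) ≤ 2 * N := by exact_mod_cast hN
      have h1 := one_add_mul_le_pow (a := 1 / ((n : ℝ) + 1))
        (by have : (0 : ℝ) ≤ 1 / ((n : ℝ) + 1) := by positivity
            linarith) N
      refine hr.trans (le_trans ?_ h1)
      rw [add_le_add_iff_left, mul_one_div, div_le_div_iff₀ (by positivity) (by positivity)]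
      linarith
    have hNs : N * s ≤ D := by
      have : N * (s + 1) ≤ N * E := Nat.mul_le_mul_left _ hs
      rw [mul_add] at this
      omega
    calc r ^ s ≤ ((1 + 1 / ((n : ℝ) + 1)) ^ N) ^ s := by gcongr
      _ = (1 + 1 / ((n : ℝ) + 1)) ^ (N * s) := (pow_mul _ _ _).symm
      _ ≤ (1 + 1 / ((n : ℝ) + 1)) ^ D := pow_le_pow_right₀ hβ1 hNs
      _ ≤ _ := by gcongr

theorem rpow_volume_ratio_le (hn : 0 < n) (hm : 0 < m) (hk₁ : 0 < k₁)
    (hσ₁ : IsSphereMeasure n σ₁) (hσ₂ : IsSphereMeasure m σ₂)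
    (hD : D = Nat.choose (n + 2 * k₁ - 1) (2 * k₁) * Nat.choose (m + 2 * k₂ - 1) (2 * k₂) - 1)
    (hD2 : 2 ≤ D) (hψ : IsUnitaryParam n m D σ₁ σ₂ (MSet n m k₁ k₂ σ₁ σ₂) ψ) :
    (volume (⇑ψ ⁻¹' tilde n m k₁ k₂ σ₁ σ₂ (PosSet n m k₁ k₂)) /
        volume (⇑ψ ⁻¹' bball n m k₁ k₂ σ₁ σ₂)) ^ ((1 : ℝ) / (D : ℝ)) ≤
      ENNReal.ofReal (2 * Real.sqrt ((2 * (k₁ : ℝ) ^ 2) / (2 * (k₁ : ℝ) ^ 2 + (n : ℝ)))) := by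
  obtain ⟨s, hs, hvol⟩ := volume_preimage_tilde_le hn hm hk₁ hσ₁ hσ₂ (by omega) hψ
  have hk1 : (1 : ℝ) ≤ k₁ := by exact_mod_cast hk₁
  have hD' : (0 : ℝ) < D := by exact_mod_cast (by omega : 0 < D)
  have hN := mul_succ_le_two_mul_choose (n := n) hn hk₁
  set r : ℝ := 1 + n / (2 * (k₁ : ℝ) ^ 2) with hr
  have hr1 : 1 ≤ r := by
    have : (0 : ℝ) ≤ n / (2 * (k₁ : ℝ) ^ 2) := by positivity
    linarith
  have hr2 : r ≤ 1 + n / 2 := by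
    rw [hr, add_le_add_iff_left]
    gcongr
    nlinarith
  have hsD : s ≤ D := by
    have h1 : 1 * (m + 2 * k₂ - 1).choose (2 * k₂) ≤ (n + 2 * k₁ - 1).choose (2 * k₁) *
        (m + 2 * k₂ - 1).choose (2 * k₂) := Nat.mul_le_mul_right _ (by nlinarith)
    omega
  have hkey := pow_le_inv_pow_of_dim hn hN hs hD hD2 hr1 hr2
  have hrinv : (2 * (k₁ : ℝ) ^ 2) / (2 * (k₁ : ℝ) ^ 2 + (n : ℝ)) = r⁻¹ := by
    rw [hr]; field_simp
  set ρ : ℝ := (n : ℝ) / (n + 2) * (D + 2) / D with hρdef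
  have hn' : (0 : ℝ) < n := by exact_mod_cast hn
  have hρ : 0 < ρ := by positivity
  have hr0 : 0 < r := by linarith
  rw [hrinv]
  have hreal : ρ ^ ((D : ℝ) / 2) * (Real.sqrt (r ^ (D - s)))⁻¹ ≤ (Real.sqrt r⁻¹) ^ D := by
    have e1 : ρ ^ ((D : ℝ) / 2) = Real.sqrt (ρ ^ D) := by
      rw [Real.sqrt_eq_rpow, ← Real.rpow_natCast, ← Real.rpow_mul hρ.le]
      congr 1; ring
    have e2 : (Real.sqrt r⁻¹) ^ D = Real.sqrt (r⁻¹ ^ D) := by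
      rw [Real.sqrt_eq_rpow, Real.sqrt_eq_rpow, ← Real.rpow_natCast, ← Real.rpow_natCast,
        ← Real.rpow_mul (by positivity), ← Real.rpow_mul (by positivity), mul_comm]
    rw [e1, e2, ← Real.sqrt_inv, ← Real.sqrt_mul (by positivity)]
    refine Real.sqrt_le_sqrt ?_
    rw [inv_pow, ← div_eq_mul_inv, div_le_iff₀ (by positivity), inv_mul_eq_div,
      le_div_iff₀ (by positivity)]
    have e3 : r ^ D = r ^ (D - s) * r ^ s := by rw [← pow_add]; congr 1; omega
    rw [e3, mul_left_comm]
    refine mul_le_of_le_one_right (by positivity) ?_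
    calc ρ ^ D * r ^ s ≤ ρ ^ D * (ρ⁻¹) ^ D := by gcongr
      _ = 1 := by rw [← mul_pow, mul_inv_cancel₀ hρ.ne', one_pow]
  rw [preimage_bball_eq hψ]
  have hratio : volume (⇑ψ ⁻¹' tilde n m k₁ k₂ σ₁ σ₂ (PosSet n m k₁ k₂)) /
      volume {a : Fin D → ℝ | ∑ i, a i ^ 2 ≤ 1} ≤
      ENNReal.ofReal (2 * Real.sqrt r⁻¹) ^ D := by
    refine ENNReal.div_le_of_le_mul (hvol.trans ?_)
    refine mul_le_mul_left ?_ _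
    rw [ENNReal.ofReal_mul zero_le_two, mul_pow, ENNReal.ofReal_ofNat,
      ← ENNReal.ofReal_pow (Real.sqrt_nonneg _)]
    exact mul_le_mul_right (ENNReal.ofReal_le_ofReal hreal) _
  calc _ ≤ (ENNReal.ofReal (2 * Real.sqrt r⁻¹) ^ D) ^ ((1 : ℝ) / (D : ℝ)) :=
        ENNReal.rpow_le_rpow hratio (by positivity)
    _ = _ := by
      rw [← ENNReal.rpow_natCast, ← ENNReal.rpow_mul, mul_one_div_cancel hD'.ne',
        ENNReal.rpow_one]

theorem rename_swap_mem_biform {d₁ d₂ : ℕ} {f : MvPolynomial (Fin n ⊕ Fin m) ℝ}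
    (hf : f ∈ Biform n m d₁ d₂) : rename Sum.swap f ∈ Biform m n d₂ d₁ := by
  intro d hd
  obtain ⟨u, rfl, hu⟩ := coeff_rename_ne_zero _ _ _ hd
  have h := hf hu
  rw [Finsupp.weight_apply, Finsupp.sum_mapDomain_index (by simp) (by intros; rw [add_smul])]
  rw [Finsupp.weight_apply] at h
  have e : ∀ i, bw m n (Sum.swap i) = (bw n m i).swap := by rintro (i | i) <;> rfl
  rw [Finsupp.sum] at h ⊢
  have h1 := congrArg Prod.fst h
  have h2 := congrArg Prod.snd h
  simp only [Prod.fst_sum, Prod.snd_sum, Prod.smul_fst, Prod.smul_snd] at h1 h2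
  ext <;> simp only [e, Prod.fst_sum, Prod.snd_sum, Prod.smul_fst, Prod.smul_snd,
    Prod.fst_swap, Prod.snd_swap, h1, h2]

theorem beval_rename_swap (f : MvPolynomial (Fin n ⊕ Fin m) ℝ) (x : Fin n → ℝ) (y : Fin m → ℝ) :
    beval (rename Sum.swap f) y x = beval f x y := by
  have h : Sum.elim y x ∘ Sum.swap = Sum.elim x y := by ext (i | i) <;> rfl
  rw [beval, eval_rename, beval, h]

theorem bip_rename_swap (hσ₁ : IsSphereMeasure n σ₁) (hσ₂ : IsSphereMeasure m σ₂)
    (f g : MvPolynomial (Fin n ⊕ Fin m) ℝ) :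
    bip σ₂ σ₁ (rename Sum.swap f) (rename Sum.swap g) = bip σ₁ σ₂ f g := by
  have := hσ₁.prob; have := hσ₂.prob
  rw [bip_eq hσ₂ hσ₁, bip_eq hσ₁ hσ₂, ← integral_prod_swap]
  simp only [beval_rename_swap, Prod.fst_swap, Prod.snd_swap]

theorem bavg_rename_swap (hσ₁ : IsSphereMeasure n σ₁) (hσ₂ : IsSphereMeasure m σ₂)
    (f : MvPolynomial (Fin n ⊕ Fin m) ℝ) :
    bavg σ₂ σ₁ (rename Sum.swap f) = bavg σ₁ σ₂ f := by
  have := hσ₁.prob; have := hσ₂.prob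
  rw [bavg_eq hσ₂ hσ₁, bavg_eq hσ₁ hσ₂, ← integral_prod_swap]
  simp only [beval_rename_swap, Prod.fst_swap, Prod.snd_swap]

theorem BiformPaper.IsUnitaryParam.swap (hσ₁ : IsSphereMeasure n σ₁)
    (hσ₂ : IsSphereMeasure m σ₂)
    (hψ : IsUnitaryParam n m D σ₁ σ₂ (MSet n m k₁ k₂ σ₁ σ₂) ψ) :
    IsUnitaryParam m n D σ₂ σ₁ (MSet m n k₂ k₁ σ₂ σ₁)
      ((rename (R := ℝ) (Sum.swap : Fin n ⊕ Fin m → Fin m ⊕ Fin n)).toLinearMap ∘ₗ ψ) where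
  inj := (rename_injective _ Sum.swap_leftInverse.injective).comp hψ.inj
  range := by
    ext f
    constructor
    · rintro ⟨a, rfl⟩
      exact ⟨rename_swap_mem_biform (hψ.mem a).1,
        (bavg_rename_swap hσ₁ hσ₂ (ψ a)).trans (hψ.mem a).2⟩
    · intro hf
      have h : rename Sum.swap f ∈ Set.range ψ := by
        rw [hψ.range]
        exact ⟨rename_swap_mem_biform hf.1, (bavg_rename_swap hσ₂ hσ₁ f).trans hf.2⟩
      obtain ⟨a, ha⟩ := h
      refine ⟨a, ?_⟩
      change rename Sum.swap (ψ a) = f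
      rw [ha, rename_rename, Sum.swap_swap_eq, rename_id_apply]
  ip a b := (bip_rename_swap hσ₁ hσ₂ (ψ a) (ψ b)).trans (hψ.ip a b)

theorem rpow_volume_ratio_le_min (hn : 0 < n) (hm : 0 < m) (hk₁ : 0 < k₁) (hk₂ : 0 < k₂)
    (hσ₁ : IsSphereMeasure n σ₁) (hσ₂ : IsSphereMeasure m σ₂)
    (hD : D = Nat.choose (n + 2 * k₁ - 1) (2 * k₁) * Nat.choose (m + 2 * k₂ - 1) (2 * k₂) - 1)
    (hD2 : 2 ≤ D) (hψ : IsUnitaryParam n m D σ₁ σ₂ (MSet n m k₁ k₂ σ₁ σ₂) ψ) :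
    (volume (⇑ψ ⁻¹' tilde n m k₁ k₂ σ₁ σ₂ (PosSet n m k₁ k₂)) /
        volume (⇑ψ ⁻¹' bball n m k₁ k₂ σ₁ σ₂)) ^ ((1 : ℝ) / (D : ℝ)) ≤
      ENNReal.ofReal (2 * Real.sqrt (min
        ((2 * (k₁ : ℝ) ^ 2) / (2 * (k₁ : ℝ) ^ 2 + (n : ℝ)))
        ((2 * (k₂ : ℝ) ^ 2) / (2 * (k₂ : ℝ) ^ 2 + (m : ℝ))))) := by
  rcases min_choice ((2 * (k₁ : ℝ) ^ 2) / (2 * (k₁ : ℝ) ^ 2 + (n : ℝ)))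
    ((2 * (k₂ : ℝ) ^ 2) / (2 * (k₂ : ℝ) ^ 2 + (m : ℝ))) with h | h
  · rw [h]; exact rpow_volume_ratio_le hn hm hk₁ hσ₁ hσ₂ hD hD2 hψ
  · rw [h]
    have hψ' := hψ.swap hσ₁ hσ₂
    have h1 := rpow_volume_ratio_le hm hn hk₂ hσ₂ hσ₁ (by rw [hD, mul_comm]) hD2 hψ'
    rw [preimage_bball_eq hψ'] at h1
    rw [preimage_bball_eq hψ]
    convert! h1 using 4
    ext a
    rw [mem_preimage_tilde_iff hn hm hψ, mem_preimage_tilde_iff hm hn hψ']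
    have e : ∀ x y, beval (((rename (R := ℝ) (Sum.swap : Fin n ⊕ Fin m → Fin m ⊕ Fin n)).toLinearMap
        ∘ₗ ψ) a) y x = beval (ψ a) x y := beval_rename_swap (ψ a)
    simp only [e]
    exact ⟨fun h y hy x hx => h x hx y hy, fun h x hx y hy => h y hy x hx⟩

end UpperBound

open BiformPaper in
/-- **Theorem (bounds on the volume of the section of nonnegative biforms).**
For positive integers `n, m, k₁, k₂` (with `D_𝓜 ≥ 1`):
`c_{2k₁,2k₂} ≤ (Vol P̃os / Vol B_𝓜)^{1/D_𝓜} ≤ 2·min(2k₁²/(2k₁²+n), 2k₂²/(2k₂²+m))^{1/2}`. -/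
theorem statement1 (n m k₁ k₂ : ℕ) (hn : 0 < n) (hm : 0 < m) (hk₁ : 0 < k₁) (hk₂ : 0 < k₂)
    (D : ℕ)
    (hD : D = Nat.choose (n + 2 * k₁ - 1) (2 * k₁) * Nat.choose (m + 2 * k₂ - 1) (2 * k₂) - 1)
    (hD1 : 1 ≤ D)
    (σ₁ : Measure (Fin n → ℝ)) (σ₂ : Measure (Fin m → ℝ))
    (hσ₁ : IsSphereMeasure n σ₁) (hσ₂ : IsSphereMeasure m σ₂)
    (ψ : (Fin D → ℝ) →ₗ[ℝ] MvPolynomial (Fin n ⊕ Fin m) ℝ)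
    (hψ : IsUnitaryParam n m D σ₁ σ₂ (MSet n m k₁ k₂ σ₁ σ₂) ψ) :
    ENNReal.ofReal
        (if k₁ = 1 ∧ k₂ = 1 then
          (3 : ℝ) ^ 3 * (10 : ℝ) ^ (-(20 : ℝ) / 9) * ((max n m : ℕ) : ℝ) ^ (-(1 : ℝ) / 2)
        else
          Real.exp (-3) *
            ((2 : ℝ) * (⌈((max n m : ℕ) : ℝ) * Real.log (2 * ((max k₁ k₂ : ℕ) : ℝ) + 1)⌉ : ℝ))
              ^ (-(1 : ℝ) / 2)) ≤
      (volume (⇑ψ ⁻¹' tilde n m k₁ k₂ σ₁ σ₂ (PosSet n m k₁ k₂)) /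
          volume (⇑ψ ⁻¹' bball n m k₁ k₂ σ₁ σ₂)) ^ ((1 : ℝ) / (D : ℝ)) ∧
    (volume (⇑ψ ⁻¹' tilde n m k₁ k₂ σ₁ σ₂ (PosSet n m k₁ k₂)) /
        volume (⇑ψ ⁻¹' bball n m k₁ k₂ σ₁ σ₂)) ^ ((1 : ℝ) / (D : ℝ)) ≤
      ENNReal.ofReal (2 * Real.sqrt (min
        ((2 * (k₁ : ℝ) ^ 2) / (2 * (k₁ : ℝ) ^ 2 + (n : ℝ)))
        ((2 * (k₂ : ℝ) ^ 2) / (2 * (k₂ : ℝ) ^ 2 + (m : ℝ))))) := by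
  have hD2 : 2 ≤ D ∧ 2 ≤ max n m := by
    have h1 : 1 ≤ (n + 2 * k₁ - 1).choose (2 * k₁) := Nat.choose_pos (by omega)
    have h2 : 1 ≤ (m + 2 * k₂ - 1).choose (2 * k₂) := Nat.choose_pos (by omega)
    rcases Nat.lt_or_ge n 2 with h | h
    · rcases Nat.lt_or_ge m 2 with h' | h'
      · obtain rfl : n = 1 := by omega
        obtain rfl : m = 1 := by omega
        simp at hD
        omega
      · have h3 := three_le_choose_of_two_le h' hk₂
        have := Nat.mul_le_mul h1 h3
        exact ⟨by omega, h'.trans (le_max_right _ _)⟩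
    · have h3 := three_le_choose_of_two_le h hk₁
      have := Nat.mul_le_mul h3 h2
      exact ⟨by omega, h.trans (le_max_left _ _)⟩
  refine ⟨?_, rpow_volume_ratio_le_min hn hm hk₁ hk₂ hσ₁ hσ₂ hD hD2.1 hψ⟩
  split_ifs with h
  · obtain ⟨rfl, rfl⟩ := h
    exact ofReal_ten_rpow_le_rpow_volume_ratio hn hm hD2.2 hσ₁ hσ₂ hD2.1 hψ
  · exact ofReal_exp_le_rpow_volume_ratio hn hm hk₁ hσ₁ hσ₂ hD2.1 hψ
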